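/- arXiv:math/0401090 — 8 statements merged into one kernel-verified Lean document; each statement's English description precedes it below -/
import Mathlib

section
/- Let n ≥ 1, h ≥ 0 with n ≡ h (mod 2), and let j ≥ 0, with j ≥ 1 in case h = 0. Then the number of nonnegative lattice paths of length n ending at height h (i.e. p(n) = h) and having exactly j returns equals C(n−(j+1), (n+h)/2 − 1) − C(n−(j+1), (n+h)/2), where C(a,b) denotes the binomial coefficient (taken to be 0 when b < 0 or b > a). -/
/-- A nonnegative lattice path of length `n`: `p 0 = 0`, each step is `±1`,
and the path never goes below the x-axis. -/
def IsLatticePath (n : ℕ) (p : Fin (n + 1) → ℤ) : Prop :=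
  p 0 = 0 ∧ (∀ k : Fin n, |p k.succ - p k.castSucc| = 1) ∧ ∀ k, 0 ≤ p k

/-- The number of returns of a path: indices `1 ≤ k ≤ n` with `p k = 0`. -/
def numReturns (n : ℕ) (p : Fin (n + 1) → ℤ) : ℕ :=
  (Finset.univ.filter (fun k : Fin (n + 1) => k ≠ 0 ∧ p k = 0)).card

/-- Binomial coefficient `C(a, b)` for integers, taken to be `0` when
`b < 0` or `b > a`. -/
def intBinom (a b : ℤ) : ℤ :=
  if 0 ≤ b ∧ b ≤ a then (a.toNat.choose b.toNat : ℤ) else 0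

/-- The set of paths being counted. -/
def pathSet (n : ℕ) (h : ℤ) (j : ℕ) : Set (Fin (n + 1) → ℤ) :=
  {p | IsLatticePath n p ∧ p (Fin.last n) = h ∧ numReturns n p = j}

lemma numReturns_snoc (n : ℕ) (p : Fin (n + 1) → ℤ) (x : ℤ) :
    numReturns (n + 1) (Fin.snoc (α := fun _ => ℤ) p x) =
      numReturns n p + if x = 0 then 1 else 0 := by
  unfold numReturns
  rw [Finset.card_filter, Finset.card_filter, Fin.sum_univ_castSucc]
  simp [Fin.snoc_castSucc, Fin.snoc_last]

lemma isLatticePath_snoc (n : ℕ) (p : Fin (n + 1) → ℤ) (x : ℤ) :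
    IsLatticePath (n + 1) (Fin.snoc (α := fun _ => ℤ) p x) ↔
      IsLatticePath n p ∧ |x - p (Fin.last n)| = 1 ∧ 0 ≤ x := by
  unfold IsLatticePath
  have h0 : (Fin.snoc (α := fun _ => ℤ) p x : Fin (n + 2) → ℤ) 0 = p 0 :=
    Fin.snoc_castSucc (α := fun _ => ℤ) x p 0
  rw [h0, Fin.forall_fin_succ' (n := n), Fin.forall_fin_succ' (n := n + 1)]
  simp only [Fin.succ_castSucc, Fin.snoc_castSucc, Fin.succ_last, Fin.snoc_last]
  tauto

lemma snoc_inj (n : ℕ) (x : ℤ) :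
    Function.Injective (fun p : Fin (n + 1) → ℤ => (Fin.snoc (α := fun _ => ℤ) p x : Fin (n + 2) → ℤ)) := by
  intro p q hpq
  funext i
  have := congrFun hpq i.castSucc
  simpa [Fin.snoc_castSucc] using this

lemma pathSet_succ (n : ℕ) (h : ℤ) (j : ℕ) (hh : 0 ≤ h) :
    pathSet (n + 1) h (j + if h = 0 then 1 else 0) =
      (fun p : Fin (n + 1) → ℤ => (Fin.snoc (α := fun _ => ℤ) p h : Fin (n + 2) → ℤ)) ''
        (pathSet n (h - 1) j ∪ pathSet n (h + 1) j) := by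
  ext q
  constructor
  · rintro ⟨h1, h2, h3⟩
    have hq : (Fin.snoc (α := fun _ => ℤ) (Fin.init q) h : Fin (n + 2) → ℤ) = q := by
      rw [← h2]; exact Fin.snoc_init_self q
    rw [← hq] at h1 h3
    rw [numReturns_snoc] at h3
    rw [isLatticePath_snoc] at h1
    obtain ⟨a, b, c⟩ := h1
    refine ⟨Fin.init q, ?_, hq⟩
    have h3' : numReturns n (Fin.init q) = j := by omega
    rcases (abs_eq (by norm_num)).1 b with b | b
    · left; exact ⟨a, by omega, h3'⟩
    · right; exact ⟨a, by omega, h3'⟩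
  · rintro ⟨p, hp, rfl⟩
    refine ⟨?_, by simp, ?_⟩
    · rw [isLatticePath_snoc]
      rcases hp with ⟨a, b, c⟩ | ⟨a, b, c⟩
      · exact ⟨a, by rw [b]; simp, hh⟩
      · exact ⟨a, by rw [b]; simp, hh⟩
    · rw [numReturns_snoc]
      rcases hp with ⟨a, b, c⟩ | ⟨a, b, c⟩ <;> rw [c]

lemma pathSet_neg (n : ℕ) (h : ℤ) (j : ℕ) (hh : h < 0) : pathSet n h j = ∅ := by
  ext p
  simp only [Set.mem_empty_iff_false, iff_false]
  rintro ⟨⟨_, _, a⟩, b, _⟩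
  have := a (Fin.last n)
  omega

lemma pathSet_zero_zero (n : ℕ) : pathSet (n + 1) 0 0 = ∅ := by
  ext p
  simp only [Set.mem_empty_iff_false, iff_false]
  rintro ⟨_, b, c⟩
  unfold numReturns at c
  rw [Finset.card_eq_zero] at c
  have : Fin.last (n + 1) ∈ (∅ : Finset (Fin (n + 2))) := by
    rw [← c]; simp [b]
  simp at this

lemma pathSet_finite (n : ℕ) : ∀ (h : ℤ) (j : ℕ), (pathSet n h j).Finite := by
  induction n with
  | zero =>
    intro h j
    refine (Set.finite_singleton (fun _ => h)).subset ?_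
    rintro p ⟨_, b, _⟩
    have : p = fun _ => h := by
      funext i
      rw [← b]; congr 1; exact Subsingleton.elim (α := Fin 1) _ _
    exact this
  | succ n ih =>
    intro h j
    rcases lt_or_ge h 0 with hh | hh
    · rw [pathSet_neg _ _ _ hh]; exact Set.finite_empty
    · by_cases h0 : h = 0
      · rcases j with _ | j
        · rw [h0, pathSet_zero_zero]; exact Set.finite_empty
        · have := pathSet_succ n h j hh
          rw [if_pos h0] at this
          rw [this]
          exact ((ih _ _).union (ih _ _)).image _
      · have := pathSet_succ n h j hh
        rw [if_neg h0] at this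
        rw [add_zero] at this
        rw [this]
        exact ((ih _ _).union (ih _ _)).image _

lemma ncard_succ (n : ℕ) (h : ℤ) (j : ℕ) (hh : 0 ≤ h) :
    (pathSet (n + 1) h (j + if h = 0 then 1 else 0)).ncard =
      (pathSet n (h - 1) j).ncard + (pathSet n (h + 1) j).ncard := by
  rw [pathSet_succ _ _ _ hh, Set.ncard_image_of_injective _ (snoc_inj n h),
    Set.ncard_union_eq _ (pathSet_finite _ _ _) (pathSet_finite _ _ _)]
  rw [Set.disjoint_left]
  rintro p ⟨_, a, _⟩ ⟨_, b, _⟩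
  omega

lemma ncard_base (h : ℤ) (j : ℕ) :
    (pathSet 0 h j).ncard = if h = 0 ∧ j = 0 then 1 else 0 := by
  have key : ∀ p : Fin 1 → ℤ, numReturns 0 p = 0 := by
    intro p
    unfold numReturns
    rw [Finset.card_eq_zero, Finset.filter_eq_empty_iff]
    intro x _ hx
    exact hx.1 (Subsingleton.elim (α := Fin 1) _ _)
  split_ifs with hc
  · obtain ⟨rfl, rfl⟩ := hc
    rw [Set.ncard_eq_one]
    refine ⟨fun _ => 0, ?_⟩
    ext p
    simp only [Set.mem_singleton_iff]
    constructor
    · rintro ⟨⟨a, _⟩, _⟩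
      funext i
      rw [← a]; congr 1; exact Subsingleton.elim (α := Fin 1) _ _
    · rintro rfl
      exact ⟨⟨rfl, fun k => k.elim0, fun _ => le_rfl⟩, rfl, key _⟩
  · rw [Set.ncard_eq_zero (pathSet_finite _ _ _)]
    ext p
    simp only [Set.mem_empty_iff_false, iff_false]
    rintro ⟨⟨a, _⟩, b, c⟩
    rw [key] at c
    exact hc ⟨by rw [← b, ← a]; congr 1, c.symm⟩

lemma intBinom_pascal (a b : ℤ) (hab : a ≠ -1 ∨ b ≠ 0) :
    intBinom (a + 1) b = intBinom a (b - 1) + intBinom a b := by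
  rcases lt_or_ge a 0 with ha | ha
  · unfold intBinom
    rw [if_neg (by omega), if_neg (by omega), if_neg (by omega)]; rfl
  · obtain ⟨a, rfl⟩ := Int.eq_ofNat_of_zero_le ha
    have gen : ∀ c d : ℕ, intBinom c d = c.choose d := by
      intro c d
      unfold intBinom
      split_ifs with h
      · simp
      · rw [Nat.choose_eq_zero_of_lt (by omega)]; rfl
    have hneg : ∀ c d : ℤ, d < 0 → intBinom c d = 0 := by
      intro c d hd
      unfold intBinom
      rw [if_neg (by omega)]
    rcases lt_or_ge b 0 with hb | hb
    · rw [hneg _ _ hb, hneg _ _ hb, hneg _ _ (by omega)]; rfl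
    · obtain ⟨b, rfl⟩ := Int.eq_ofNat_of_zero_le hb
      rcases b with _ | b
      · rw [hneg _ (((0 : ℕ) : ℤ) - 1) (by norm_num)]
        have := gen (a + 1) 0
        have h2 := gen a 0
        push_cast at *
        simp [this, h2]
      · have := gen (a + 1) (b + 1)
        have h2 := gen a (b + 1)
        have h3 := gen a b
        rw [Nat.choose_succ_succ] at this
        push_cast at *
        rw [this, h2, add_sub_cancel_right, h3]

lemma intBinom_symm (a b c : ℤ) (h : b + c = a) : intBinom a b = intBinom a c := by
  unfold intBinom
  by_cases hb : 0 ≤ b ∧ b ≤ a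
  · rw [if_pos hb, if_pos (by omega), Nat.choose_symm_of_eq_add (show a.toNat = b.toNat + c.toNat by omega)]
  · rw [if_neg hb, if_neg (by omega)]

lemma main_count (n : ℕ) : ∀ (j m h : ℕ), n + 1 + h = 2 * m →
    ((pathSet (n + 1) (h : ℤ) j).ncard : ℤ) =
      intBinom ((n : ℤ) - j) ((m : ℤ) - 1) - intBinom ((n : ℤ) - j) m := by
  induction n with
  | zero =>
    intro j m h hm
    have h0 : h ≠ 0 := by omega
    have := ncard_succ 0 h j (by omega)
    rw [if_neg (by omega), add_zero, ncard_base, ncard_base] at this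
    rw [this]
    rw [if_neg (c := (h : ℤ) + 1 = 0 ∧ j = 0) (by omega)]
    unfold intBinom
    rw [if_neg (c := 0 ≤ (m : ℤ) ∧ _) (by omega)]
    by_cases hc : (h : ℤ) - 1 = 0 ∧ j = 0
    · obtain ⟨h1, rfl⟩ := hc
      have : m = 1 := by omega
      subst this
      simp [h1]
    · rw [if_neg hc, if_neg (by omega)]; rfl
  | succ n ih =>
    intro j m h hm
    rcases h with _ | h
    · rcases j with _ | j
      · rw [Nat.cast_zero, pathSet_zero_zero, Set.ncard_empty,
          intBinom_symm _ ((m : ℤ) - 1) m (by push_cast; omega)]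
        simp
      · have := ncard_succ (n + 1) 0 j le_rfl
        rw [if_pos rfl, pathSet_neg _ (0 - 1) _ (by norm_num), Set.ncard_empty] at this
        have h2 := ih j m 1 (by omega)
        push_cast at *
        rw [this]
        push_cast
        rw [zero_add, h2]
        congr 2 <;> ring
    · have := ncard_succ (n + 1) ((h + 1 : ℕ) : ℤ) j (by omega)
      rw [if_neg (by omega), add_zero] at this
      rw [this]
      have h1 := ih j (m - 1) h (by omega)
      have h2 := ih j m (h + 2) (by omega)
      have e1 : ((h + 1 : ℕ) : ℤ) - 1 = h := by push_cast; ring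
      have e2 : ((h + 1 : ℕ) : ℤ) + 1 = (h + 2 : ℕ) := by push_cast; ring
      have e3 : ((m - 1 : ℕ) : ℤ) = m - 1 := by omega
      have e4 : ((n + 1 : ℕ) : ℤ) - j = (n - j) + 1 := by push_cast; ring
      rw [e1, e2, Nat.cast_add, h1, h2, e3, e4, intBinom_pascal _ _ (by omega),
        intBinom_pascal _ _ (by omega)]
      ring

theorem stmt_0 (n h j : ℕ) (hn : 1 ≤ n) (hpar : n % 2 = h % 2) (hj : h = 0 → 1 ≤ j) :
    (Nat.card {p : Fin (n + 1) → ℤ //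
        IsLatticePath n p ∧ p (Fin.last n) = (h : ℤ) ∧ numReturns n p = j} : ℤ) =
      intBinom ((n : ℤ) - (j + 1)) ((((n + h) / 2 : ℕ) : ℤ) - 1) -
        intBinom ((n : ℤ) - (j + 1)) (((n + h) / 2 : ℕ) : ℤ) := by
  obtain ⟨n, rfl⟩ : ∃ k, n = k + 1 := ⟨n - 1, by omega⟩
  have := main_count n j ((n + 1 + h) / 2) h (by omega)
  have e : ((n + 1 : ℕ) : ℤ) - (j + 1) = n - j := by push_cast; ring
  rw [e, ← this]
  rfl
end

section
/- For all n ≥ 1 and 0 ≤ j ≤ n, the number of nonnegative lattice paths of length 2n+2 ending at height 0 and having exactly j+1 returns equals ((j+1)/(n+1))·C(2n−j, n), where C(a,b) denotes the binomial coefficient. -/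
/-- Paths of length `N` ending at height `h` with `r` returns. -/
def PathP (N h r : ℕ) (p : Fin (N + 1) → ℤ) : Prop :=
  IsLatticePath N p ∧ p (Fin.last N) = h ∧ numReturns N p = r

/-- Counting recursion by last step. -/
def cntA : ℕ → ℕ → ℕ → ℕ
  | 0, h, r => if h = 0 ∧ r = 0 then 1 else 0
  | N + 1, h + 1, r => cntA N h r + cntA N (h + 2) r
  | _ + 1, 0, 0 => 0
  | N + 1, 0, r + 1 => cntA N 1 r

/-- Number of free walks of length `M` ending at `e`. -/
def cntB : ℕ → ℤ → ℤ
  | 0, e => if e = 0 then 1 else 0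
  | M + 1, e => cntB M (e - 1) + cntB M (e + 1)

lemma isLatticePath_succ (N : ℕ) (p : Fin (N + 1 + 1) → ℤ) :
    IsLatticePath (N + 1) p ↔ IsLatticePath N (Fin.init p) ∧
      |p (Fin.last (N + 1)) - Fin.init p (Fin.last N)| = 1 ∧ 0 ≤ p (Fin.last (N + 1)) := by
  unfold IsLatticePath
  rw [Fin.forall_fin_succ' (P := fun k : Fin (N + 1) => |p k.succ - p k.castSucc| = 1),
    Fin.forall_fin_succ' (P := fun k : Fin (N + 1 + 1) => 0 ≤ p k)]
  simp only [Fin.init, Fin.succ_last, Fin.castSucc_zero, ← Fin.castSucc_succ]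
  tauto

lemma numReturns_succ (N : ℕ) (p : Fin (N + 1 + 1) → ℤ) :
    numReturns (N + 1) p = numReturns N (Fin.init p) +
      if p (Fin.last (N + 1)) = 0 then 1 else 0 := by
  unfold numReturns
  rw [Finset.card_filter, Finset.card_filter, Fin.sum_univ_castSucc]
  have h1 : Fin.last (N + 1) ≠ 0 := Fin.last_pos.ne'
  congr 1
  · refine Finset.sum_congr rfl fun k _ => ?_
    have h2 : (k.castSucc ≠ 0) ↔ k ≠ 0 := by
      rw [Ne, Ne, Fin.ext_iff, Fin.ext_iff]; rfl
    exact if_congr (and_congr h2 Iff.rfl) rfl rfl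
  · simp only [h1, ne_eq, not_false_eq_true, true_and]

lemma abs_one_iff (a b : ℤ) : |a - b| = 1 ↔ b = a - 1 ∨ b = a + 1 := by
  rw [abs_eq (by norm_num)]; omega

lemma pathP_succ_succ (N h r : ℕ) (p : Fin (N + 1 + 1) → ℤ) :
    PathP (N + 1) (h + 1) r p ↔ p (Fin.last (N + 1)) = (h : ℤ) + 1 ∧
      (PathP N h r (Fin.init p) ∨ PathP N (h + 2) r (Fin.init p)) := by
  unfold PathP
  rw [isLatticePath_succ, numReturns_succ, abs_one_iff]
  push_cast
  generalize p (Fin.last (N + 1)) = x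
  generalize (Fin.init p : Fin (N + 1) → ℤ) = q
  generalize hy : q (Fin.last N) = y
  constructor
  · rintro ⟨⟨h1, h2, h3⟩, rfl, h5⟩
    rw [if_neg (by omega)] at h5
    refine ⟨rfl, ?_⟩
    rcases h2 with h2 | h2
    · exact Or.inl ⟨h1, by omega, h5⟩
    · exact Or.inr ⟨h1, by omega, h5⟩
  · rintro ⟨rfl, ⟨h1, h2, h3⟩ | ⟨h1, h2, h3⟩⟩ <;>
    · rw [if_neg (by omega)]
      exact ⟨⟨h1, by omega, by omega⟩, rfl, h3⟩

lemma pathP_succ_zero (N r : ℕ) (p : Fin (N + 1 + 1) → ℤ) :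
    PathP (N + 1) 0 r p ↔ p (Fin.last (N + 1)) = 0 ∧
      ∃ s, r = s + 1 ∧ PathP N 1 s (Fin.init p) := by
  unfold PathP
  rw [isLatticePath_succ, numReturns_succ, abs_one_iff]
  simp only [Nat.cast_zero, Nat.cast_one]
  generalize p (Fin.last (N + 1)) = x
  constructor
  · rintro ⟨⟨h1, h2, h3⟩, rfl, h5⟩
    rw [if_pos rfl] at h5
    have := h1.2.2 (Fin.last N)
    exact ⟨rfl, numReturns N (Fin.init p), h5.symm, h1, by omega, rfl⟩
  · rintro ⟨rfl, s, rfl, h1, h2, h3⟩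
    rw [if_pos rfl]
    exact ⟨⟨h1, by omega, le_rfl⟩, rfl, by omega⟩

/-- Append a last value. -/
def snocEmb (N : ℕ) (x : ℤ) : (Fin (N + 1) → ℤ) ↪ (Fin (N + 1 + 1) → ℤ) where
  toFun q := Fin.snoc (α := fun _ => ℤ) q x
  inj' a b hab := by
    have := congrArg (fun f : Fin (N + 1 + 1) → ℤ => (Fin.init f : Fin (N + 1) → ℤ)) hab
    simpa [Fin.init_snoc] using this

lemma mem_map_snoc (N : ℕ) (x : ℤ) (F : Finset (Fin (N + 1) → ℤ)) (p : Fin (N + 1 + 1) → ℤ) :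
    p ∈ F.map (snocEmb N x) ↔ p (Fin.last (N + 1)) = x ∧ (Fin.init p : Fin (N + 1) → ℤ) ∈ F := by
  rw [Finset.mem_map]
  constructor
  · rintro ⟨q, hq, rfl⟩
    have e : snocEmb N x q = Fin.snoc (α := fun _ => ℤ) q x := rfl
    rw [e]
    exact ⟨Fin.snoc_last (α := fun _ => ℤ) x q, by rwa [Fin.init_snoc (α := fun _ => ℤ)]⟩
  · rintro ⟨rfl, h⟩
    exact ⟨_, h, Fin.snoc_init_self (α := fun _ => ℤ) p⟩

lemma exists_finset (N : ℕ) : ∀ h r : ℕ, ∃ F : Finset (Fin (N + 1) → ℤ),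
    (∀ p, p ∈ F ↔ PathP N h r p) ∧ F.card = cntA N h r := by
  induction N with
  | zero =>
    intro h r
    have key : ∀ p : Fin (0 + 1) → ℤ, PathP 0 h r p ↔ (h = 0 ∧ r = 0) ∧ p = 0 := by
      intro p
      have hr : numReturns 0 p = 0 := by
        unfold numReturns
        rw [Finset.card_eq_zero, Finset.filter_eq_empty_iff]
        rintro k - ⟨hk, -⟩
        exact hk (Fin.ext (by omega))
      unfold PathP
      rw [hr]
      constructor
      · rintro ⟨⟨h1, -, -⟩, h2, h3⟩
        have h2' : p 0 = h := h2
        refine ⟨⟨by omega, h3.symm⟩, ?_⟩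
        funext k
        rw [show k = 0 from Fin.ext (by omega)]
        exact h1
      · rintro ⟨⟨rfl, rfl⟩, rfl⟩
        exact ⟨⟨rfl, fun k => k.elim0, fun k => le_rfl⟩, rfl, rfl⟩
    by_cases hc : h = 0 ∧ r = 0
    · refine ⟨{0}, fun p => ?_, ?_⟩
      · rw [key]; simp [hc]
      · simp [cntA, hc]
    · refine ⟨∅, fun p => ?_, ?_⟩
      · rw [key]; simp [hc]
      · simp [cntA, hc]
  | succ N ih =>
    intro h r
    rcases h with _ | h
    · rcases r with _ | r
      · exact ⟨∅, fun p => by rw [pathP_succ_zero]; simp, by simp [cntA]⟩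
      · obtain ⟨F, hF, hc⟩ := ih 1 r
        refine ⟨F.map (snocEmb N 0), fun p => ?_, ?_⟩
        · rw [mem_map_snoc, pathP_succ_zero, hF]
          simp
        · rw [Finset.card_map, hc, cntA]
    · obtain ⟨F, hF, hc⟩ := ih h r
      obtain ⟨G, hG, hd⟩ := ih (h + 2) r
      have hdis : Disjoint F G := by
        rw [Finset.disjoint_left]
        intro p h1 h2
        have h1 := ((hF p).1 h1).2.1
        have h2 := ((hG p).1 h2).2.1
        push_cast at h2
        omega
      refine ⟨(F.disjUnion G hdis).map (snocEmb N (h + 1)), fun p => ?_, ?_⟩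
      · rw [mem_map_snoc, pathP_succ_succ, Finset.mem_disjUnion, hF, hG]
      · rw [Finset.card_map, Finset.card_disjUnion, hc, hd, cntA]

lemma cntA_zero (N : ℕ) : ∀ h r : ℕ, 1 ≤ r → N ≤ r → cntA N h r = 0 := by
  induction N with
  | zero => intro h r h1 _; simp [cntA]; omega
  | succ N ih =>
    intro h r h1 h2
    rcases h with _ | h
    · rcases r with _ | r
      · omega
      · rw [cntA]
        rcases r with _ | r
        · obtain rfl : N = 0 := by omega
          simp [cntA]
        · exact ih _ _ (by omega) (by omega)
    · rw [cntA, ih _ _ h1 (by omega), ih _ _ h1 (by omega)]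

lemma cntB_neg (M : ℕ) : ∀ e, cntB M (-e) = cntB M e := by
  induction M with
  | zero => intro e; simp [cntB]
  | succ M ih =>
    intro e
    rw [cntB, cntB, show -e - 1 = -(e + 1) by ring, show -e + 1 = -(e - 1) by ring, ih, ih, add_comm]

lemma cntA_eq (N : ℕ) : ∀ h r M : ℕ, N = M + r + 1 →
    (cntA N h r : ℤ) = cntB M (r + h - 1) - cntB M (r + h + 1) := by
  induction N with
  | zero => intro h r M hM; omega
  | succ N ih =>
    intro h r M hM
    rcases h with _ | h
    · rcases r with _ | r
      · have := cntB_neg M 1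
        simp [cntA, this]
      · rw [cntA, ih 1 r M (by omega)]
        push_cast
        congr 2
    · rw [cntA]
      rcases M with _ | M
      · obtain rfl : N = r := by omega
        rcases N with _ | N
        · rcases h with _ | h
          · simp [cntA, cntB]
          · simp only [cntA, cntB]
            rw [if_neg (by omega), if_neg (by omega), if_neg (by push_cast; omega),
              if_neg (by push_cast; omega)]
            simp
        · rw [cntA_zero _ _ _ (by omega) le_rfl, cntA_zero _ _ _ (by omega) le_rfl]
          simp only [cntB]
          push_cast
          split_ifs <;> omega
      · push_cast
        rw [ih _ _ M (by omega), ih _ _ M (by omega), cntB, cntB]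
        push_cast
        ring_nf

lemma cntB_choose (M : ℕ) : ∀ k : ℕ, cntB M (2 * k - M) = M.choose k := by
  have aux : ∀ M : ℕ, ∀ e : ℤ, e < -M → cntB M e = 0 := by
    intro M
    induction M with
    | zero => intro e he; simp [cntB]; push_cast at he; omega
    | succ M ih =>
      intro e he
      push_cast at he
      rw [cntB, ih _ (by omega), ih _ (by omega), add_zero]
  induction M with
  | zero => intro k; rcases k with _ | k <;> simp [cntB]; omega
  | succ M ih =>
    intro k
    rcases k with _ | k
    · rw [cntB, aux _ _ (by push_cast; omega)]
      have := ih 0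
      simp at this ⊢
      exact this
    · rw [cntB, Nat.choose_succ_succ]
      push_cast
      rw [← ih k, ← ih (k + 1)]
      push_cast
      ring_nf

theorem stmt_2 (n j : ℕ) (hn : 1 ≤ n) (hj : j ≤ n) :
    (Nat.card {p : Fin (2 * n + 2 + 1) → ℤ //
        IsLatticePath (2 * n + 2) p ∧ p (Fin.last (2 * n + 2)) = 0 ∧
          numReturns (2 * n + 2) p = j + 1} : ℚ) =
      ((j : ℚ) + 1) / ((n : ℚ) + 1) * ((2 * n - j).choose n : ℚ) := by
  obtain ⟨F, hF, hc⟩ := exists_finset (2 * n + 2) 0 (j + 1)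
  rw [Nat.subtype_card F (fun p => by rw [hF]; simp [PathP]), hc]
  have h1 := cntA_eq (2 * n + 2) 0 (j + 1) (2 * n - j) (by omega)
  have h2 := cntB_choose (2 * n - j) n
  have h3 := cntB_choose (2 * n - j) (n + 1)
  have hs := Nat.choose_succ_right_eq (2 * n - j) n
  rw [show 2 * n - j - n = n - j by omega] at hs
  have e : ((2 * n - j : ℕ) : ℤ) = 2 * n - j := by push_cast [show j ≤ 2 * n by omega]; ring
  rw [e] at h2 h3
  rw [show (2 * (n : ℤ) - (2 * n - j)) = j by ring] at h2
  rw [show (2 * ((n + 1 : ℕ) : ℤ) - (2 * n - j)) = j + 2 by push_cast; ring] at h3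
  push_cast at h1
  rw [show (j : ℤ) + 1 + 0 - 1 = j by ring, show (j : ℤ) + 1 + 0 + 1 = j + 2 by ring, h2, h3] at h1
  have h1q : (cntA (2 * n + 2) 0 (j + 1) : ℚ) =
      ((2 * n - j).choose n : ℚ) - ((2 * n - j).choose (n + 1) : ℚ) := by exact_mod_cast h1
  have hsq : ((2 * n - j).choose (n + 1) : ℚ) * (n + 1) = (2 * n - j).choose n * (n - j) := by
    have := congrArg (Nat.cast : ℕ → ℚ) hs
    push_cast [hj] at this
    exact this
  rw [h1q]
  have : (n : ℚ) + 1 ≠ 0 := by positivity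
  field_simp
  linear_combination -hsq
end

section
/- For all n ≥ 1 and 0 ≤ j ≤ n, the number of nonnegative lattice paths of length 2n (with arbitrary end height) having exactly j returns equals C(2n−j−1, n−1), where C(a,b) denotes the binomial coefficient. -/
/-- Number of paths of length `n` from height `h` with `j` zeros at positive times. -/
def pathF : ℕ → ℕ → ℕ → ℕ
  | 0, _, j => if j = 0 then 1 else 0
  | n + 1, 0, j => pathF n 1 j
  | n + 1, 1, j => pathF n 2 j + if j = 0 then 0 else pathF n 0 (j - 1)
  | n + 1, h + 2, j => pathF n (h + 3) j + pathF n (h + 1) j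

theorem pathF_half_symm (n : ℕ) : n.choose ((n + 1) / 2) = n.choose (n / 2) := by
  apply Nat.choose_symm_of_eq_add
  omega

theorem pathF_zero (n : ℕ) : ∀ h, pathF n (h + 1) 0 =
    ∑ i ∈ Finset.range (h + 1), n.choose ((n + i + 1) / 2) := by
  induction n with
  | zero =>
    intro h
    rw [Finset.sum_range_succ']
    have : ∀ i ∈ Finset.range h, Nat.choose 0 ((0 + (i + 1) + 1) / 2) = 0 := by
      intro i _
      apply Nat.choose_eq_zero_of_lt
      omega
    rw [Finset.sum_eq_zero this]
    simp [pathF]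
  | succ n ih =>
    have key : ∀ i, (n + 1).choose ((n + 1 + (i + 1) + 1) / 2) =
        n.choose ((n + (i + 2) + 1) / 2) + n.choose ((n + i + 1) / 2) := by
      intro i
      have h1 : (n + 1 + (i + 1) + 1) / 2 = (n + i + 1) / 2 + 1 := by omega
      have h2 : (n + (i + 2) + 1) / 2 = (n + i + 1) / 2 + 1 := by omega
      rw [h1, h2, Nat.choose_succ_succ, add_comm]
    have key0 : (n + 1).choose ((n + 1 + 0 + 1) / 2) =
        n.choose ((n + 1 + 1) / 2) + n.choose ((n + 0 + 1) / 2) := by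
      have h1 : (n + 1 + 0 + 1) / 2 = n / 2 + 1 := by omega
      rw [h1, Nat.choose_succ_succ, add_zero, pathF_half_symm, add_comm]
    intro h
    cases h with
    | zero =>
      simp only [pathF, zero_add]
      rw [ih 1]
      simp only [Finset.sum_range_succ, Finset.sum_range_zero, if_true]
      rw [key0]
      omega
    | succ h =>
      simp only [pathF]
      rw [ih (h + 2), ih h, Finset.sum_range_succ' _ (h + 1), Finset.sum_congr rfl (fun i _ => key i),
        Finset.sum_add_distrib, key0, Finset.sum_range_succ' _ (h + 2),
        Finset.sum_range_succ' _ (h + 1)]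
      simp only [add_assoc, Nat.reduceAdd, zero_add]
      omega

theorem pathF_pos (n : ℕ) : ∀ h j, pathF n (h + 1) (j + 1) =
    if j + 1 ≤ n then (n - (j + 1)).choose ((n + h) / 2) else 0 := by
  induction n using Nat.strong_induction_on with
  | _ n ih =>
  intro h j
  cases n with
  | zero => simp [pathF]
  | succ n =>
    have up := ih n (by omega) (h + 1) j
    cases h with
    | succ h =>
      have dn := ih n (by omega) h j
      simp only [pathF]
      rw [up, dn]
      split_ifs with h1 h2 h2
      · have e1 : n + 1 - (j + 1) = (n - (j + 1)) + 1 := by omega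
        have e2 : (n + 1 + (h + 1)) / 2 = (n + h) / 2 + 1 := by omega
        have e3 : (n + (h + 1 + 1)) / 2 = (n + h) / 2 + 1 := by omega
        rw [e1, e2, e3, Nat.choose_succ_succ]
        rw [add_comm]
      · omega
      · symm
        apply Nat.choose_eq_zero_of_lt
        omega
      · rfl
    | zero =>
      simp only [pathF, zero_add]
      simp only [zero_add] at up
      rw [if_neg (by omega), up]
      cases n with
      | zero => cases j <;> simp [pathF]
      | succ n =>
        simp only [pathF, Nat.add_sub_cancel]
        cases j with
        | zero =>
          rw [pathF_zero n 0]
          simp only [Finset.sum_range_succ, Finset.sum_range_zero, zero_add, add_zero]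
          rw [if_pos (by omega), if_pos (by omega), pathF_half_symm]
          have e2 : (n + 1 + 1) / 2 = n / 2 + 1 := by omega
          rw [e2]
          simp only [Nat.add_sub_cancel]
          rw [Nat.choose_succ_succ, add_comm]
        | succ j =>
          rw [ih n (by omega) 0 j]
          split_ifs with h1 h2 h3 h3
          all_goals first
            | omega
            | skip
          · have e1 : n + 1 + 1 - (j + 1 + 1) = (n - (j + 1)) + 1 := by omega
            have e2 : (n + 1 + 1 + 0) / 2 = n / 2 + 1 := by omega
            have e3 : (n + 1 + 1) / 2 = n / 2 + 1 := by omega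
            have e4 : n + 1 - (j + 1 + 1) = n - (j + 1) := by omega
            rw [e1, e2, e4, Nat.choose_succ_succ, add_zero, add_comm]
          · symm
            apply Nat.choose_eq_zero_of_lt
            omega

/-- Paths of length `n` from height `h` with `j` zeros at positive times. -/
def pathT (n : ℕ) (h : ℤ) (j : ℕ) : Set (Fin (n + 1) → ℤ) :=
  {p | p 0 = h ∧ (∀ k : Fin n, |p k.succ - p k.castSucc| = 1) ∧ (∀ k, 0 ≤ p k) ∧
    numReturns n p = j}

theorem numReturns_cons (n : ℕ) (h : ℤ) (q : Fin (n + 1) → ℤ) :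
    numReturns (n + 1) (Fin.cons h q : Fin (n + 2) → ℤ) =
      numReturns n q + if q 0 = 0 then 1 else 0 := by
  unfold numReturns
  simp only [Finset.card_filter]
  rw [Fin.sum_univ_succ]
  simp only [ne_eq, not_true_eq_false, false_and, if_false, Fin.succ_ne_zero,
    not_false_eq_true, true_and, Fin.cons_succ, zero_add]
  rw [Fin.sum_univ_succ, Fin.sum_univ_succ]
  simp [add_comm]

theorem pathT_succ (n : ℕ) (h : ℤ) (hh : 0 ≤ h) (j : ℕ) :
    pathT (n + 1) h j = Set.image (fun q : Fin (n + 1) → ℤ => (Fin.cons h q : Fin (n + 2) → ℤ))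
      {q | (q 0 = h + 1 ∨ q 0 = h - 1) ∧ (∀ k : Fin n, |q k.succ - q k.castSucc| = 1) ∧
        (∀ k, 0 ≤ q k) ∧ numReturns n q + (if q 0 = 0 then 1 else 0) = j} := by
  have habs : ∀ x : ℤ, |x - h| = 1 ↔ (x = h + 1 ∨ x = h - 1) := by
    intro x
    rw [abs_eq (by norm_num)]
    constructor <;> rintro (h | h) <;> [left; right; left; right] <;> omega
  have main : ∀ q : Fin (n + 1) → ℤ, (Fin.cons h q : Fin (n + 2) → ℤ) ∈ pathT (n + 1) h j ↔
      ((q 0 = h + 1 ∨ q 0 = h - 1) ∧ (∀ k : Fin n, |q k.succ - q k.castSucc| = 1) ∧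
        (∀ k, 0 ≤ q k) ∧ numReturns n q + (if q 0 = 0 then 1 else 0) = j) := by
    intro q
    unfold pathT
    rw [Set.mem_ofPred_eq, numReturns_cons, Fin.forall_fin_succ, Fin.forall_fin_succ (n := n + 1)]
    simp only [Fin.cons_zero, Fin.cons_succ, Fin.castSucc_zero, ← Fin.succ_castSucc, habs]
    tauto
  ext p
  constructor
  · intro hp
    have hp0 : p 0 = h := hp.1
    have e : (Fin.cons h (Fin.tail p) : Fin (n + 2) → ℤ) = p := by
      rw [← hp0]; exact Fin.cons_self_tail p
    refine ⟨Fin.tail p, ?_, e⟩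
    rw [← e] at hp
    exact (main _).1 hp
  · rintro ⟨q, hq, rfl⟩
    exact (main q).2 hq

theorem pathT_encard (n : ℕ) : ∀ h j : ℕ, (pathT n h j).encard = (pathF n h j : ℕ∞) := by
  induction n with
  | zero =>
    intro h j
    have hr : ∀ p : Fin (0 + 1) → ℤ, numReturns 0 p = 0 := by
      intro p
      simp [numReturns, Finset.filter_eq_empty_iff]
    by_cases hj : j = 0
    · have : pathT 0 h j = {fun _ => (h : ℤ)} := by
        ext p
        simp only [pathT, Set.mem_ofPred_eq, Set.mem_singleton_iff, hr]
        constructor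
        · rintro ⟨h0, _⟩
          funext k
          rw [← h0]
          congr 1
          apply Fin.ext
          have := k.isLt
          simp
        · rintro rfl
          exact ⟨rfl, fun k => k.elim0, fun k => by simp, hj.symm⟩
      rw [this]
      simp [pathF, hj]
    · have : pathT 0 h j = ∅ := by
        ext p
        simp only [pathT, Set.mem_ofPred_eq, hr, Set.mem_empty_iff_false, iff_false]
        rintro ⟨_, _, _, h3⟩
        exact hj h3.symm
      rw [this]
      simp [pathF, hj]
  | succ n ih =>
    intro h j
    have inj : Function.Injective
        (fun q : Fin (n + 1) → ℤ => (Fin.cons (h : ℤ) q : Fin (n + 2) → ℤ)) :=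
      Fin.cons_right_injective (α := fun _ => ℤ) (h : ℤ)
    rw [pathT_succ n h (by positivity) j, Function.Injective.encard_image inj]
    have dis : ∀ (a b : ℤ) (i k : ℕ), a ≠ b → Disjoint (pathT n a i) (pathT n b k) := by
      intro a b i k hab
      rw [Set.disjoint_left]
      intro p hp hq
      exact hab (hp.1.symm.trans hq.1)
    match h with
    | 0 =>
      rw [pathF, ← ih 1 j]
      congr 1
      ext q
      simp only [pathT, Set.mem_ofPred_eq]
      constructor
      · rintro ⟨h1 | h1, h2, h3, h4⟩
        · have h1' : q 0 = 1 := by simpa using h1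
          rw [if_neg (by omega)] at h4
          exact ⟨by simpa using h1, h2, h3, h4⟩
        · have := h3 0
          push_cast at h1
          omega
      · rintro ⟨h1, h2, h3, h4⟩
        push_cast at h1
        refine ⟨Or.inl (by simpa using h1), h2, h3, ?_⟩
        rw [if_neg (by omega)]
        exact h4
    | 1 =>
      rw [pathF]
      by_cases hj : j = 0
      · rw [if_pos hj, add_zero, ← ih 2 j]
        congr 1
        ext q
        simp only [pathT, Set.mem_ofPred_eq]
        push_cast
        constructor
        · rintro ⟨h1 | h1, h2, h3, h4⟩
          · rw [if_neg (by omega)] at h4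
            exact ⟨by omega, h2, h3, h4⟩
          · rw [if_pos (by omega)] at h4
            omega
        · rintro ⟨h1, h2, h3, h4⟩
          refine ⟨Or.inl (by omega), h2, h3, ?_⟩
          rw [if_neg (by omega)]
          exact h4
      · rw [if_neg hj]
        push_cast
        rw [← ih 2 j, ← ih 0 (j - 1), ← Set.encard_union_eq (dis _ _ _ _ (by norm_num))]
        congr 1
        ext q
        simp only [pathT, Set.mem_ofPred_eq, Set.mem_union]
        push_cast
        constructor
        · rintro ⟨h1 | h1, h2, h3, h4⟩
          · rw [if_neg (by omega)] at h4
            exact Or.inl ⟨by omega, h2, h3, h4⟩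
          · rw [if_pos (by omega)] at h4
            exact Or.inr ⟨by omega, h2, h3, by omega⟩
        · rintro (⟨h1, h2, h3, h4⟩ | ⟨h1, h2, h3, h4⟩)
          · refine ⟨Or.inl (by omega), h2, h3, ?_⟩
            rw [if_neg (by omega)]
            exact h4
          · refine ⟨Or.inr (by omega), h2, h3, ?_⟩
            rw [if_pos (by omega)]
            omega
    | h + 2 =>
      rw [pathF]
      push_cast
      rw [← ih (h + 3) j, ← ih (h + 1) j,
        ← Set.encard_union_eq (dis _ _ _ _ (by push_cast; omega))]
      congr 1
      ext q
      simp only [pathT, Set.mem_ofPred_eq, Set.mem_union]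
      push_cast
      constructor
      · rintro ⟨h1 | h1, h2, h3, h4⟩
        · rw [if_neg (by omega)] at h4
          exact Or.inl ⟨by omega, h2, h3, h4⟩
        · rw [if_neg (by omega)] at h4
          exact Or.inr ⟨by omega, h2, h3, by omega⟩
      · rintro (⟨h1, h2, h3, h4⟩ | ⟨h1, h2, h3, h4⟩)
        · refine ⟨Or.inl (by omega), h2, h3, ?_⟩
          rw [if_neg (by omega)]
          exact h4
        · refine ⟨Or.inr (by omega), h2, h3, ?_⟩
          rw [if_neg (by omega)]
          exact h4

theorem stmt_3 (n j : ℕ) (hn : 1 ≤ n) (hj : j ≤ n) :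
    Nat.card {p : Fin (2 * n + 1) → ℤ //
        IsLatticePath (2 * n) p ∧ numReturns (2 * n) p = j} =
      (2 * n - j - 1).choose (n - 1) := by
  have h1 : {p : Fin (2 * n + 1) → ℤ | IsLatticePath (2 * n) p ∧ numReturns (2 * n) p = j} =
      pathT (2 * n) ((0 : ℕ) : ℤ) j := by
    ext p
    simp only [IsLatticePath, pathT, Set.mem_ofPred_eq, Nat.cast_zero]
    tauto
  have h2 : Nat.card {p : Fin (2 * n + 1) → ℤ //
        IsLatticePath (2 * n) p ∧ numReturns (2 * n) p = j} =
      (pathT (2 * n) ((0 : ℕ) : ℤ) j).ncard := by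
    rw [← h1]
    rfl
  rw [h2, Set.ncard_def, pathT_encard, ENat.toNat_natCast]
  obtain ⟨m, rfl⟩ : ∃ m, n = m + 1 := ⟨n - 1, by omega⟩
  have e : 2 * (m + 1) = (2 * m + 1) + 1 := by ring
  rw [e, pathF]
  cases j with
  | zero =>
    rw [pathF_zero _ 0]
    simp only [Finset.sum_range_succ, Finset.sum_range_zero, zero_add, add_zero]
    rw [pathF_half_symm]
    congr 1
    omega
  | succ j =>
    rw [pathF_pos _ 0 j, if_pos (by omega)]
    congr 1 <;> omega
end

section
/- For all n ≥ 2 and 1 ≤ j ≤ n, the number of nonnegative lattice paths p of length 2n−1 such that either (p(2n−1) ≥ 3 and p has exactly j returns) or (p(2n−1) = 1 and p has exactly j−1 returns) equals C(2n−j−2, n−2), where C(a,b) denotes the binomial coefficient. -/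
lemma path_succ (m : ℕ) (p : Fin (m + 1 + 1) → ℤ) :
    IsLatticePath (m + 1) p ↔ IsLatticePath m (fun k => p k.castSucc) ∧
      |p (Fin.last (m + 1)) - p (Fin.last m).castSucc| = 1 ∧ 0 ≤ p (Fin.last (m + 1)) := by
  unfold IsLatticePath
  constructor
  · rintro ⟨h0, h1, h2⟩
    exact ⟨⟨h0, fun k => h1 k.castSucc, fun k => h2 _⟩, h1 (Fin.last m), h2 _⟩
  · rintro ⟨⟨h0, h1, h2⟩, h3, h4⟩
    refine ⟨h0, fun k => ?_, fun k => ?_⟩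
    · induction k using Fin.lastCases with
      | last => exact h3
      | cast k => exact h1 k
    · induction k using Fin.lastCases with
      | last => exact h4
      | cast k => exact h2 k

lemma ret_succ (m : ℕ) (p : Fin (m + 1 + 1) → ℤ) :
    numReturns (m + 1) p = numReturns m (fun k => p k.castSucc) +
      if p (Fin.last (m + 1)) = 0 then 1 else 0 := by
  unfold numReturns
  rw [Finset.card_filter, Finset.card_filter, Fin.sum_univ_castSucc]
  simp

/-- Paths of length `m` ending at `h` with `r` returns. -/
def PA (m h r : ℕ) : Set (Fin (m + 1) → ℤ) :=
  {p | IsLatticePath m p ∧ p (Fin.last m) = h ∧ numReturns m p = r}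

/-- Recursive count of these paths. -/
def NN : ℕ → ℕ → ℕ → ℕ
  | 0, 0, 0 => 1
  | 0, _, _ => 0
  | m + 1, h + 1, r => NN m h r + NN m (h + 2) r
  | m + 1, 0, r + 1 => NN m 1 r
  | _ + 1, 0, 0 => 0

/-- Append a final height. -/
def app (m : ℕ) (h : ℤ) (q : Fin (m + 1) → ℤ) : Fin (m + 1 + 1) → ℤ :=
  Fin.snoc (α := fun _ => ℤ) q h

lemma app_cast (m : ℕ) (h : ℤ) (q : Fin (m + 1) → ℤ) (k : Fin (m + 1)) :
    app m h q k.castSucc = q k := by simp [app]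

lemma app_last (m : ℕ) (h : ℤ) (q : Fin (m + 1) → ℤ) :
    app m h q (Fin.last (m + 1)) = h := by simp [app]

lemma app_inj (m : ℕ) (h : ℤ) : Function.Injective (app m h) := by
  intro p q hpq
  funext k
  rw [← app_cast m h p k, hpq, app_cast]

lemma app_init (m : ℕ) (p : Fin (m + 1 + 1) → ℤ) :
    app m (p (Fin.last (m + 1))) (fun k => p k.castSucc) = p := by
  funext k
  induction k using Fin.lastCases with
  | last => rw [app_last]
  | cast k => rw [app_cast]

lemma mem_app (m h : ℕ) (S : Set (Fin (m + 1) → ℤ)) (p : Fin (m + 1 + 1) → ℤ) :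
    p ∈ app m h '' S ↔ p (Fin.last (m + 1)) = h ∧ (fun k => p k.castSucc) ∈ S := by
  constructor
  · rintro ⟨q, hq, rfl⟩
    refine ⟨app_last _ _ _, ?_⟩
    simpa only [app_cast] using hq
  · rintro ⟨h1, h2⟩
    refine ⟨_, h2, ?_⟩
    rw [← h1]
    exact app_init m p

lemma PA_succ (m h r : ℕ) :
    PA (m + 1) (h + 1) r = app m ((h + 1 : ℕ) : ℤ) '' PA m h r ∪
      app m ((h + 1 : ℕ) : ℤ) '' PA m (h + 2) r := by
  ext p
  rw [Set.mem_union, mem_app m (h + 1), mem_app m (h + 1)]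
  simp only [PA, Set.mem_ofPred_eq, path_succ, ret_succ]
  generalize p (Fin.last (m + 1)) = x
  generalize p (Fin.last m).castSucc = y
  push_cast
  rw [abs_eq (by norm_num)]
  constructor
  · rintro ⟨⟨h1, h2, h3⟩, rfl, h5⟩
    rw [if_neg (by omega)] at h5
    rcases h2 with h2 | h2
    · exact Or.inl ⟨rfl, h1, by omega, h5⟩
    · exact Or.inr ⟨rfl, h1, by omega, h5⟩
  · rintro (⟨rfl, h1, h2, h3⟩ | ⟨rfl, h1, h2, h3⟩) <;>
    · rw [if_neg (by omega)]
      exact ⟨⟨h1, by omega, by omega⟩, rfl, h3⟩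

lemma PA_zero (m r : ℕ) :
    PA (m + 1) 0 (r + 1) = app m ((0 : ℕ) : ℤ) '' PA m 1 r := by
  ext p
  rw [mem_app m 0]
  simp only [PA, Set.mem_ofPred_eq, path_succ, ret_succ]
  have hnn : IsLatticePath m (fun k => p k.castSucc) → 0 ≤ p (Fin.last m).castSucc :=
    fun h => h.2.2 (Fin.last m)
  revert hnn
  generalize p (Fin.last (m + 1)) = x
  generalize p (Fin.last m).castSucc = y
  intro hnn
  push_cast
  rw [abs_eq (by norm_num)]
  constructor
  · rintro ⟨⟨h1, h2, h3⟩, rfl, h5⟩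
    rw [if_pos rfl] at h5
    have := hnn h1
    exact ⟨rfl, h1, by omega, by omega⟩
  · rintro ⟨rfl, h1, h2, h3⟩
    rw [if_pos rfl]
    exact ⟨⟨h1, by omega, by omega⟩, rfl, by omega⟩

lemma PA_zero_zero (m : ℕ) : PA (m + 1) 0 0 = ∅ := by
  ext p
  simp only [PA, Set.mem_ofPred_eq, ret_succ, Set.mem_empty_iff_false, iff_false]
  rintro ⟨_, h, h'⟩
  rw [if_pos (by simpa using h)] at h'
  omega

lemma PA_base (h r : ℕ) : (PA 0 h r).encard = (NN 0 h r : ℕ) := by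
  have hr : ∀ p, numReturns 0 p = 0 := by
    intro p
    simp [numReturns]
  have hl : Fin.last 0 = 0 := rfl
  by_cases hh : h = 0 ∧ r = 0
  · obtain ⟨rfl, rfl⟩ := hh
    have : PA 0 0 0 = {fun _ => 0} := by
      ext p
      simp only [PA, Set.mem_ofPred_eq, hr, Set.mem_singleton_iff, IsLatticePath]
      constructor
      · rintro ⟨⟨h0, _⟩, _⟩
        funext k
        rw [show k = 0 from Fin.ext (by have := k.isLt; omega), h0]
      · rintro rfl
        simp
    rw [this]
    simp [NN]
  · have : PA 0 h r = ∅ := by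
      ext p
      simp only [PA, Set.mem_ofPred_eq, hr, Set.mem_empty_iff_false, iff_false, IsLatticePath, hl]
      rintro ⟨⟨h0, _⟩, h1, h2⟩
      rw [h0] at h1
      exact hh ⟨by exact_mod_cast h1.symm, h2.symm⟩
    rw [this]
    match h, r, hh with
    | 0, 0, hh => simp at hh
    | 0, r + 1, _ => simp [NN]
    | h + 1, r, _ => simp [NN]

lemma PA_card (m : ℕ) : ∀ h r : ℕ, (PA m h r).encard = (NN m h r : ℕ) := by
  induction m with
  | zero => exact PA_base
  | succ m ih =>
    intro h r
    match h, r with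
    | h + 1, r =>
      rw [PA_succ, Set.encard_union_eq, (app_inj _ _).encard_image, (app_inj _ _).encard_image,
        ih, ih, NN]
      · push_cast; rfl
      · rw [Set.disjoint_image_iff (app_inj _ _), Set.disjoint_left]
        rintro p ⟨_, h1, _⟩ ⟨_, h2, _⟩
        rw [h1] at h2
        omega
    | 0, r + 1 => rw [PA_zero, (app_inj _ _).encard_image, ih, NN]
    | 0, 0 => rw [PA_zero_zero]; simp [NN]

lemma path_le (m : ℕ) : ∀ p, IsLatticePath m p → p (Fin.last m) ≤ m := by
  induction m with
  | zero => intro p h; have := h.1; exact this.le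
  | succ m ih =>
    intro p h
    rw [path_succ] at h
    have h1 := ih _ h.1
    have h2 := (abs_le.1 h.2.1.le).2
    push_cast
    linarith

/-- Paths of length `m` ending at height at least `c` with `r` returns. -/
def PD (m c r : ℕ) : Set (Fin (m + 1) → ℤ) :=
  {p | IsLatticePath m p ∧ (c : ℤ) ≤ p (Fin.last m) ∧ numReturns m p = r}

lemma PD_card (m r k : ℕ) : ∀ c, m + 1 ≤ c + k →
    (PD m c r).encard = (∑ i ∈ Finset.range k, NN m (c + i) r : ℕ) := by
  induction k with
  | zero =>
    intro c hc
    have : PD m c r = ∅ := by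
      ext p
      simp only [PD, Set.mem_ofPred_eq, Set.mem_empty_iff_false, iff_false]
      rintro ⟨h1, h2, _⟩
      have := path_le m p h1
      omega
    rw [this]; simp
  | succ k ih =>
    intro c hc
    have : PD m c r = PD m (c + 1) r ∪ PA m c r := by
      ext p
      simp only [PD, PA, Set.mem_ofPred_eq, Set.mem_union]
      push_cast
      constructor
      · rintro ⟨h1, h2, h3⟩
        rcases h2.eq_or_lt with h | h
        · exact Or.inr ⟨h1, h.symm, h3⟩
        · exact Or.inl ⟨h1, by omega, h3⟩
      · rintro (⟨h1, h2, h3⟩ | ⟨h1, h2, h3⟩)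
        · exact ⟨h1, by omega, h3⟩
        · exact ⟨h1, by omega, h3⟩
    rw [this, Set.encard_union_eq, ih (c + 1) (by omega), PA_card, Finset.sum_range_succ']
    · push_cast
      simp only [add_zero, add_assoc, add_comm 1]
    · rw [Set.disjoint_left]
      rintro p ⟨_, h1, _⟩ ⟨_, h2, _⟩
      push_cast at h1
      omega

/-- Closed form: ballot numbers. -/
def gg : ℕ → ℕ → ℤ
  | _, 0 => 1
  | d, t + 1 => ((d + 2 * t + 1).choose (t + 1) : ℤ) - ((d + 2 * t + 1).choose t : ℤ)

lemma gg_zero (t : ℕ) : gg 0 (t + 1) = 0 := by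
  have : (0 + 2 * t + 1).choose (t + 1) = (0 + 2 * t + 1).choose t :=
    Nat.choose_symm_of_eq_add (by omega)
  simp only [gg, this, sub_self]

lemma gg_rec (d t : ℕ) : gg (d + 1) (t + 1) = gg d (t + 1) + gg (d + 2) t := by
  cases t with
  | zero => simp [gg]
  | succ t =>
    simp only [gg]
    have e1 : d + 1 + 2 * (t + 1) + 1 = (d + 2 * t + 3) + 1 := by ring
    have e2 : d + 2 * (t + 1) + 1 = d + 2 * t + 3 := by ring
    have e3 : d + 2 + 2 * t + 1 = d + 2 * t + 3 := by ring
    rw [e1, e2, e3, Nat.choose_succ_succ' (d + 2 * t + 3) (t + 1), Nat.choose_succ_succ' (d + 2 * t + 3) t]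
    push_cast
    ring

lemma NN_zero (m : ℕ) : ∀ h r, (m < h + 2 * r ∨ (m + h) % 2 = 1) → NN m h r = 0 := by
  induction m with
  | zero =>
    intro h r hh
    match h, r with
    | 0, 0 => simp at hh
    | 0, r + 1 => simp [NN]
    | h + 1, r => simp [NN]
  | succ m ih =>
    intro h r hh
    match h, r with
    | h + 1, r => rw [NN, ih h r (by omega), ih (h + 2) r (by omega)]
    | 0, r + 1 => rw [NN, ih 1 r (by omega)]
    | 0, 0 => rw [NN]

lemma NN_eq (m : ℕ) : ∀ h r t, m = h + 2 * r + 2 * t → (NN m h r : ℤ) = gg (h + r) t := by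
  induction m with
  | zero =>
    intro h r t hh
    obtain rfl : h = 0 := by omega
    obtain rfl : r = 0 := by omega
    obtain rfl : t = 0 := by omega
    simp [NN, gg]
  | succ m ih =>
    intro h r t hh
    match h, r, t with
    | h + 1, r, 0 =>
      rw [NN, NN_zero m (h + 2) r (by omega)]
      push_cast
      rw [ih h r 0 (by omega)]
      simp [gg]
    | h + 1, r, t + 1 =>
      rw [NN]
      push_cast
      rw [ih h r (t + 1) (by omega), ih (h + 2) r t (by omega)]
      have e1 : h + 1 + r = h + r + 1 := by ring
      have e2 : h + 2 + r = h + r + 2 := by ring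
      rw [e1, e2, gg_rec]
    | 0, r + 1, t =>
      rw [NN, ih 1 r t (by omega)]
      congr 1
      ring
    | 0, 0, 0 => omega
    | 0, 0, t + 1 => rw [NN, gg_zero]; rfl

lemma NN_sum (m r t : ℕ) : ∀ h K, m = h + 1 + 2 * r + 2 * t → 2 * t + 1 ≤ K →
    (∑ i ∈ Finset.range K, (NN m (h + 1 + i) r : ℤ)) = ((h + r + 2 * t).choose t : ℤ) := by
  induction t with
  | zero =>
    intro h K hm hK
    obtain ⟨K, rfl⟩ : ∃ K', K = K' + 1 := ⟨K - 1, by omega⟩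
    rw [Finset.sum_range_succ', Finset.sum_eq_zero]
    · rw [add_zero, NN_eq m (h + 1) r 0 (by omega)]
      simp [gg]
    · intro i _
      rw [NN_zero _ _ _ (by omega)]
      rfl
  | succ t ih =>
    intro h K hm hK
    obtain ⟨K, rfl⟩ : ∃ K', K = K' + 2 := ⟨K - 2, by omega⟩
    rw [Finset.sum_range_succ', Finset.sum_range_succ']
    have h1 := ih (h + 2) K (by omega) (by omega)
    have h2 : ∀ i, h + 1 + (i + 1 + 1) = h + 2 + 1 + i := by intro i; ring
    simp only [h2]
    rw [h1, NN_zero m (h + 1 + (0 + 1)) r (by omega), add_zero,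
      NN_eq m (h + 1) r (t + 1) (by omega)]
    simp only [gg]
    have e1 : h + 1 + r + 2 * t + 1 = h + r + 2 * (t + 1) := by ring
    have e2 : h + 2 + r + 2 * t = h + r + 2 * (t + 1) := by ring
    rw [e1, e2]
    push_cast
    ring

lemma count_final (n j : ℕ) (hn : 2 ≤ n) (hj1 : 1 ≤ j) (hjn : j ≤ n) :
    (∑ i ∈ Finset.range (2 * n), NN (2 * n - 1) (3 + i) j) + NN (2 * n - 1) 1 (j - 1) =
      (2 * n - j - 2).choose (n - 2) := by
  obtain ⟨j, rfl⟩ : ∃ j', j = j' + 1 := ⟨j - 1, by omega⟩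
  obtain ⟨s, rfl⟩ : ∃ s, n = j + 1 + s := ⟨n - (j + 1), by omega⟩
  zify
  rw [NN_eq _ 1 (j + 1 - 1) s (by omega)]
  have hz : ∀ K, s < 2 →
      (∑ i ∈ Finset.range K, (NN (2 * (j + 1 + s) - 1) (3 + i) (j + 1) : ℤ)) = 0 := by
    intro K hs
    apply Finset.sum_eq_zero
    intro i _
    rw [NN_zero _ _ _ (by omega)]
    rfl
  match s with
  | 0 =>
    rw [hz _ (by omega)]
    have e : 2 * (j + 1 + 0) - (j + 1) - 2 = j + 1 + 0 - 2 := by omega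
    rw [e]
    simp [gg]
  | 1 =>
    rw [hz _ (by omega)]
    have e : 2 * (j + 1 + 1) - (j + 1) - 2 = j + 1 := by omega
    have e' : j + 1 + 1 - 2 = j := by omega
    rw [e, e']
    simp [gg]
    ring
  | s + 2 =>
    have h1 := NN_sum (2 * (j + 1 + (s + 2)) - 1) (j + 1) s 2 (2 * (j + 1 + (s + 2)))
      (by omega) (by omega)
    norm_num only at h1
    rw [h1]
    simp only [gg]
    have e : 2 * (j + 1 + (s + 2)) - (j + 1) - 2 = j + 2 * s + 3 := by omega
    have e' : j + 1 + (s + 2) - 2 = j + s + 1 := by omega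
    have e1 : 2 + (j + 1) + 2 * s = j + 2 * s + 3 := by ring
    have e2 : 1 + (j + 1 - 1) + 2 * (s + 1) + 1 = j + 2 * s + 3 + 1 := by omega
    rw [e, e', e1, e2, Nat.choose_succ_succ' (j + 2 * s + 3) (s + 1),
      Nat.choose_succ_succ' (j + 2 * s + 3) s,
      Nat.choose_symm_of_eq_add (n := j + 2 * s + 3) (a := j + s + 1) (b := s + 2) (by omega)]
    push_cast
    ring

theorem stmt_4 (n j : ℕ) (hn : 2 ≤ n) (hj1 : 1 ≤ j) (hjn : j ≤ n) :
    Nat.card {p : Fin (2 * n - 1 + 1) → ℤ //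
        IsLatticePath (2 * n - 1) p ∧
          ((3 ≤ p (Fin.last (2 * n - 1)) ∧ numReturns (2 * n - 1) p = j) ∨
            (p (Fin.last (2 * n - 1)) = 1 ∧ numReturns (2 * n - 1) p = j - 1))} =
      (2 * n - j - 2).choose (n - 2) := by
  rw [← count_final n j hn hj1 hjn]
  have key : {p : Fin (2 * n - 1 + 1) → ℤ | IsLatticePath (2 * n - 1) p ∧
          ((3 ≤ p (Fin.last (2 * n - 1)) ∧ numReturns (2 * n - 1) p = j) ∨
            (p (Fin.last (2 * n - 1)) = 1 ∧ numReturns (2 * n - 1) p = j - 1))} =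
      PD (2 * n - 1) 3 j ∪ PA (2 * n - 1) 1 (j - 1) := by
    ext p
    simp only [PD, PA, Set.mem_ofPred_eq, Set.mem_union]
    push_cast
    tauto
  have hc : (PD (2 * n - 1) 3 j ∪ PA (2 * n - 1) 1 (j - 1)).encard =
      ((∑ i ∈ Finset.range (2 * n), NN (2 * n - 1) (3 + i) j) + NN (2 * n - 1) 1 (j - 1) : ℕ) := by
    rw [Set.encard_union_eq, PD_card _ _ (2 * n) 3 (by omega), PA_card]
    · push_cast; rfl
    · rw [Set.disjoint_left]
      rintro p ⟨_, h1, _⟩ ⟨_, h2, _⟩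
      push_cast at h1 h2
      omega
  rw [← key] at hc
  have := congrArg ENat.toNat hc
  rw [ENat.toNat_natCast] at this
  exact this
end

section
/- For all n ≥ 1 and 0 ≤ j ≤ n, the number of upper sets S of the root poset of type A_n with |S ∩ Π| = j equals ((j+1)/(n+1))·C(2n−j, n), where C(a,b) denotes the binomial coefficient. -/
/-- The standard basis vector `e i` of `ℤ^(n+1)`. -/
def stdA (n : ℕ) (i : Fin (n + 1)) : Fin (n + 1) → ℤ := Pi.single i 1

/-- The set of positive roots of type `A_n`: `e i - e j` for `i < j`. -/
def posA (n : ℕ) : Set (Fin (n + 1) → ℤ) :=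
  {x | ∃ i j : Fin (n + 1), i < j ∧ x = stdA n i - stdA n j}

/-- The set of simple roots of type `A_n`: `α i = e i - e (i+1)`. -/
def simpleA (n : ℕ) : Set (Fin (n + 1) → ℤ) :=
  {x | ∃ i j : Fin (n + 1), (i : ℕ) + 1 = (j : ℕ) ∧ x = stdA n i - stdA n j}

/-- The root poset order: `a ≤ b` iff `b - a` is a nonnegative integer
combination of simple roots, i.e. lies in the additive submonoid generated by them. -/
def rootLeA (n : ℕ) (a b : Fin (n + 1) → ℤ) : Prop :=
  b - a ∈ AddSubmonoid.closure (simpleA n)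

/-- `S` is an upper set of the root poset of type `A_n`. -/
def isUpperA (n : ℕ) (S : Set (Fin (n + 1) → ℤ)) : Prop :=
  S ⊆ posA n ∧ ∀ a ∈ S, ∀ b ∈ posA n, rootLeA n a b → b ∈ S

/-- ballot sequences of length `m`, bounded by `v`, with `j` touches -/
def ballotF (m v j : ℕ) : Set (ℕ → ℕ) :=
  {f | (∀ i < m, f i ≤ i ∧ f i ≤ v) ∧ (∀ i k, i ≤ k → k < m → f i ≤ f k) ∧
    (∀ i, m ≤ i → f i = 0) ∧ ((Finset.range m).filter (fun i => f i = i)).card = j}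

lemma ballotF_zero_v (m j : ℕ) : ballotF (m + 2) 0 j = ballotF (m + 1) 0 j := by
  have key : ∀ f : ℕ → ℕ, f (m+1) = 0 →
      (Finset.range (m+2)).filter (fun i => f i = i) =
      (Finset.range (m+1)).filter (fun i => f i = i) := by
    intro f hf
    ext i
    simp only [Finset.mem_filter, Finset.mem_range]
    constructor
    · rintro ⟨h1, h2⟩
      refine ⟨?_, h2⟩
      by_contra h
      have : i = m + 1 := by omega
      subst this; omega
    · rintro ⟨h1, h2⟩
      exact ⟨by omega, h2⟩
  ext f
  constructor
  · rintro ⟨h1, h2, h3, h4⟩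
    have h0 : f (m+1) = 0 := by have := h1 (m+1) (by omega); omega
    refine ⟨fun i hi => h1 i (by omega), fun i k h h' => h2 i k h (by omega), ?_, ?_⟩
    · intro i hi
      rcases Nat.lt_or_ge i (m+2) with h | h
      · have := h1 i h; omega
      · exact h3 i h
    · rw [← key f h0]; exact h4
  · rintro ⟨h1, h2, h3, h4⟩
    have hz : ∀ i, f i = 0 := by
      intro i
      rcases Nat.lt_or_ge i (m+1) with h | h
      · have := h1 i h; omega
      · exact h3 i h
    refine ⟨fun i hi => by simp [hz], fun i k h h' => by simp [hz], fun i _ => hz i, ?_⟩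
    rw [key f (hz _)]; exact h4

lemma ballotF_empty_of_lt {m v j : ℕ} (h : m < j) : ballotF m v j = ∅ := by
  ext f
  simp only [Set.mem_empty_iff_false, iff_false]
  rintro ⟨-, -, -, h4⟩
  have := Finset.card_filter_le (Finset.range m) (fun i => f i = i)
  rw [Finset.card_range] at this
  omega

lemma ballotF_empty_zero {m v : ℕ} : ballotF (m + 1) v 0 = ∅ := by
  ext f
  simp only [Set.mem_empty_iff_false, iff_false]
  rintro ⟨h1, -, -, h4⟩
  rw [Finset.card_eq_zero] at h4
  have : 0 ∈ (Finset.range (m+1)).filter (fun i => f i = i) := by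
    have := h1 0 (by omega)
    simp; omega
  rw [h4] at this
  simp at this

lemma filter_update (f : ℕ → ℕ) (m v : ℕ) :
    ((Finset.range (m+1)).filter (fun i => Function.update f m v i = i)).card =
    ((Finset.range m).filter (fun i => f i = i)).card + if v = m then 1 else 0 := by
  rw [Finset.range_add_one, Finset.filter_insert]
  have : (Finset.range m).filter (fun i => Function.update f m v i = i) =
      (Finset.range m).filter (fun i => f i = i) := by
    apply Finset.filter_congr
    intro i hi
    rw [Finset.mem_range] at hi
    rw [Function.update_of_ne (by omega)]
  rw [this]
  simp only [Function.update_self]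
  split_ifs
  · rw [Finset.card_insert_of_notMem (by simp)]
  · rfl

lemma ballotF_succ (m v j j' : ℕ) (hv : v + 1 ≤ m) (hj : j = j' + if v + 1 = m then 1 else 0) :
    ballotF (m + 1) (v + 1) j =
      ballotF (m + 1) v j ∪ (fun f => Function.update f m (v + 1)) '' ballotF m (v + 1) j' := by
  ext f
  simp only [Set.mem_union, Set.mem_image]
  constructor
  · rintro ⟨h1, h2, h3, h4⟩
    by_cases h : f m = v + 1
    · right
      have hu : Function.update (Function.update f m 0) m (v+1) = f := by
        rw [Function.update_idem, ← h, Function.update_eq_self]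
      refine ⟨Function.update f m 0, ⟨?_, ?_, ?_, ?_⟩, hu⟩
      · intro i hi
        rw [Function.update_of_ne (by omega)]
        exact h1 i (by omega)
      · intro i k hik hk
        rw [Function.update_of_ne (by omega), Function.update_of_ne (by omega)]
        exact h2 i k hik (by omega)
      · intro i hi
        by_cases him : i = m
        · subst him; simp
        · rw [Function.update_of_ne him]; exact h3 i (by omega)
      · have := filter_update (Function.update f m 0) m (v+1)
        rw [hu, h4] at this
        omega
    · left
      refine ⟨?_, h2, h3, h4⟩
      intro i hi
      have a := h1 i hi
      have b := h2 i m (by omega) (by omega)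
      have c := h1 m (by omega)
      omega
  · rintro (⟨h1, h2, h3, h4⟩ | ⟨g, ⟨h1, h2, h3, h4⟩, rfl⟩)
    · exact ⟨fun i hi => by have := h1 i hi; omega, h2, h3, h4⟩
    · refine ⟨?_, ?_, ?_, ?_⟩
      · intro i hi
        by_cases him : i = m
        · subst him; simp; omega
        · rw [Function.update_of_ne him]; exact h1 i (by omega)
      · intro i k hik hk
        by_cases hkm : k = m
        · subst hkm
          by_cases hi : i = k
          · subst hi; simp
          · rw [Function.update_of_ne hi, Function.update_self]
            exact (h1 i (by omega)).2
        · rw [Function.update_of_ne (by omega), Function.update_of_ne (by omega)]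
          exact h2 i k hik (by omega)
      · intro i hi
        rw [Function.update_of_ne (by omega)]; exact h3 i (by omega)
      · rw [filter_update, h4, hj]

lemma ballotF_finite (m v j : ℕ) : (ballotF m v j).Finite := by
  have : (ballotF m v j) ⊆ (fun g : Fin m → Fin (m+1) => fun i : ℕ =>
      if h : i < m then (g ⟨i, h⟩ : ℕ) else 0) '' Set.univ := by
    rintro f ⟨h1, h2, h3, h4⟩
    refine ⟨fun i => ⟨f i, by have := h1 i i.2; omega⟩, trivial, ?_⟩
    funext i
    by_cases h : i < m
    · simp [h]
    · simp [h, h3 i (by omega)]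
  exact (Set.finite_univ.image _).subset this

lemma ballotF_card_succ (m v j j' : ℕ) (hv : v + 1 ≤ m)
    (hj : j = j' + if v + 1 = m then 1 else 0) :
    (ballotF (m + 1) (v + 1) j).ncard =
      (ballotF (m + 1) v j).ncard + (ballotF m (v + 1) j').ncard := by
  rw [ballotF_succ m v j j' hv hj, Set.ncard_union_eq _ (ballotF_finite _ _ _)
    ((ballotF_finite _ _ _).image _), Set.InjOn.ncard_image]
  · rintro f ⟨-, -, h3, -⟩ g ⟨-, -, h3', -⟩ h
    funext i
    by_cases him : i = m
    · rw [h3 i (by omega), h3' i (by omega)]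
    · have := congrFun h i
      simpa only [Function.update_of_ne him] using this
  · rw [Set.disjoint_left]
    rintro f ⟨h1, -⟩ ⟨g, -, rfl⟩
    have := (h1 m (by omega)).2
    simp at this

lemma ballotF_card_top (m j : ℕ) :
    ballotF (m + 1) (m + 1) j = ballotF (m + 1) m j := by
  ext f
  constructor
  · rintro ⟨h1, h2⟩
    exact ⟨fun i hi => by have := h1 i hi; omega, h2⟩
  · rintro ⟨h1, h2⟩
    exact ⟨fun i hi => by have := h1 i hi; omega, h2⟩

lemma ballotF_one : ballotF 1 0 1 = {fun _ => 0} := by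
  ext f
  rw [Set.mem_singleton_iff]
  constructor
  · rintro ⟨h1, h2, h3, h4⟩
    funext i
    rcases Nat.lt_or_ge i 1 with h | h
    · exact Nat.le_zero.1 (h1 i h).2
    · exact h3 i h
  · rintro rfl
    refine ⟨by simp, by simp, by simp, by rfl⟩

lemma ballotF_card (m : ℕ) : ∀ k v : ℕ, k ≤ m → v ≤ m →
    (ballotF (m + 1) v (k + 1)).ncard + (m + v - k).choose (m + 1) = (m + v - k).choose m := by
  induction m with
  | zero =>
    intro k v hk hv
    obtain rfl : k = 0 := by omega
    obtain rfl : v = 0 := by omega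
    simp [ballotF_one]
  | succ m ih =>
    intro k v hk
    induction v with
    | zero =>
      intro _
      rw [ballotF_zero_v]
      rcases Nat.lt_or_ge m k with h | h
      · obtain rfl : k = m + 1 := by omega
        rw [ballotF_empty_of_lt (by omega)]
        simp
      · have := ih k 0 h (by omega)
        rcases Nat.eq_zero_or_pos k with h0 | h0
        · subst h0
          simp at this ⊢
          exact this
        · rw [Nat.choose_eq_zero_of_lt (by omega), Nat.choose_eq_zero_of_lt (by omega)] at this
          rw [Nat.choose_eq_zero_of_lt (by omega), Nat.choose_eq_zero_of_lt (by omega)]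
          exact this
    | succ v ihv =>
      intro hv
      have i1 := ihv (by omega)
      by_cases hvm : v = m
      · subst hvm
        rw [ballotF_card_succ (v+1) v (k+1) k (by omega) (by simp), ballotF_card_top]
        have e : v + 1 + (v + 1) - k = (v + 1 + v - k) + 1 := by omega
        rw [e, Nat.choose_succ_succ', Nat.choose_succ_succ']
        rcases k with _ | k
        · rw [ballotF_empty_zero]
          have : (v + 1 + v - 0).choose v = (v+1+v-0).choose (v+1) := by
            apply Nat.choose_symm_of_eq_add; omega
          simp only [Set.ncard_empty]
          omega
        · have i2 := ih k v (by omega) (by omega)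
          have e2 : v + 1 + v - (k + 1) = v + v - k := by omega
          rw [e2] at i1 ⊢
          omega
      · rw [ballotF_card_succ (m+1) v (k+1) (k+1) (by omega) (by simp [hvm])]
        rcases Nat.lt_or_ge m k with h | h
        · obtain rfl : k = m + 1 := by omega
          rw [ballotF_empty_of_lt (m := m + 1) (by omega)]
          rw [Nat.choose_eq_zero_of_lt (by omega), Nat.choose_eq_zero_of_lt (by omega)] at i1
          rw [Nat.choose_eq_zero_of_lt (by omega), Nat.choose_eq_zero_of_lt (by omega)]
          simpa using i1
        · have i2 := ih k (v+1) h (by omega)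
          have e : m + 1 + (v + 1) - k = (m + 1 + v - k) + 1 := by omega
          have e2 : m + (v + 1) - k = m + 1 + v - k := by omega
          rw [e2] at i2
          rw [e, Nat.choose_succ_succ', Nat.choose_succ_succ']
          omega

/-- roots indexed by naturals -/
def rtA (n p q : ℕ) : Fin (n + 1) → ℤ :=
  fun k => (if (k : ℕ) = p then 1 else 0) - (if (k : ℕ) = q then 1 else 0)

lemma stdA_sub (n : ℕ) (i j : Fin (n + 1)) : stdA n i - stdA n j = rtA n i j := by
  funext k
  simp [stdA, rtA, Pi.single_apply, Fin.ext_iff]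

lemma mem_posA {n : ℕ} {x : Fin (n + 1) → ℤ} :
    x ∈ posA n ↔ ∃ p q, p < q ∧ q ≤ n ∧ x = rtA n p q := by
  constructor
  · rintro ⟨i, j, h, rfl⟩
    exact ⟨i, j, h, by omega, stdA_sub n i j⟩
  · rintro ⟨p, q, h, h', rfl⟩
    exact ⟨⟨p, by omega⟩, ⟨q, by omega⟩, h, (stdA_sub n ⟨p, by omega⟩ ⟨q, by omega⟩).symm⟩

lemma mem_simpleA {n : ℕ} {x : Fin (n + 1) → ℤ} :
    x ∈ simpleA n ↔ ∃ p, p < n ∧ x = rtA n p (p + 1) := by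
  constructor
  · rintro ⟨i, j, h, rfl⟩
    exact ⟨i, by omega, by rw [stdA_sub, h]⟩
  · rintro ⟨p, h, rfl⟩
    exact ⟨⟨p, by omega⟩, ⟨p + 1, by omega⟩, rfl, (stdA_sub n ⟨p, by omega⟩ ⟨p + 1, by omega⟩).symm⟩

/-- partial sums -/
def psA (n t : ℕ) (x : Fin (n + 1) → ℤ) : ℤ := ∑ k : Fin (n + 1), if (k : ℕ) ≤ t then x k else 0

lemma sum_ind (n t p : ℕ) (hp : p ≤ n) :
    (∑ k : Fin (n + 1), if (k : ℕ) ≤ t then (if (k : ℕ) = p then (1 : ℤ) else 0) else 0) =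
      if p ≤ t then 1 else 0 := by
  rw [Finset.sum_eq_single (⟨p, by omega⟩ : Fin (n+1))]
  · simp
  · intro b _ hb
    have : (b : ℕ) ≠ p := fun h => hb (Fin.ext h)
    simp [this]
  · simp

lemma psA_rt (n t p q : ℕ) (hp : p ≤ n) (hq : q ≤ n) :
    psA n t (rtA n p q) = (if p ≤ t then 1 else 0) - (if q ≤ t then 1 else 0) := by
  rw [← sum_ind n t p hp, ← sum_ind n t q hq, ← Finset.sum_sub_distrib]
  apply Finset.sum_congr rfl
  intro k _
  unfold rtA
  split_ifs <;> rfl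

lemma psA_add (n t : ℕ) (x y : Fin (n + 1) → ℤ) : psA n t (x + y) = psA n t x + psA n t y := by
  unfold psA
  rw [← Finset.sum_add_distrib]
  apply Finset.sum_congr rfl
  intro k _
  split_ifs <;> simp

lemma psA_nonneg (n t : ℕ) (x : Fin (n + 1) → ℤ) (hx : x ∈ AddSubmonoid.closure (simpleA n)) :
    0 ≤ psA n t x := by
  induction hx using AddSubmonoid.closure_induction with
  | mem x hx =>
    obtain ⟨p, hp, rfl⟩ := mem_simpleA.1 hx
    rw [psA_rt _ _ _ _ (by omega) (by omega)]
    split_ifs <;> first | omega | simp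
  | zero => simp [psA]
  | add x y _ _ hx hy => rw [psA_add]; omega

lemma rt_mem_closure (n p d : ℕ) (h : p + d ≤ n) :
    rtA n p (p + d) ∈ AddSubmonoid.closure (simpleA n) := by
  induction d with
  | zero =>
    have : rtA n p (p + 0) = 0 := by funext k; simp [rtA]
    rw [this]; exact zero_mem _
  | succ d ih =>
    have : rtA n p (p + (d + 1)) = rtA n p (p + d) + rtA n (p + d) (p + d + 1) := by
      funext k; simp only [rtA, Pi.add_apply, ← add_assoc]; ring
    rw [this]
    exact add_mem (ih (by omega))
      (AddSubmonoid.subset_closure (mem_simpleA.2 ⟨p + d, by omega, rfl⟩))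

lemma rootLe_iff (n p q p' q' : ℕ) (h : p < q) (hq : q ≤ n) (h' : p' < q') (hq' : q' ≤ n) :
    rootLeA n (rtA n p q) (rtA n p' q') ↔ p' ≤ p ∧ q ≤ q' := by
  unfold rootLeA
  constructor
  · intro hm
    have key : ∀ t, psA n t (rtA n p q) ≤ psA n t (rtA n p' q') := by
      intro t
      have h1 := psA_nonneg n t _ hm
      have h2 := psA_add n t (rtA n p' q' - rtA n p q) (rtA n p q)
      rw [sub_add_cancel] at h2
      omega
    have k1 := key p
    have k2 := key (q - 1)
    rw [psA_rt _ _ _ _ (by omega) (by omega), psA_rt _ _ _ _ (by omega) (by omega)] at k1 k2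
    split_ifs at k1 k2 <;> omega
  · rintro ⟨h1, h2⟩
    have : rtA n p' q' - rtA n p q = rtA n p' (p' + (p - p')) + rtA n q (q + (q' - q)) := by
      rw [Nat.add_sub_cancel' h1, Nat.add_sub_cancel' h2]
      funext k; simp only [rtA, Pi.add_apply, Pi.sub_apply]; ring
    rw [this]
    exact add_mem (rt_mem_closure _ _ _ (by omega)) (rt_mem_closure _ _ _ (by omega))

lemma rt_inj {n p q p' q' : ℕ} (h : p < q) (hq : q ≤ n) (h' : p' < q') (hq' : q' ≤ n)
    (e : rtA n p q = rtA n p' q') : p = p' ∧ q = q' := by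
  have a := (rootLe_iff n p q p' q' h hq h' hq').1 (by simp [rootLeA, e])
  have b := (rootLe_iff n p' q' p q h' hq' h hq).1 (by simp [rootLeA, e])
  omega

/-- the upper set attached to a sequence -/
def upS (n : ℕ) (f : ℕ → ℕ) : Set (Fin (n + 1) → ℤ) :=
  {x | ∃ p q, p < q ∧ q ≤ n ∧ n + 1 ≤ q + f (n - p) ∧ x = rtA n p q}

lemma mem_upS {n p q : ℕ} {f : ℕ → ℕ} (h : p < q) (hq : q ≤ n) :
    rtA n p q ∈ upS n f ↔ n + 1 ≤ q + f (n - p) := by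
  constructor
  · rintro ⟨p', q', h', hq', hf, e⟩
    obtain ⟨rfl, rfl⟩ := rt_inj h hq h' hq' e
    exact hf
  · intro hf
    exact ⟨p, q, h, hq, hf, rfl⟩

lemma upS_simple (n : ℕ) (f : ℕ → ℕ) (hf : ∀ i < n + 1, f i ≤ i) :
    (upS n f ∩ simpleA n).ncard + 1 =
      ((Finset.range (n + 1)).filter (fun i => f i = i)).card := by
  have h0 : (Finset.range (n + 1)).filter (fun i => f i = i) =
      insert 0 ((Finset.Icc 1 n).filter (fun i => f i = i)) := by
    ext i
    simp only [Finset.mem_filter, Finset.mem_range, Finset.mem_insert, Finset.mem_Icc]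
    have := hf 0 (by omega)
    constructor
    · rintro ⟨h1, h2⟩
      omega
    · rintro (rfl | h)
      · omega
      · omega
  rw [h0, Finset.card_insert_of_notMem (by simp)]
  congr 1
  rw [← Set.ncard_coe_finset]
  have : upS n f ∩ simpleA n = (fun i => rtA n (n - i) (n - i + 1)) ''
      (((Finset.Icc 1 n).filter (fun i => f i = i) : Finset ℕ) : Set ℕ) := by
    ext x
    simp only [Set.mem_inter_iff, Set.mem_image, Finset.coe_filter, Set.mem_ofPred_eq,
      Finset.mem_Icc]
    constructor
    · rintro ⟨hx, hs⟩
      obtain ⟨p, hp, rfl⟩ := mem_simpleA.1 hs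
      rw [mem_upS (by omega) (by omega)] at hx
      have := hf (n - p) (by omega)
      refine ⟨n - p, ⟨by omega, by omega⟩, ?_⟩
      rw [Nat.sub_sub_self (by omega)]
    · rintro ⟨i, ⟨hi, hfi⟩, rfl⟩
      refine ⟨(mem_upS (by omega) (by omega)).2 ?_, mem_simpleA.2 ⟨n - i, by omega, rfl⟩⟩
      rw [Nat.sub_sub_self (by omega)]
      omega
  rw [this, Set.InjOn.ncard_image]
  intro i hi k hk e
  simp only [Finset.coe_filter, Set.mem_ofPred_eq, Finset.mem_Icc] at hi hk
  have := rt_inj (by omega) (by omega) (by omega) (by omega) e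
  omega

lemma upS_upper (n : ℕ) (f : ℕ → ℕ) (hf : ∀ i k, i ≤ k → k < n + 1 → f i ≤ f k) :
    isUpperA n (upS n f) := by
  constructor
  · rintro x ⟨p, q, h, hq, -, rfl⟩
    exact mem_posA.2 ⟨p, q, h, hq, rfl⟩
  · rintro x ⟨p, q, h, hq, hx, rfl⟩ y hy hle
    obtain ⟨p', q', h', hq', rfl⟩ := mem_posA.1 hy
    rw [rootLe_iff n p q p' q' h hq h' hq'] at hle
    rw [mem_upS h' hq']
    have := hf (n - p) (n - p') (by omega) (by omega)
    omega

lemma exists_seq (n : ℕ) (S : Set (Fin (n + 1) → ℤ)) (hS : isUpperA n S) :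
    ∃ f : ℕ → ℕ, (∀ i < n + 1, f i ≤ i) ∧ (∀ i k, i ≤ k → k < n + 1 → f i ≤ f k) ∧
      (∀ i, n + 1 ≤ i → f i = 0) ∧ upS n f = S := by
  classical
  obtain ⟨hS1, hS2⟩ := hS
  let g : ℕ → ℕ := fun i => Nat.findGreatest (fun a => rtA n (n - i) (n + 1 - a) ∈ S) i
  have gle : ∀ i, g i ≤ i := fun i => Nat.findGreatest_le i
  have gspec : ∀ i, g i ≠ 0 → rtA n (n - i) (n + 1 - g i) ∈ S := fun i h =>
    Nat.findGreatest_of_ne_zero (P := fun a => rtA n (n - i) (n + 1 - a) ∈ S) rfl h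
  have gge : ∀ i a, a ≤ i → rtA n (n - i) (n + 1 - a) ∈ S → a ≤ g i := fun i a h h' =>
    Nat.le_findGreatest (P := fun a => rtA n (n - i) (n + 1 - a) ∈ S) h h'
  have up : ∀ p q p' q', p < q → q ≤ n → p' ≤ p → q ≤ q' → q' ≤ n →
      rtA n p q ∈ S → rtA n p' q' ∈ S := by
    intro p q p' q' h1 h2 h3 h4 h5 h
    exact hS2 _ h _ (mem_posA.2 ⟨p', q', by omega, h5, rfl⟩)
      ((rootLe_iff n p q p' q' h1 h2 (by omega) h5).2 ⟨h3, h4⟩)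
  refine ⟨fun i => if i < n + 1 then g i else 0, ?_, ?_, ?_, ?_⟩
  · intro i hi
    simp only [hi, if_true]; exact gle i
  · intro i k hik hk
    have hi : i < n + 1 := by omega
    simp only [hi, hk, if_true]
    by_cases h0 : g i = 0
    · omega
    · have := gle i
      exact gge k (g i) (by omega)
        (up (n - i) _ _ _ (by omega) (by omega) (by omega) le_rfl (by omega) (gspec i h0))
  · intro i hi
    exact if_neg (by omega)
  · ext x
    constructor
    · rintro ⟨p, q, h, hq, hx, rfl⟩
      beta_reduce at hx
      rw [if_pos (by omega)] at hx
      have h1 := gle (n - p)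
      have h2 := gspec (n - p) (by omega)
      rw [Nat.sub_sub_self (by omega)] at h2
      exact up _ _ _ _ (by omega) (by omega) le_rfl (by omega) hq h2
    · intro hx
      obtain ⟨p, q, h, hq, rfl⟩ := mem_posA.1 (hS1 hx)
      rw [mem_upS h hq, if_pos (by omega)]
      have := gge (n - p) (n + 1 - q) (by omega) (by
        rw [Nat.sub_sub_self (by omega), Nat.sub_sub_self (by omega)]; exact hx)
      omega

lemma upS_inj (n : ℕ) (f g : ℕ → ℕ) (hf : ∀ i < n + 1, f i ≤ i) (hg : ∀ i < n + 1, g i ≤ i)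
    (h : upS n f ⊆ upS n g) : ∀ i < n + 1, f i ≤ g i := by
  intro i hi
  by_cases h0 : f i = 0
  · omega
  · have h1 := hf i hi
    have h2 : rtA n (n - i) (n + 1 - f i) ∈ upS n f := by
      rw [mem_upS (by omega) (by omega), Nat.sub_sub_self (by omega)]
      omega
    have h3 := h h2
    rw [mem_upS (by omega) (by omega), Nat.sub_sub_self (by omega)] at h3
    omega

lemma upper_card (n j : ℕ) :
    {S : Set (Fin (n + 1) → ℤ) | isUpperA n S ∧ (S ∩ simpleA n).ncard = j}.ncard =
      (ballotF (n + 1) n (j + 1)).ncard := by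
  have : {S : Set (Fin (n + 1) → ℤ) | isUpperA n S ∧ (S ∩ simpleA n).ncard = j} =
      upS n '' ballotF (n + 1) n (j + 1) := by
    ext S
    constructor
    · rintro ⟨hS, hc⟩
      obtain ⟨f, h1, h2, h3, rfl⟩ := exists_seq n S hS
      refine ⟨f, ⟨fun i hi => ⟨h1 i hi, ?_⟩, h2, h3, ?_⟩, rfl⟩
      · have := h1 i hi; omega
      · rw [← upS_simple n f h1, hc]
    · rintro ⟨f, ⟨h1, h2, h3, h4⟩, rfl⟩
      refine ⟨upS_upper n f h2, ?_⟩
      have := upS_simple n f (fun i hi => (h1 i hi).1)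
      omega
  rw [this, Set.InjOn.ncard_image]
  rintro f ⟨h1, -, h3, -⟩ g ⟨h1', -, h3', -⟩ e
  funext i
  rcases Nat.lt_or_ge i (n + 1) with h | h
  · exact le_antisymm
      (upS_inj n f g (fun i hi => (h1 i hi).1) (fun i hi => (h1' i hi).1) e.subset i h)
      (upS_inj n g f (fun i hi => (h1' i hi).1) (fun i hi => (h1 i hi).1) e.symm.subset i h)
  · rw [h3 i h, h3' i h]

theorem stmt_5 (n j : ℕ) (hn : 1 ≤ n) (hj : j ≤ n) :
    (Nat.card {S : Set (Fin (n + 1) → ℤ) //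
        isUpperA n S ∧ (S ∩ simpleA n).ncard = j} : ℚ) =
      ((j : ℚ) + 1) / ((n : ℚ) + 1) * ((2 * n - j).choose n : ℚ) := by
  have h1 : Nat.card {S : Set (Fin (n + 1) → ℤ) //
        isUpperA n S ∧ (S ∩ simpleA n).ncard = j} = (ballotF (n + 1) n (j + 1)).ncard :=
    upper_card n j
  rw [h1]
  have h2 := ballotF_card n j n hj le_rfl
  rw [← two_mul] at h2
  have h3 := Nat.choose_succ_right_eq (2 * n - j) n
  have e : 2 * n - j - n = n - j := by omega
  rw [e] at h3
  have h2' : ((ballotF (n + 1) n (j + 1)).ncard : ℚ) + ((2 * n - j).choose (n + 1) : ℚ) =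
    ((2 * n - j).choose n : ℚ) := by exact_mod_cast h2
  have h3' : ((2 * n - j).choose (n + 1) : ℚ) * ((n : ℚ) + 1) =
    ((2 * n - j).choose n : ℚ) * ((n : ℚ) - j) := by
    rw [← Nat.cast_sub hj]; exact_mod_cast h3
  have hpos : (n : ℚ) + 1 ≠ 0 := by positivity
  rw [div_mul_eq_mul_div, eq_div_iff hpos]
  linear_combination ((n : ℚ) + 1) * h2' - h3'
end

section
/- For all n ≥ 1 and 0 ≤ j ≤ n, the number of upper sets S of the root poset of type B_n with |S ∩ Π| = j equals C(2n−j−1, n−1), where C(a,b) denotes the binomial coefficient. -/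
/-- The standard basis vector `e i` of `ℤ^n`. -/
def stdB (n : ℕ) (i : Fin n) : Fin n → ℤ := Pi.single i 1

/-- The set of positive roots of type `B_n`:
`e i - e j` and `e i + e j` for `i < j`, and `e i`. -/
def posB (n : ℕ) : Set (Fin n → ℤ) :=
  {x | (∃ i j : Fin n, i < j ∧ x = stdB n i - stdB n j) ∨
    (∃ i j : Fin n, i < j ∧ x = stdB n i + stdB n j) ∨ (∃ i : Fin n, x = stdB n i)}

/-- The set of simple roots of type `B_n`: `α i = e i - e (i+1)` for `i < n - 1`
together with the last simple root `e (n-1)`. -/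
def simpleB (n : ℕ) : Set (Fin n → ℤ) :=
  {x | (∃ i j : Fin n, (i : ℕ) + 1 = (j : ℕ) ∧ x = stdB n i - stdB n j) ∨
    (∃ i : Fin n, (i : ℕ) + 1 = n ∧ x = stdB n i)}

/-- The root poset order of type `B_n`. -/
def rootLeB (n : ℕ) (a b : Fin n → ℤ) : Prop :=
  b - a ∈ AddSubmonoid.closure (simpleB n)

/-- `S` is an upper set of the root poset of type `B_n`. -/
def isUpperB (n : ℕ) (S : Set (Fin n → ℤ)) : Prop :=
  S ⊆ posB n ∧ ∀ a ∈ S, ∀ b ∈ posB n, rootLeB n a b → b ∈ S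

namespace BB

/-! Counting part: abstract recursion. -/

def R (M i c : ℕ) : Set (ℕ × ℕ) := {p | i ≤ p.1 ∧ c ≤ p.2 ∧ p.1 < p.2 ∧ p.1 + p.2 < M}

def dg : Set (ℕ × ℕ) := {p | p.2 = p.1 + 1}

def Up (M i c : ℕ) (T : Set (ℕ × ℕ)) : Prop :=
  T ⊆ R M i c ∧ ∀ a ∈ T, ∀ b ∈ R M i c, b.1 ≤ a.1 → a.2 ≤ b.2 → b ∈ T

def U (M i c j : ℕ) : Set (Set (ℕ × ℕ)) := {T | Up M i c T ∧ (T ∩ dg).ncard = j}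

lemma R_finite (M i c : ℕ) : (R M i c).Finite := by
  apply Set.Finite.subset ((Set.finite_Iio M).prod (Set.finite_Iio M))
  rintro ⟨a, b⟩ h
  simp only [R, Set.mem_ofPred_eq] at h
  simp only [Set.mem_prod, Set.mem_Iio]
  omega

lemma U_finite (M i c j : ℕ) : (U M i c j).Finite :=
  (R_finite M i c).finite_subsets.subset (fun _ h => h.1.1)

def row (M i c : ℕ) : Set (ℕ × ℕ) := {p | p.1 = i ∧ c ≤ p.2 ∧ p.1 + p.2 < M}

lemma U_diag (M i j : ℕ) : U M i i j = U M i (i+1) j := by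
  have : R M i i = R M i (i+1) := by
    ext ⟨a, b⟩; simp only [R, Set.mem_ofPred_eq]; omega
  simp only [U, Up, this]

lemma U_empty (M i c j : ℕ) (h : M ≤ i + c) : U M i c j = {T | T = ∅ ∧ j = 0} := by
  have : R M i c = ∅ := by
    rw [Set.eq_empty_iff_forall_notMem]
    rintro ⟨a, b⟩ h; simp only [R, Set.mem_ofPred_eq] at h; omega
  ext T
  simp only [U, Up, this, Set.mem_ofPred_eq, Set.subset_empty_iff]
  constructor
  · rintro ⟨⟨rfl, -⟩, h⟩
    simp at h
    exact ⟨rfl, h.symm⟩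
  · rintro ⟨rfl, rfl⟩
    simp

lemma U_notMem (M i c j : ℕ) (hic : i < c) (hM : i + c < M) :
    {T ∈ U M i c j | (i, c) ∉ T} = U M i (c+1) j := by
  ext T
  simp only [U, Up, Set.mem_ofPred_eq]
  constructor
  · rintro ⟨⟨⟨h1, h2⟩, h3⟩, h4⟩
    refine ⟨⟨?_, ?_⟩, h3⟩
    · rintro ⟨a, b⟩ hab
      have hr := h1 hab
      simp only [R, Set.mem_ofPred_eq] at hr ⊢
      have : b ≠ c := by
        rintro rfl
        exact h4 (h2 _ hab (i, b) (by simp only [R, Set.mem_ofPred_eq]; omega) hr.1 le_rfl)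
      omega
    · intro a ha b hb
      exact h2 a ha b (by simp only [R, Set.mem_ofPred_eq] at hb ⊢; omega)
  · rintro ⟨⟨h1, h2⟩, h3⟩
    refine ⟨⟨⟨?_, ?_⟩, h3⟩, ?_⟩
    · rintro a ha
      have hr := h1 ha
      simp only [R, Set.mem_ofPred_eq] at hr ⊢
      omega
    · intro a ha b hb hx hy
      have hr := h1 ha
      refine h2 a ha b ?_ hx hy
      simp only [R, Set.mem_ofPred_eq] at hb hr ⊢
      omega
    · intro h
      have := h1 h
      simp only [R, Set.mem_ofPred_eq] at this
      omega

lemma diag_count (M i c : ℕ) (hic : i < c) (hM : i + c < M) (T : Set (ℕ × ℕ))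
    (hT : T ⊆ R M (i+1) c) :
    ((T ∪ row M i c) ∩ dg).ncard = (T ∩ dg).ncard + (if c = i + 1 then 1 else 0) := by
  have hfin : T.Finite := (R_finite _ _ _).subset hT
  split_ifs with h
  · have : (T ∪ row M i c) ∩ dg = insert (i, c) (T ∩ dg) := by
      ext ⟨a, b⟩
      simp only [row, dg, Set.mem_inter_iff, Set.mem_union, Set.mem_ofPred_eq, Set.mem_insert_iff,
        Prod.mk.injEq]
      constructor
      · rintro ⟨h1 | h1, h2⟩
        · exact Or.inr ⟨h1, h2⟩
        · left; omega
      · rintro (h1 | h1)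
        · refine ⟨Or.inr ?_, ?_⟩ <;> omega
        · exact ⟨Or.inl h1.1, h1.2⟩
    rw [this, Set.ncard_insert_of_notMem _ (hfin.subset Set.inter_subset_left)]
    intro h
    have := hT h.1
    simp only [R, Set.mem_ofPred_eq] at this
    omega
  · congr 1
    ext ⟨a, b⟩
    simp only [row, dg, Set.mem_inter_iff, Set.mem_union, Set.mem_ofPred_eq]
    constructor
    · rintro ⟨h1 | h1, h2⟩
      · exact ⟨h1, h2⟩
      · omega
    · rintro ⟨h1, h2⟩
      exact ⟨Or.inl h1, h2⟩

lemma U_mem (M i c j : ℕ) (hic : i < c) (hM : i + c < M) :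
    {T ∈ U M i c j | (i, c) ∈ T} =
      (fun T => T ∪ row M i c) '' {T | Up M (i+1) c T ∧
        (T ∩ dg).ncard + (if c = i + 1 then 1 else 0) = j} := by
  ext T
  simp only [U, Set.mem_ofPred_eq, Set.mem_image]
  constructor
  · rintro ⟨⟨⟨h1, h2⟩, h3⟩, h4⟩
    have hs : T ∩ R M (i+1) c ∪ row M i c = T := by
      ext ⟨a, b⟩
      simp only [Set.mem_union, Set.mem_inter_iff]
      constructor
      · rintro (h | h)
        · exact h.1
        · simp only [row, Set.mem_ofPred_eq] at h
          refine h2 _ h4 _ ?_ ?_ ?_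
          · simp only [R, Set.mem_ofPred_eq]; omega
          · simp only; omega
          · simp only; omega
      · intro h
        have := h1 h
        simp only [R, row, Set.mem_ofPred_eq] at this ⊢
        by_cases hh : a = i
        · right; omega
        · left; exact ⟨h, by omega⟩
    refine ⟨T ∩ R M (i+1) c, ⟨⟨Set.inter_subset_right, ?_⟩, ?_⟩, hs⟩
    · intro a ha b hb hx hy
      refine ⟨h2 a ha.1 b ?_ hx hy, hb⟩
      simp only [R, Set.mem_ofPred_eq] at hb ⊢; omega
    · rw [← diag_count M i c hic hM _ Set.inter_subset_right, hs, h3]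
  · rintro ⟨T, ⟨⟨h1, h2⟩, h3⟩, rfl⟩
    refine ⟨⟨⟨?_, ?_⟩, ?_⟩, ?_⟩
    · rintro a (ha | ha)
      · have := h1 ha
        simp only [R, Set.mem_ofPred_eq] at this ⊢; omega
      · simp only [row, R, Set.mem_ofPred_eq] at ha ⊢; omega
    · rintro a ha b hb hx hy
      by_cases hh : b.1 = i
      · right
        simp only [row, R, Set.mem_ofPred_eq] at hb ⊢; omega
      · rcases ha with ha | ha
        · left
          refine h2 a ha b ?_ hx hy
          simp only [R, Set.mem_ofPred_eq] at hb ⊢; omega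
        · simp only [row, R, Set.mem_ofPred_eq] at hb ha; omega
    · rw [diag_count M i c hic hM _ h1, h3]
    · right
      exact ⟨rfl, le_rfl, hM⟩

lemma row_inj (M i c : ℕ) : Set.InjOn (fun T => T ∪ row M i c) {T | Up M (i+1) c T} := by
  have key : ∀ T, Up M (i+1) c T → T = (T ∪ row M i c) ∩ R M (i+1) c := by
    intro T hT
    ext a
    constructor
    · intro h; exact ⟨Or.inl h, hT.1 h⟩
    · rintro ⟨h | h, h'⟩
      · exact h
      · simp only [row, R, Set.mem_ofPred_eq] at h h'; omega
  intro T hT T' hT' h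
  simp only at h
  rw [key T hT, key T' hT', h]

lemma U_rec (M i c j : ℕ) (hic : i < c) (hM : i + c < M) :
    (U M i c j).ncard = (U M i (c+1) j).ncard +
      {T | Up M (i+1) c T ∧ (T ∩ dg).ncard + (if c = i + 1 then 1 else 0) = j}.ncard := by
  have h1 := U_notMem M i c j hic hM
  have h2 := U_mem M i c j hic hM
  have hs : U M i c j = {T ∈ U M i c j | (i, c) ∉ T} ∪ {T ∈ U M i c j | (i, c) ∈ T} := by
    ext T; simp only [Set.mem_union, Set.mem_ofPred_eq]; tauto
  have f1 : {T ∈ U M i c j | (i, c) ∉ T}.Finite := (U_finite M i c j).subset (fun T h => h.1)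
  have f2 : {T ∈ U M i c j | (i, c) ∈ T}.Finite := (U_finite M i c j).subset (fun T h => h.1)
  rw [hs, Set.ncard_union_eq ?_ f1 f2, h1, h2, Set.InjOn.ncard_image]
  · exact (row_inj M i c).mono (fun T h => h.1)
  · rw [Set.disjoint_left]; intro T h h'; exact h.2 h'.2

/-- path count: height `h`, `m` steps left, `j` returns -/
def N : ℕ → ℕ → ℕ → ℕ
  | 0, _, j => if j = 0 then 1 else 0
  | m+1, 0, j => N m 1 j
  | m+1, 1, 0 => N m 2 0
  | m+1, 1, j+1 => N m 2 (j+1) + N m 0 j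
  | m+1, h+2, j => N m (h+3) j + N m (h+1) j

lemma U_card (m : ℕ) : ∀ i h j, (U (i + (i + h) + m) i (i+h) j).ncard = N m h j := by
  induction m with
  | zero =>
    intro i h j
    rw [U_empty _ _ _ _ (by omega), N]
    split_ifs with hj
    · simp [hj]
    · simp [hj]
  | succ m ih =>
    intro i h j
    match h, j with
    | 0, j =>
      have := ih i 1 j
      rw [N, ← this, show i + 0 = i by rfl, U_diag]
      congr 2; omega
    | 1, 0 =>
      rw [U_rec _ _ _ _ (by omega) (by omega), N, ← ih i 2 0]
      simp
      congr 2; omega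
    | 1, j+1 =>
      rw [U_rec _ _ _ _ (by omega) (by omega), N, ← ih i 2 (j+1), ← ih (i+1) 0 j]
      congr 1
      · congr 2; omega
      · simp only [if_true, U, add_left_inj]
        have e1 : i + (i + 1) + (m+1) = i + 1 + (i + 1 + 0) + m := by omega
        rw [e1]
    | h+2, j =>
      rw [U_rec _ _ _ _ (by omega) (by omega), N, ← ih i (h+3) j, ← ih (i+1) (h+1) j]
      congr 1
      · congr 2; omega
      · rw [if_neg (by omega)]
        simp only [U, add_zero]
        congr 4
        have e1 : i + (i + (h+2)) + (m+1) = i + 1 + (i + 1 + (h+1)) + m := by omega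
        have e2 : i + (h + 2) = i + 1 + (h + 1) := by omega
        rw [e1, e2]

lemma N_zero (m : ℕ) : ∀ h j, m < j → N m h j = 0 := by
  induction m with
  | zero => intro h j hj; rw [N, if_neg (by omega)]
  | succ m ih =>
    intro h j hj
    match h, j with
    | 0, j => rw [N]; exact ih _ _ (by omega)
    | 1, 0 => omega
    | 1, j+1 => rw [N, ih _ _ (by omega), ih _ _ (by omega)]
    | h+2, j => rw [N, ih _ _ (by omega), ih _ _ (by omega)]

def G (m x : ℕ) : ℕ := ∑ k ∈ Finset.range x, m.choose k

lemma G_rec (m x : ℕ) : G (m+1) (x+1) = G m (x+1) + G m x := by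
  unfold G
  rw [Finset.sum_range_succ' _ x, Finset.sum_range_succ' _ x]
  simp only [Nat.choose_succ_succ', Finset.sum_add_distrib, Nat.choose_zero_right]
  omega

lemma G_zero (m : ℕ) : G m 0 = 0 := by simp [G]

lemma G_rec' (m x y z : ℕ) (h : y = x) (h' : z + 1 = x ∨ x = 0 ∧ z = 0) :
    G (m+1) x = G m y + G m z := by
  subst h
  rcases h' with h | ⟨rfl, rfl⟩
  · subst h; exact G_rec _ _
  · simp [G_zero]

lemma N_pos (m : ℕ) : ∀ h, N m (h+1) 0 + G m ((m - h) / 2) = G m ((m + h + 2) / 2) := by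
  induction m with
  | zero =>
    intro h
    rw [N]
    have : G 0 ((0 + h + 2)/2) = 1 := by
      rw [show (0 + h + 2)/2 = h/2 + 1 by omega, G, Finset.sum_range_succ']
      simp
    rw [this]; simp [G_zero]
  | succ m ih =>
    intro h
    match h with
    | 0 =>
      rw [N]
      have h1 : N m 2 0 + G m ((m-1)/2) = G m ((m+1+2)/2) := ih 1
      have h2 := G_rec' m ((m+1+0+2)/2) ((m+1+2)/2) ((m+1)/2) (by omega) (by omega)
      have h3 := G_rec' m ((m+1-0)/2) ((m+1)/2) ((m-1)/2) (by omega) (by omega)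
      omega
    | h+1 =>
      rw [N]
      have h1 : N m (h+3) 0 + G m ((m-(h+2))/2) = G m ((m+(h+2)+2)/2) := ih (h+2)
      have h1' := ih h
      have h2 := G_rec' m ((m+1+(h+1)+2)/2) ((m+(h+2)+2)/2) ((m+h+2)/2) (by omega) (by omega)
      have h3 := G_rec' m ((m+1-(h+1))/2) ((m-h)/2) ((m-(h+2))/2) (by omega) (by omega)
      omega

lemma N_one (m : ℕ) : N m 1 0 = m.choose (m/2) := by
  have := N_pos m 0
  rw [show (m+0+2)/2 = m/2+1 by omega, G, G, Finset.sum_range_succ] at this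
  simp at this
  omega

lemma choose_rec (a x y z : ℕ) (h : y = x) (h' : z + 1 = x) :
    (a+1).choose x = a.choose y + a.choose z := by
  subst h; subst h'; rw [Nat.choose_succ_succ']; omega

lemma N_formula (m : ℕ) : ∀ h j a, m = j + 1 + a →
    N m (h+1) (j+1) = a.choose ((m + h) / 2) := by
  induction m using Nat.strong_induction_on with
  | _ m ih =>
  match m, ih with
  | 0, ih => intro h j a hm; omega
  | m+1, ih =>
    intro h j a hm
    match h, a with
    | 0, 0 =>
      rw [N, N_zero m 2 _ (by omega), Nat.zero_add]
      obtain rfl : m = j := by omega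
      match m with
      | 0 => simp [N]
      | m+1 =>
        rw [N, N_zero m _ _ (by omega), Nat.choose_eq_zero_of_lt (by omega)]
    | 0, a+1 =>
      rw [N, ih m (by omega) 1 j a (by omega)]
      obtain ⟨m, rfl⟩ : ∃ k, m = k + 1 := ⟨m - 1, by omega⟩
      rw [N, choose_rec a ((m+1+1+0)/2) ((m+1+1)/2) (m/2) (by omega) (by omega)]
      congr 1
      match j with
      | 0 => rw [N_one]; congr 1; omega
      | j+1 =>
        rw [ih m (by omega) 0 j a (by omega)]; congr 1
    | h+1, 0 =>
      rw [N, N_zero m _ _ (by omega), N_zero m _ _ (by omega), Nat.choose_eq_zero_of_lt (by omega)]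
    | h+1, a+1 =>
      rw [N, ih m (by omega) (h+2) j a (by omega), ih m (by omega) h j a (by omega)]
      rw [choose_rec a _ ((m + (h+2))/2) ((m+h)/2) (by omega) (by omega)]

lemma N_final (n j : ℕ) (hn : 1 ≤ n) (hj : j ≤ n) :
    N (2*n) 0 j = (2 * n - j - 1).choose (n - 1) := by
  obtain ⟨m, rfl⟩ : ∃ k, n = k + 1 := ⟨n - 1, by omega⟩
  rw [show 2 * (m+1) = 2*m+1+1 by ring, N]
  match j with
  | 0 => rw [N_one]; congr 1; omega
  | j+1 =>
    rw [N_formula (2*m+1) 0 j (2*m - j) (by omega)]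
    congr 1 <;> omega

/-! Transfer part. -/

def E (n k : ℕ) : Fin n → ℤ := fun x => if (x : ℕ) = k then 1 else 0

lemma stdB_eq (n : ℕ) (i : Fin n) : stdB n i = E n i := by
  ext x
  simp only [stdB, E, Pi.single_apply, Fin.ext_iff]

lemma E_ge (n k : ℕ) (h : n ≤ k) : E n k = 0 := by
  ext x
  have := x.2
  simp only [E, Pi.zero_apply]
  rw [if_neg (by omega)]

lemma simple_iff (n : ℕ) (x : Fin n → ℤ) :
    x ∈ simpleB n ↔ ∃ k, k < n ∧ x = E n k - E n (k+1) := by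
  simp only [simpleB, Set.mem_ofPred_eq, stdB_eq]
  constructor
  · rintro (⟨i, j, h, rfl⟩ | ⟨i, h, rfl⟩)
    · exact ⟨i, i.2, by rw [h]⟩
    · exact ⟨i, i.2, by rw [E_ge n (i+1) (by omega), sub_zero]⟩
  · rintro ⟨k, hk, rfl⟩
    by_cases h : k + 1 = n
    · right
      exact ⟨⟨k, hk⟩, h, by rw [E_ge n (k+1) (by omega), sub_zero]⟩
    · left
      exact ⟨⟨k, hk⟩, ⟨k+1, by omega⟩, rfl, rfl⟩

def phi (n : ℕ) (p : ℕ × ℕ) : Fin n → ℤ := E n p.1 - E n p.2 + E n (2*n - p.2)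

lemma posB_eq (n : ℕ) : posB n = phi n '' R (2*n) 0 0 := by
  ext x
  simp only [posB, Set.mem_ofPred_eq, stdB_eq, Set.mem_image, phi, R]
  constructor
  · rintro (⟨i, j, h, rfl⟩ | ⟨i, j, h, rfl⟩ | ⟨i, rfl⟩)
    · refine ⟨(i, j), by simp only; omega, ?_⟩
      simp only
      rw [E_ge n (2*n-j) (by omega), add_zero]
    · refine ⟨(i, 2*n - j), by simp only; omega, ?_⟩
      simp only
      rw [E_ge n (2*n-j) (by omega), sub_zero, show 2*n - (2*n-j) = (j:ℕ) by omega]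
    · refine ⟨(i, n), by simp only; omega, ?_⟩
      simp only
      rw [E_ge n n le_rfl, E_ge n (2*n-n) (by omega), sub_zero, add_zero]
  · rintro ⟨⟨i, c⟩, h, rfl⟩
    simp only at h ⊢
    rcases lt_trichotomy c n with hc | hc | hc
    · left
      refine ⟨⟨i, by omega⟩, ⟨c, hc⟩, by simp only [Fin.mk_lt_mk]; omega, ?_⟩
      rw [E_ge n (2*n-c) (by omega), add_zero]
    · right; right
      refine ⟨⟨i, by omega⟩, ?_⟩
      rw [E_ge n c (by omega), E_ge n (2*n-c) (by omega), sub_zero, add_zero]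
    · right; left
      refine ⟨⟨i, by omega⟩, ⟨2*n-c, by omega⟩, by simp only [Fin.mk_lt_mk]; omega, ?_⟩
      rw [E_ge n c (by omega), sub_zero]

lemma E_sub_mem (n a b : ℕ) (h : a ≤ b) :
    E n a - E n b ∈ AddSubmonoid.closure (simpleB n) := by
  induction b, h using Nat.le_induction with
  | base => rw [sub_self]; exact zero_mem _
  | succ b hb ih =>
    have : E n b - E n (b+1) ∈ AddSubmonoid.closure (simpleB n) := by
      by_cases hh : b < n
      · exact AddSubmonoid.subset_closure ((simple_iff n _).2 ⟨b, hh, rfl⟩)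
      · rw [E_ge n b (by omega), E_ge n (b+1) (by omega), sub_self]; exact zero_mem _
    have := add_mem ih this
    rwa [sub_add_sub_cancel] at this

def ps (n k : ℕ) : (Fin n → ℤ) →+ ℤ where
  toFun x := ∑ i : Fin n, if (i : ℕ) ≤ k then x i else 0
  map_zero' := by simp
  map_add' x y := by
    rw [← Finset.sum_add_distrib]
    apply Finset.sum_congr rfl
    intro i _
    split_ifs <;> simp

lemma ps_E (n k a : ℕ) (hk : k < n) : ps n k (E n a) = if a ≤ k then 1 else 0 := by
  simp only [ps, AddMonoidHom.coe_mk, ZeroHom.coe_mk, E]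
  split_ifs with h
  · rw [Finset.sum_eq_single (⟨a, by omega⟩ : Fin n)]
    · simp [h]
    · intro b _ hb
      have : (b : ℕ) ≠ a := fun h => hb (Fin.ext h)
      simp [this]
    · simp
  · apply Finset.sum_eq_zero
    intro b _
    split_ifs <;> first | rfl | omega

lemma ps_nonneg (n k : ℕ) (hk : k < n) (x : Fin n → ℤ)
    (hx : x ∈ AddSubmonoid.closure (simpleB n)) : 0 ≤ ps n k x := by
  induction hx using AddSubmonoid.closure_induction with
  | mem x hx =>
    obtain ⟨a, ha, rfl⟩ := (simple_iff n x).1 hx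
    rw [map_sub, ps_E n k _ hk, ps_E n k _ hk]
    split_ifs <;> omega
  | zero => simp
  | add x y _ _ h1 h2 => rw [map_add]; omega

lemma le_iff (n : ℕ) (p q : ℕ × ℕ) (hp : p ∈ R (2*n) 0 0) (hq : q ∈ R (2*n) 0 0) :
    rootLeB n (phi n p) (phi n q) ↔ q.1 ≤ p.1 ∧ p.2 ≤ q.2 := by
  obtain ⟨i, c⟩ := p
  obtain ⟨i', c'⟩ := q
  simp only [R, Set.mem_ofPred_eq] at hp hq
  constructor
  · intro h
    have key : ∀ k, k < n → _ := fun k hk => ps_nonneg n k hk _ h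
    simp only [phi, map_sub, map_add] at key ⊢
    have key' : ∀ k, k < n → (0:ℤ) ≤ ((if i' ≤ k then 1 else 0) - (if c' ≤ k then 1 else 0) +
      (if 2*n - c' ≤ k then 1 else 0)) - ((if i ≤ k then 1 else 0) - (if c ≤ k then 1 else 0) +
      (if 2*n - c ≤ k then 1 else 0)) := by
      intro k hk
      have := key k hk
      simpa only [ps_E n k _ hk] using this
    have k1 := key' i (by omega)
    constructor
    · by_contra hlt
      split_ifs at k1 <;> omega
    · by_contra hlt
      by_cases hc : c ≤ n
      · have k2 := key' (c-1) (by omega)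
        split_ifs at k2 <;> omega
      · have k2 := key' (2*n-c) (by omega)
        split_ifs at k2 <;> omega
  · rintro ⟨h1, h2⟩
    simp only at h1 h2
    have := add_mem (add_mem (E_sub_mem n i' i h1) (E_sub_mem n c c' h2))
      (E_sub_mem n (2*n-c') (2*n-c) (by omega))
    rw [rootLeB]
    convert this using 1
    simp only [phi]
    abel

lemma phi_inj (n : ℕ) : Set.InjOn (phi n) (R (2*n) 0 0) := by
  intro p hp q hq h
  have h0 : ∀ x, rootLeB n x x := fun x => by rw [rootLeB, sub_self]; exact zero_mem _
  have h1 := (le_iff n p q hp hq).1 (h ▸ h0 _)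
  have h2 := (le_iff n q p hq hp).1 (h ▸ h0 _)
  ext <;> omega

lemma phi_simple (n : ℕ) (p : ℕ × ℕ) (hp : p ∈ R (2*n) 0 0) :
    phi n p ∈ simpleB n ↔ p ∈ dg := by
  have key : ∀ k, k < n → phi n (k, k+1) = E n k - E n (k+1) := by
    intro k hk
    simp only [phi]
    rw [E_ge n (2*n-(k+1)) (by omega), add_zero]
  rw [simple_iff]
  constructor
  · rintro ⟨k, hk, h⟩
    rw [← key k hk] at h
    rw [phi_inj n hp (by simp only [R, Set.mem_ofPred_eq]; omega) h]
    rfl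
  · intro h
    obtain ⟨a, b⟩ := p
    simp only [dg, R, Set.mem_ofPred_eq] at h hp
    subst h
    exact ⟨a, by omega, key a (by omega)⟩

lemma set_eq (n j : ℕ) : {S : Set (Fin n → ℤ) | isUpperB n S ∧ (S ∩ simpleB n).ncard = j} =
    (fun T => phi n '' T) '' U (2*n) 0 0 j := by
  have hd : ∀ T, T ⊆ R (2*n) 0 0 → (phi n '' T ∩ simpleB n).ncard = (T ∩ dg).ncard := by
    intro T hT
    have : phi n '' T ∩ simpleB n = phi n '' (T ∩ dg) := by
      ext x
      constructor
      · rintro ⟨⟨p, hp, rfl⟩, h⟩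
        exact ⟨p, ⟨hp, (phi_simple n p (hT hp)).1 h⟩, rfl⟩
      · rintro ⟨p, ⟨hp, h⟩, rfl⟩
        exact ⟨⟨p, hp, rfl⟩, (phi_simple n p (hT hp)).2 h⟩
    rw [this, Set.InjOn.ncard_image]
    exact (phi_inj n).mono (fun x hx => hT hx.1)
  ext S
  simp only [Set.mem_ofPred_eq, Set.mem_image, U]
  constructor
  · rintro ⟨⟨h1, h2⟩, h3⟩
    have hS : phi n '' (R (2*n) 0 0 ∩ phi n ⁻¹' S) = S := by
      rw [Set.image_inter_preimage, ← posB_eq]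
      exact Set.inter_eq_right.2 h1
    refine ⟨R (2*n) 0 0 ∩ phi n ⁻¹' S, ⟨⟨Set.inter_subset_left, ?_⟩, ?_⟩, hS⟩
    · rintro a ⟨ha, ha'⟩ b hb hx hy
      exact ⟨hb, h2 _ ha' _ (by rw [posB_eq]; exact ⟨b, hb, rfl⟩) ((le_iff n a b ha hb).2 ⟨hx, hy⟩)⟩
    · rw [← hd _ Set.inter_subset_left, hS, h3]
  · rintro ⟨T, ⟨⟨h1, h2⟩, h3⟩, rfl⟩
    refine ⟨⟨?_, ?_⟩, ?_⟩
    · rw [posB_eq]; exact Set.image_mono h1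
    · rintro _ ⟨a, ha, rfl⟩ b hb hab
      rw [posB_eq] at hb
      obtain ⟨b, hb, rfl⟩ := hb
      have := (le_iff n a b (h1 ha) hb).1 hab
      exact ⟨b, h2 a ha b hb this.1 this.2, rfl⟩
    · rw [hd T h1, h3]

end BB

theorem stmt_6 (n j : ℕ) (hn : 1 ≤ n) (hj : j ≤ n) :
    Nat.card {S : Set (Fin n → ℤ) // isUpperB n S ∧ (S ∩ simpleB n).ncard = j} =
      (2 * n - j - 1).choose (n - 1) := by
  have h1 : Nat.card {S : Set (Fin n → ℤ) // isUpperB n S ∧ (S ∩ simpleB n).ncard = j} =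
    {S : Set (Fin n → ℤ) | isUpperB n S ∧ (S ∩ simpleB n).ncard = j}.ncard := rfl
  rw [h1, BB.set_eq, Set.InjOn.ncard_image, ← BB.N_final n j hn hj, ← BB.U_card (2*n) 0 0 j]
  · congr 2; omega
  · intro T hT T' hT' h
    exact (BB.phi_inj n).image_eq_image_iff hT.1.1 hT'.1.1 |>.1 h
end

section
/- For all n ≥ 1 and 0 ≤ j ≤ n, the number of upper sets S of the root poset of type C_n with |S ∩ Π| = j equals C(2n−j−1, n−1), where C(a,b) denotes the binomial coefficient; in particular it coincides with the corresponding count for type B_n. -/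
/-- The set of positive roots of type `C_n`:
`e i - e j` and `e i + e j` for `i < j`, and `2 e i`. -/
def posC (n : ℕ) : Set (Fin n → ℤ) :=
  {x | (∃ i j : Fin n, i < j ∧ x = stdB n i - stdB n j) ∨
    (∃ i j : Fin n, i < j ∧ x = stdB n i + stdB n j) ∨
    (∃ i : Fin n, x = (2 : ℤ) • stdB n i)}

/-- The set of simple roots of type `C_n`: `α i = e i - e (i+1)` for `i < n - 1`
together with the last simple root `2 e (n-1)`. -/
def simpleC (n : ℕ) : Set (Fin n → ℤ) :=
  {x | (∃ i j : Fin n, (i : ℕ) + 1 = (j : ℕ) ∧ x = stdB n i - stdB n j) ∨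
    (∃ i : Fin n, (i : ℕ) + 1 = n ∧ x = (2 : ℤ) • stdB n i)}

/-- The root poset order of type `C_n`. -/
def rootLeC (n : ℕ) (a b : Fin n → ℤ) : Prop :=
  b - a ∈ AddSubmonoid.closure (simpleC n)

/-- `S` is an upper set of the root poset of type `C_n`. -/
def isUpperC (n : ℕ) (S : Set (Fin n → ℤ)) : Prop :=
  S ⊆ posC n ∧ ∀ a ∈ S, ∀ b ∈ posC n, rootLeC n a b → b ∈ S

/-- The trapezoid model of the root poset. -/
def PP (n : ℕ) : Set (ℕ × ℕ) := {x | x.1 < x.2 ∧ x.1 + x.2 < 2 * n}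

/-- The part of the trapezoid to the lower right of `(i, c)`. -/
def RR (n i c : ℕ) : Set (ℕ × ℕ) := {x | x ∈ PP n ∧ i ≤ x.1 ∧ c ≤ x.2}

/-- The diagonal. -/
def DG : Set (ℕ × ℕ) := {x | x.2 = x.1 + 1}

/-- Upper sets of `RR n i c` with `j` elements on the diagonal. -/
def UU (n i c j : ℕ) : Set (Set (ℕ × ℕ)) :=
  {S | S ⊆ RR n i c ∧ (∀ x ∈ S, ∀ y ∈ RR n i c, y.1 ≤ x.1 → x.2 ≤ y.2 → y ∈ S) ∧
    (S ∩ DG).ncard = j}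

lemma PP_fin (n : ℕ) : (PP n).Finite := by
  apply Set.Finite.subset ((Set.finite_Iio (2 * n)).prod (Set.finite_Iio (2 * n)))
  rintro ⟨a, b⟩ ⟨h1, h2⟩
  simp only [Set.mem_prod, Set.mem_Iio] at *
  omega

lemma RR_fin (n i c : ℕ) : (RR n i c).Finite := (PP_fin n).subset fun _ h => h.1

lemma UU_fin (n i c j : ℕ) : (UU n i c j).Finite :=
  (RR_fin n i c).finite_subsets.subset fun _ h => h.1

lemma UU_empty (n i c j : ℕ) (h : 2 * n ≤ i + c) :
    (UU n i c j).ncard = if j = 0 then 1 else 0 := by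
  have hR : RR n i c = ∅ := by
    ext ⟨a, b⟩
    simp only [RR, PP, Set.mem_ofPred_eq, Set.mem_empty_iff_false, iff_false]
    omega
  split_ifs with hj
  · subst hj
    have : UU n i c 0 = {∅} := by
      ext S
      simp only [UU, hR, Set.mem_ofPred_eq, Set.mem_singleton_iff, Set.subset_empty_iff]
      constructor
      · exact fun h => h.1
      · rintro rfl
        simp
    rw [this, Set.ncard_singleton]
  · have : UU n i c j = ∅ := by
      ext S
      simp only [UU, hR, Set.mem_ofPred_eq, Set.subset_empty_iff, Set.mem_empty_iff_false, iff_false]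
      rintro ⟨rfl, -, h⟩
      simp at h
      omega
    rw [this, Set.ncard_empty]

lemma UU_diag (n i j : ℕ) : UU n i i j = UU n i (i + 1) j := by
  have hR : RR n i i = RR n i (i + 1) := by
    ext ⟨a, b⟩
    simp only [RR, PP, Set.mem_ofPred_eq]
    omega
  simp only [UU, hR]

/-- A row. -/
def RW (n i c : ℕ) : Set (ℕ × ℕ) := {x | x ∈ PP n ∧ x.1 = i ∧ c ≤ x.2}

lemma RW_DG (n i c : ℕ) (h1 : i < c) (h2 : i + c < 2 * n) :
    RW n i c ∩ DG = if c = i + 1 then {(i, i + 1)} else ∅ := by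
  split_ifs with h
  · ext ⟨a, b⟩
    simp only [RW, PP, DG, Set.mem_inter_iff, Set.mem_ofPred_eq, Set.mem_singleton_iff,
      Prod.mk.injEq]
    omega
  · ext ⟨a, b⟩
    simp only [RW, PP, DG, Set.mem_inter_iff, Set.mem_ofPred_eq, Set.mem_empty_iff_false, iff_false]
    omega

lemma RW_DG_card (n i c : ℕ) (h1 : i < c) (h2 : i + c < 2 * n) (T : Set (ℕ × ℕ))
    (hT : T ⊆ RR n (i + 1) c) :
    ((T ∪ RW n i c) ∩ DG).ncard = (T ∩ DG).ncard + if c = i + 1 then 1 else 0 := by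
  have hf : T.Finite := (RR_fin n (i + 1) c).subset hT
  have hf' : (RW n i c).Finite := (PP_fin n).subset fun _ h => h.1
  rw [Set.union_inter_distrib_right, Set.ncard_union_eq _ (hf.subset Set.inter_subset_left)
    (hf'.subset Set.inter_subset_left)]
  · rw [RW_DG n i c h1 h2]
    split_ifs <;> simp
  · rw [Set.disjoint_left]
    rintro ⟨a, b⟩ ⟨h, -⟩ ⟨h', -⟩
    have := hT h
    simp only [RR, RW, PP, Set.mem_ofPred_eq] at this h'
    omega

lemma UU_step (n i c j : ℕ) (h1 : i < c) (h2 : i + c < 2 * n) :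
    UU n i c j = UU n i (c + 1) j ∪
      (fun T => T ∪ RW n i c) '' {T | ∃ j', j' + (if c = i + 1 then 1 else 0) = j ∧
        T ∈ UU n (i + 1) c j'} := by
  ext S
  constructor
  · rintro ⟨hS, hU, hj⟩
    by_cases hm : (i, c) ∈ S
    · right
      have hTR : S \ RW n i c ⊆ RR n (i + 1) c := by
        rintro ⟨a, b⟩ ⟨h, h'⟩
        have := hS h
        simp only [RR, RW, PP, Set.mem_ofPred_eq] at this h' ⊢
        omega
      have hSe : S \ RW n i c ∪ RW n i c = S := by
        apply Set.sdiff_union_of_subset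
        rintro ⟨a, b⟩ h
        simp only [RW, PP, Set.mem_ofPred_eq] at h
        apply hU _ hm
        · simp only [RR, PP, Set.mem_ofPred_eq]; omega
        · simp; omega
        · simp; omega
      refine ⟨S \ RW n i c, ⟨_, ?_, hTR, ?_, rfl⟩, hSe⟩
      · rw [← RW_DG_card n i c h1 h2 _ hTR, hSe, hj]
      · rintro ⟨a, b⟩ ⟨hx, -⟩ ⟨a', b'⟩ hy h3 h4
        simp only [RR, PP, Set.mem_ofPred_eq] at hy h3 h4
        refine ⟨hU _ hx _ ?_ h3 h4, ?_⟩
        · simp only [RR, PP, Set.mem_ofPred_eq]; omega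
        · simp only [RW, PP, Set.mem_ofPred_eq]; omega
    · left
      refine ⟨?_, ?_, hj⟩
      · rintro ⟨a, b⟩ h
        have h' := hS h
        simp only [RR, PP, Set.mem_ofPred_eq] at h' ⊢
        refine ⟨h'.1, h'.2.1, ?_⟩
        rcases Nat.lt_or_ge c b with h3 | h3
        · exact h3
        · exfalso
          apply hm
          apply hU _ h
          · simp only [RR, PP, Set.mem_ofPred_eq]; omega
          · simp; omega
          · simp; omega
      · intro x hx y hy
        apply hU x hx y
        obtain ⟨ha, hb, hc⟩ := hy
        exact ⟨ha, hb, by omega⟩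
  · rintro (⟨hS, hU, hj⟩ | ⟨T, ⟨j', hj', hT, hU, hj⟩, rfl⟩)
    · refine ⟨?_, ?_, hj⟩
      · intro x hx
        obtain ⟨ha, hb, hc⟩ := hS hx
        exact ⟨ha, hb, by omega⟩
      · intro x hx y hy h3 h4
        obtain ⟨ha, hb, hc⟩ := hS hx
        obtain ⟨ha', hb', hc'⟩ := hy
        exact hU x hx y ⟨ha', hb', by omega⟩ h3 h4
    · refine ⟨?_, ?_, ?_⟩
      · rintro ⟨a, b⟩ (h | h)
        · have := hT h
          simp only [RR, PP, Set.mem_ofPred_eq] at this ⊢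
          omega
        · simp only [RW, RR, PP, Set.mem_ofPred_eq] at h ⊢
          omega
      · rintro ⟨a, b⟩ hx ⟨a', b'⟩ hy h3 h4
        by_cases hi : a' = i
        · right
          simp only [RW, RR, PP, Set.mem_ofPred_eq] at hy ⊢
          omega
        · left
          rcases hx with hx | hx
          · apply hU _ hx _ _ h3 h4
            simp only [RR, PP, Set.mem_ofPred_eq] at hy ⊢
            omega
          · simp only [RW, RR, PP, Set.mem_ofPred_eq] at hy hx h3
            omega
      · rw [RW_DG_card n i c h1 h2 _ hT, hj, hj']

lemma UU_card (n i c j k : ℕ) (h1 : i < c) (h2 : i + c < 2 * n)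
    (W : Set (Set (ℕ × ℕ))) (hW : W = {T | ∃ j', j' + (if c = i + 1 then 1 else 0) = j ∧
        T ∈ UU n (i + 1) c j'}) (hk : W.ncard = k) :
    (UU n i c j).ncard = (UU n i (c + 1) j).ncard + k := by
  have hWR : ∀ T ∈ W, T ⊆ RR n (i + 1) c := by
    rw [hW]
    rintro T ⟨j', -, h⟩
    exact h.1
  have hWf : W.Finite := (RR_fin n (i + 1) c).finite_subsets.subset hWR
  rw [UU_step n i c j h1 h2, ← hW, Set.ncard_union_eq _ (UU_fin _ _ _ _) (hWf.image _),
    Set.ncard_image_of_injOn, hk]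
  · intro T hT T' hT' h
    have key : ∀ T ∈ W, (T ∪ RW n i c) \ RW n i c = T := by
      intro T hT
      rw [Set.union_sdiff_right]
      apply sdiff_eq_left.2
      rw [Set.disjoint_left]
      intro x hx hx'
      have h3 := (hWR T hT hx).2.1
      have h4 := hx'.2.1
      omega
    rw [← key T hT, ← key T' hT']
    simp only at h
    rw [h]
  · rw [Set.disjoint_left]
    rintro S ⟨hS, -⟩ ⟨T, -, rfl⟩
    have : (i, c) ∈ RR n i (c + 1) := hS (Or.inr ⟨⟨h1, h2⟩, rfl, le_rfl⟩)
    have := this.2.2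
    simp at this

lemma UU_rec1 (n i c j : ℕ) (h1 : i + 1 < c) (h2 : i + c < 2 * n) :
    (UU n i c j).ncard = (UU n i (c + 1) j).ncard + (UU n (i + 1) c j).ncard := by
  apply UU_card n i c j _ (by omega) h2 _ rfl
  congr 1
  ext T
  have : ¬ (c = i + 1) := by omega
  simp [this]

lemma UU_rec2 (n i j : ℕ) (h2 : i + (i + 1) < 2 * n) :
    (UU n i (i + 1) (j + 1)).ncard =
      (UU n i (i + 2) (j + 1)).ncard + (UU n (i + 1) (i + 2) j).ncard := by
  apply UU_card n i (i + 1) (j + 1) _ (by omega) h2 _ rfl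
  congr 1
  ext T
  simp [UU_diag]

lemma UU_rec3 (n i : ℕ) (h2 : i + (i + 1) < 2 * n) :
    (UU n i (i + 1) 0).ncard = (UU n i (i + 2) 0).ncard := by
  refine (UU_card n i (i + 1) 0 0 (by omega) h2 _ rfl ?_).trans (Nat.add_zero _)
  have : ∀ T : Set (Set (ℕ × ℕ)), T = ∅ → T.ncard = 0 := by rintro _ rfl; simp
  apply this
  ext T
  simp

/-- Partial sums of binomials. -/
def FF (m r : ℕ) : ℕ := ∑ i ∈ Finset.range r, m.choose i

lemma FF_succ (m r : ℕ) : FF m (r + 1) = FF m r + m.choose r := Finset.sum_range_succ _ _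

lemma FF_pascal (m r : ℕ) : FF (m + 1) (r + 1) = FF m (r + 1) + FF m r := by
  induction r with
  | zero => simp [FF]
  | succ r ih =>
    rw [FF_succ, ih, Nat.choose_succ_succ', FF_succ m (r + 1), FF_succ m r]; omega

lemma FF_half (p : ℕ) : FF (2 * p + 1) (p + 1) = 2 ^ (2 * p) := by
  rw [FF, Nat.sum_range_choose_halfway, pow_mul]; norm_num

lemma FF_zero (r : ℕ) : FF 0 (r + 1) = 1 := by
  induction r with
  | zero => simp [FF]
  | succ r ih => rw [FF_succ, ih]; simp

/-- `j = 0`. -/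
lemma count0 (n : ℕ) : ∀ m i c : ℕ, i < c → i + c + m = 2 * n →
    (UU n i c 0).ncard + 2 ^ m = FF m (n - i + 1) + FF m (n - i) := by
  intro m
  induction m with
  | zero =>
    intro i c h h'
    rw [UU_empty n i c 0 (by omega)]
    obtain ⟨p, hp⟩ : ∃ p, n - i = p + 1 := ⟨n - i - 1, by omega⟩
    rw [hp, FF_zero, FF_zero]
    simp
  | succ m ih =>
    intro i c h h'
    obtain ⟨p, hp⟩ : ∃ p, n - i = p + 1 := ⟨n - i - 1, by omega⟩
    have e1 := ih i (c + 1) (by omega) (by omega)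
    rcases Nat.lt_or_ge (i + 1) c with hc | hc
    · rw [UU_rec1 n i c 0 hc (by omega)]
      have e2 := ih (i + 1) c (by omega) (by omega)
      have hp' : n - (i + 1) = p := by omega
      rw [hp'] at e2
      rw [hp] at e1 ⊢
      rw [FF_pascal m (p + 1), FF_pascal m p, pow_succ]
      omega
    · obtain rfl : c = i + 1 := by omega
      rw [UU_rec3 n i (by omega)]
      obtain rfl : m = 2 * p := by omega
      rw [hp] at e1 ⊢
      have a1 := FF_pascal (2 * p) (p + 1)
      have a2 := FF_pascal (2 * p) p
      have a3 := FF_half p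
      rw [show i + 1 + 1 = i + 2 from rfl] at e1
      have a4 : 2 ^ (2 * p + 1) = 2 * 2 ^ (2 * p) := by rw [pow_succ]; ring
      omega

lemma count0_diag (n i p : ℕ) (h : i + p + 1 = n) :
    (UU n i (i + 1) 0).ncard = (2 * p + 1).choose p := by
  have e := count0 n (2 * p + 1) i (i + 1) (by omega) (by omega)
  have hp : n - i = p + 1 := by omega
  rw [hp, FF_succ, FF_half, pow_succ, Nat.choose_symm_half] at e
  omega

lemma count1 (n : ℕ) : ∀ m i c j : ℕ, i < c → i + c + m = 2 * n →
    (UU n i c (j + 1)).ncard = if j + 1 ≤ m then (m - (j + 1)).choose (n - i - 1) else 0 := by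
  intro m
  induction m using Nat.strong_induction_on with
  | _ m ih =>
  intro i c j h h'
  obtain ⟨p, hp⟩ : ∃ p, n = i + p + 1 := ⟨n - i - 1, by omega⟩
  have hp0 : n - i - 1 = p := by omega
  rcases m with _ | m
  · rw [UU_empty n i c _ (by omega)]; simp
  have e1 := ih m (by omega) i (c + 1) j (by omega) (by omega)
  rw [hp0] at e1 ⊢
  rcases Nat.lt_or_ge (i + 1) c with hc | hc
  · rw [UU_rec1 n i c _ hc (by omega), e1, ih m (by omega) (i + 1) c j (by omega) (by omega)]
    obtain ⟨q, rfl⟩ : ∃ q, p = q + 1 := ⟨p - 1, by omega⟩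
    have hq : n - (i + 1) - 1 = q := by omega
    rw [hq]
    rcases Nat.lt_trichotomy j m with hj | hj | hj
    · obtain ⟨d, rfl⟩ : ∃ d, m = j + 1 + d := ⟨m - (j + 1), by omega⟩
      rw [if_pos (by omega), if_pos (by omega), if_pos (by omega)]
      rw [show j + 1 + d + 1 - (j + 1) = d + 1 by omega, show j + 1 + d - (j + 1) = d by omega,
        Nat.choose_succ_succ']
      omega
    · subst hj
      simp
    · rw [if_neg (by omega), if_neg (by omega), if_neg (by omega)]
  · obtain rfl : c = i + 1 := by omega
    rw [UU_rec2 n i j (by omega), show i + 2 = i + 1 + 1 from rfl, e1]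
    obtain rfl : m = 2 * p := by omega
    rcases p with _ | q
    · rw [UU_empty n (i + 1) _ _ (by omega)]
      rcases j with _ | j <;> simp
    · rcases j with _ | j
      · rw [count0_diag n (i + 1) q (by omega)]
        rw [if_pos (by omega), if_pos (by omega)]
        rw [show 2 * (q + 1) + 1 - (0 + 1) = 2 * q + 1 + 1 by omega,
          show 2 * (q + 1) - (0 + 1) = 2 * q + 1 by omega, Nat.choose_succ_succ' (2 * q + 1)]
        omega
      · rw [ih (2 * q + 1) (by omega) (i + 1) (i + 1 + 1) j (by omega) (by omega)]
        have hq : n - (i + 1) - 1 = q := by omega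
        rw [hq]
        rcases Nat.lt_trichotomy j (2 * q + 1) with hj | hj | hj
        · obtain ⟨d, hd⟩ : ∃ d, 2 * q + 1 = j + 1 + d := ⟨2 * q + 1 - (j + 1), by omega⟩
          rw [if_pos (by omega), if_pos (by omega), if_pos (by omega)]
          rw [show 2 * (q + 1) + 1 - (j + 1 + 1) = d + 1 by omega,
            show 2 * (q + 1) - (j + 1 + 1) = d by omega,
            show 2 * q + 1 - (j + 1) = d by omega,
            Nat.choose_succ_succ']
          omega
        · subst hj
          rw [if_neg (by omega), if_neg (by omega), if_pos (by omega)]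
          rw [show 2 * (q + 1) + 1 - (2 * q + 1 + 1 + 1) = 0 by omega]
          simp
        · rw [if_neg (by omega), if_neg (by omega), if_neg (by omega)]

lemma count_main (n j : ℕ) (hn : 1 ≤ n) (hj : j ≤ n) :
    (UU n 0 1 j).ncard = (2 * n - j - 1).choose (n - 1) := by
  rcases j with _ | j
  · rw [count0_diag n 0 (n - 1) (by omega)]
    congr 1; omega
  · rw [count1 n (2 * n - 1) 0 1 j (by omega) (by omega), if_pos (by omega)]
    congr 1; omega

lemma transfer {V : Type*} [AddCommGroup V] (n j : ℕ) (pos simple : Set V) (r : ℕ × ℕ → V)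
    (hpos : r '' PP n = pos)
    (hle : ∀ x ∈ PP n, ∀ y ∈ PP n,
      (r y - r x ∈ AddSubmonoid.closure simple ↔ y.1 ≤ x.1 ∧ x.2 ≤ y.2))
    (hs : r '' (PP n ∩ DG) = simple) :
    Nat.card {S : Set V // (S ⊆ pos ∧ ∀ a ∈ S, ∀ b ∈ pos,
      b - a ∈ AddSubmonoid.closure simple → b ∈ S) ∧ (S ∩ simple).ncard = j} =
    (UU n 0 1 j).ncard := by
  have hR : RR n 0 1 = PP n := by
    ext ⟨a, b⟩
    simp only [RR, PP, Set.mem_ofPred_eq]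
    omega
  have hinj : Set.InjOn r (PP n) := by
    intro x hx y hy h
    have h1 := (hle x hx y hy).1 (by rw [h, sub_self]; exact zero_mem _)
    have h2 := (hle y hy x hx).1 (by rw [h, sub_self]; exact zero_mem _)
    ext <;> omega
  have hcard : ∀ T ⊆ PP n, (r '' T ∩ simple).ncard = (T ∩ DG).ncard := by
    intro T hT
    rw [← hs, ← hinj.image_inter hT Set.inter_subset_left,
      Set.ncard_image_of_injOn (hinj.mono fun x hx => hT hx.1)]
    congr 1
    ext x
    exact ⟨fun h => ⟨h.1, h.2.2⟩, fun h => ⟨h.1, hT h.1, h.2⟩⟩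
  have himg : {S : Set V | (S ⊆ pos ∧ ∀ a ∈ S, ∀ b ∈ pos,
      b - a ∈ AddSubmonoid.closure simple → b ∈ S) ∧ (S ∩ simple).ncard = j} =
      (fun T => r '' T) '' UU n 0 1 j := by
    ext S
    constructor
    · rintro ⟨⟨h1, h2⟩, h3⟩
      have hS : r '' (PP n ∩ r ⁻¹' S) = S := by
        rw [Set.image_inter_preimage, hpos]
        exact Set.inter_eq_right.2 h1
      refine ⟨PP n ∩ r ⁻¹' S, ⟨?_, ?_, ?_⟩, hS⟩
      · rw [hR]; exact Set.inter_subset_left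
      · rw [hR]
        rintro x ⟨hx, hx'⟩ y hy h4 h5
        refine ⟨hy, h2 _ hx' _ ?_ ((hle x hx y hy).2 ⟨h4, h5⟩)⟩
        rw [← hpos]; exact ⟨y, hy, rfl⟩
      · rw [← hcard _ Set.inter_subset_left, hS, h3]
    · rintro ⟨T, ⟨h1, h2, h3⟩, rfl⟩
      rw [hR] at h1 h2
      refine ⟨⟨?_, ?_⟩, ?_⟩
      · rw [← hpos]; exact Set.image_mono h1
      · rintro _ ⟨x, hx, rfl⟩ b hb hl
        rw [← hpos] at hb
        obtain ⟨y, hy, rfl⟩ := hb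
        have := (hle x (h1 hx) y hy).1 hl
        exact ⟨y, h2 x hx y hy this.1 this.2, rfl⟩
      · rw [hcard T h1, h3]
  change Set.ncard {S : Set V | _} = _
  rw [himg, Set.ncard_image_of_injOn]
  intro T hT T' hT' h
  have a1 : T ⊆ PP n := hR ▸ hT.1
  have a2 : T' ⊆ PP n := hR ▸ hT'.1
  exact (hinj.image_eq_image_iff a1 a2).1 h

/-- Standard basis vectors indexed by naturals. -/
def eN (n i : ℕ) : Fin n → ℤ := fun k => if (k : ℕ) = i then 1 else 0

lemma stdB_eN (n : ℕ) (i : Fin n) : stdB n i = eN n i := by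
  ext k
  simp [stdB, eN, Pi.single_apply, Fin.ext_iff]

/-- Partial sums of coordinates. -/
def ps (n k : ℕ) : (Fin n → ℤ) →+ ℤ where
  toFun v := ∑ l : Fin n, if (l : ℕ) < k then v l else 0
  map_zero' := by simp
  map_add' v w := by
    rw [← Finset.sum_add_distrib]
    apply Finset.sum_congr rfl
    intro l _
    split_ifs <;> simp

lemma ps_eN (n k i : ℕ) (hi : i < n) : ps n k (eN n i) = if i < k then 1 else 0 := by
  change (∑ l : Fin n, if (l : ℕ) < k then eN n i l else 0) = _
  rw [Finset.sum_eq_single (⟨i, hi⟩ : Fin n)]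
  · simp [eN]
  · intro b _ hb
    have : (b : ℕ) ≠ i := fun h => hb (Fin.ext h)
    simp [eN, this]
  · simp

lemma nonneg_of_closure (n k : ℕ) (s : Set (Fin n → ℤ)) (hs : ∀ v ∈ s, 0 ≤ ps n k v)
    (v : Fin n → ℤ) (hv : v ∈ AddSubmonoid.closure s) : 0 ≤ ps n k v := by
  induction hv using AddSubmonoid.closure_induction with
  | mem x hx => exact hs x hx
  | zero => simp
  | add x y _ _ h1 h2 => rw [map_add]; omega

lemma ps_simpleC (n k : ℕ) : ∀ v ∈ simpleC n, 0 ≤ ps n k v := by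
  rintro v (⟨i, j, h, rfl⟩ | ⟨i, h, rfl⟩)
  · rw [stdB_eN, stdB_eN, map_sub, ps_eN _ _ _ i.2, ps_eN _ _ _ j.2]
    split_ifs <;> omega
  · rw [stdB_eN, map_zsmul, ps_eN _ _ _ i.2]
    split_ifs <;> simp

lemma ps_simpleB (n k : ℕ) : ∀ v ∈ simpleB n, 0 ≤ ps n k v := by
  rintro v (⟨i, j, h, rfl⟩ | ⟨i, h, rfl⟩)
  · rw [stdB_eN, stdB_eN, map_sub, ps_eN _ _ _ i.2, ps_eN _ _ _ j.2]
    split_ifs <;> omega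
  · rw [stdB_eN, ps_eN _ _ _ i.2]
    split_ifs <;> simp

/-- Column vector, type C. -/
def dC (n c : ℕ) : Fin n → ℤ := if c < n then - eN n c else eN n (2 * n - 1 - c)

/-- Column vector, type B. -/
def dB (n c : ℕ) : Fin n → ℤ :=
  if c < n then - eN n c else if c = n then 0 else eN n (2 * n - c)

/-- A general monotonicity lemma. -/
lemma chain_mem {n : ℕ} (M : AddSubmonoid (Fin n → ℤ)) (d : ℕ → Fin n → ℤ) (N : ℕ)
    (h : ∀ c, c + 1 < N → d (c + 1) - d c ∈ M) (a b : ℕ) (hab : a ≤ b) (hb : b < N) :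
    d b - d a ∈ M := by
  induction b, hab using Nat.le_induction with
  | base => rw [sub_self]; exact zero_mem _
  | succ b hab ih =>
    have := add_mem (h b hb) (ih (by omega))
    rwa [sub_add_sub_cancel] at this

lemma chain_mem' {n : ℕ} (M : AddSubmonoid (Fin n → ℤ)) (d : ℕ → Fin n → ℤ) (N : ℕ)
    (h : ∀ c, c + 1 < N → d c - d (c + 1) ∈ M) (a b : ℕ) (hab : a ≤ b) (hb : b < N) :
    d a - d b ∈ M := by
  induction b, hab using Nat.le_induction with
  | base => rw [sub_self]; exact zero_mem _
  | succ b hab ih =>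
    have := add_mem (ih (by omega)) (h b hb)
    rwa [sub_add_sub_cancel] at this

lemma simpleC_sub (n i : ℕ) (h : i + 1 < n) : eN n i - eN n (i + 1) ∈ simpleC n :=
  Or.inl ⟨⟨i, by omega⟩, ⟨i + 1, h⟩, rfl, by rw [stdB_eN, stdB_eN]⟩

lemma simpleB_sub (n i : ℕ) (h : i + 1 < n) : eN n i - eN n (i + 1) ∈ simpleB n :=
  Or.inl ⟨⟨i, by omega⟩, ⟨i + 1, h⟩, rfl, by rw [stdB_eN, stdB_eN]⟩

lemma dC_step (n c : ℕ) (h : c + 1 < 2 * n) : dC n (c + 1) - dC n c ∈ simpleC n := by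
  unfold dC
  rcases Nat.lt_trichotomy (c + 1) n with h1 | h1 | h1
  · rw [if_pos h1, if_pos (by omega), neg_sub_neg]
    exact simpleC_sub n c h1
  · rw [if_neg (by omega), if_pos (by omega), sub_neg_eq_add]
    refine Or.inr ⟨⟨c, by omega⟩, h1, ?_⟩
    rw [stdB_eN, two_smul, show 2 * n - 1 - (c + 1) = c by omega]
  · rw [if_neg (by omega), if_neg (by omega)]
    have := simpleC_sub n (2 * n - 1 - (c + 1)) (by omega)
    rwa [show 2 * n - 1 - (c + 1) + 1 = 2 * n - 1 - c by omega] at this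

lemma dB_step (n c : ℕ) (h : c + 1 < 2 * n) : dB n (c + 1) - dB n c ∈ simpleB n := by
  unfold dB
  rcases Nat.lt_trichotomy (c + 1) n with h1 | h1 | h1
  · rw [if_pos h1, if_pos (by omega), neg_sub_neg]
    exact simpleB_sub n c h1
  · rw [if_neg (by omega), if_pos (by omega), if_pos (by omega), sub_neg_eq_add, zero_add]
    refine Or.inr ⟨⟨c, by omega⟩, h1, ?_⟩
    rw [stdB_eN]
  · rw [if_neg (by omega), if_neg (by omega), if_neg (by omega)]
    split_ifs with h2
    · subst h2
      refine Or.inr ⟨⟨c - 1, by omega⟩, by simp; omega, ?_⟩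
      rw [stdB_eN, sub_zero, show 2 * c - (c + 1) = c - 1 by omega]
    · have := simpleB_sub n (2 * n - (c + 1)) (by omega)
      rwa [show 2 * n - (c + 1) + 1 = 2 * n - c by omega] at this

lemma ps_dC (n k c : ℕ) (hc : c < 2 * n) : ps n k (dC n c) =
    if c < n then (if c < k then -1 else 0) else (if 2 * n - 1 - c < k then 1 else 0) := by
  unfold dC
  split_ifs with h1 h2 h2 <;> (try rw [map_neg]) <;> rw [ps_eN _ _ _ (by omega)] <;> simp [*]

lemma ps_dB (n k c : ℕ) (hc : c < 2 * n) : ps n k (dB n c) =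
    if c < n then (if c < k then -1 else 0) else
      if c = n then 0 else (if 2 * n - c < k then 1 else 0) := by
  unfold dB
  split_ifs with h1 h2 h2 h2 <;> (try rw [map_zero]) <;> (try rw [map_neg]) <;>
    rw [ps_eN _ _ _ (by omega)] <;> simp [*]

lemma leC (n : ℕ) (x y : ℕ × ℕ) (hx : x ∈ PP n) (hy : y ∈ PP n) :
    (eN n y.1 + dC n y.2) - (eN n x.1 + dC n x.2) ∈ AddSubmonoid.closure (simpleC n) ↔
      y.1 ≤ x.1 ∧ x.2 ≤ y.2 := by
  obtain ⟨i, c⟩ := x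
  obtain ⟨i', c'⟩ := y
  simp only [PP, Set.mem_ofPred_eq] at hx hy ⊢
  constructor
  · intro h
    have key := fun k => nonneg_of_closure n k _ (ps_simpleC n k) _ h
    simp only [map_sub, map_add] at key
    simp only [ps_eN n _ i (by omega), ps_eN n _ i' (by omega), ps_dC n _ c (by omega),
      ps_dC n _ c' (by omega)] at key
    constructor
    · have := key (i + 1)
      split_ifs at this <;> omega
    · by_contra hcc
      rcases Nat.lt_or_ge c' n with h1 | h1
      · have := key (max c' i + 1)
        split_ifs at this <;> omega
      · have := key (2 * n - c)
        split_ifs at this <;> omega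
  · rintro ⟨h1, h2⟩
    rw [add_sub_add_comm]
    apply add_mem
    · exact chain_mem' _ (eN n) n (fun c hc => AddSubmonoid.subset_closure (simpleC_sub n c hc))
        _ _ h1 (by omega)
    · exact chain_mem _ (dC n) (2 * n) (fun c hc => AddSubmonoid.subset_closure (dC_step n c hc))
        _ _ h2 (by omega)

lemma leB (n : ℕ) (x y : ℕ × ℕ) (hx : x ∈ PP n) (hy : y ∈ PP n) :
    (eN n y.1 + dB n y.2) - (eN n x.1 + dB n x.2) ∈ AddSubmonoid.closure (simpleB n) ↔
      y.1 ≤ x.1 ∧ x.2 ≤ y.2 := by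
  obtain ⟨i, c⟩ := x
  obtain ⟨i', c'⟩ := y
  simp only [PP, Set.mem_ofPred_eq] at hx hy ⊢
  constructor
  · intro h
    have key := fun k => nonneg_of_closure n k _ (ps_simpleB n k) _ h
    simp only [map_sub, map_add] at key
    simp only [ps_eN n _ i (by omega), ps_eN n _ i' (by omega), ps_dB n _ c (by omega),
      ps_dB n _ c' (by omega)] at key
    constructor
    · have := key (i + 1)
      split_ifs at this <;> omega
    · by_contra hcc
      rcases Nat.lt_or_ge c' n with h1 | h1
      · have := key (max c' i + 1)
        split_ifs at this <;> omega
      · have := key (2 * n - c + 1)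
        split_ifs at this <;> omega
  · rintro ⟨h1, h2⟩
    rw [add_sub_add_comm]
    apply add_mem
    · exact chain_mem' _ (eN n) n (fun c hc => AddSubmonoid.subset_closure (simpleB_sub n c hc))
        _ _ h1 (by omega)
    · exact chain_mem _ (dB n) (2 * n) (fun c hc => AddSubmonoid.subset_closure (dB_step n c hc))
        _ _ h2 (by omega)

lemma simpC (n : ℕ) :
    (fun x : ℕ × ℕ => eN n x.1 + dC n x.2) '' (PP n ∩ DG) = simpleC n := by
  ext v
  constructor
  · rintro ⟨⟨i, c⟩, ⟨⟨h1, h2⟩, h3⟩, rfl⟩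
    simp only [DG, Set.mem_ofPred_eq] at h1 h2 h3 ⊢
    subst h3
    unfold dC
    split_ifs with h
    · rw [← sub_eq_add_neg]; exact simpleC_sub n i h
    · refine Or.inr ⟨⟨i, by omega⟩, by simp; omega, ?_⟩
      rw [stdB_eN, two_smul, show 2 * n - 1 - (i + 1) = i by omega]
  · rintro (⟨i, j, h, rfl⟩ | ⟨i, h, rfl⟩)
    · refine ⟨(i, j), ⟨⟨?_, ?_⟩, ?_⟩, ?_⟩
      · simp; omega
      · simp; omega
      · simp [DG]; omega
      · simp only [dC, stdB_eN]
        rw [if_pos j.2, sub_eq_add_neg]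
    · refine ⟨(i, n), ⟨⟨?_, ?_⟩, ?_⟩, ?_⟩
      · simp
      · simp; omega
      · simp [DG]; omega
      · simp only [dC, stdB_eN]
        rw [if_neg (by omega), two_smul, show 2 * n - 1 - n = i by omega]

lemma simpB (n : ℕ) :
    (fun x : ℕ × ℕ => eN n x.1 + dB n x.2) '' (PP n ∩ DG) = simpleB n := by
  ext v
  constructor
  · rintro ⟨⟨i, c⟩, ⟨⟨h1, h2⟩, h3⟩, rfl⟩
    simp only [DG, Set.mem_ofPred_eq] at h1 h2 h3 ⊢
    subst h3
    unfold dB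
    split_ifs with h h'
    · rw [← sub_eq_add_neg]; exact simpleB_sub n i h
    · refine Or.inr ⟨⟨i, by omega⟩, h', ?_⟩
      rw [stdB_eN, add_zero]
    · omega
  · rintro (⟨i, j, h, rfl⟩ | ⟨i, h, rfl⟩)
    · refine ⟨(i, j), ⟨⟨?_, ?_⟩, ?_⟩, ?_⟩
      · simp; omega
      · simp; omega
      · simp [DG]; omega
      · simp only [dB, stdB_eN]
        rw [if_pos j.2, sub_eq_add_neg]
    · refine ⟨(i, n), ⟨⟨?_, ?_⟩, ?_⟩, ?_⟩
      · simp
      · simp; omega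
      · simp [DG]; omega
      · simp [dB, stdB_eN]

lemma posC_image (n : ℕ) : (fun x : ℕ × ℕ => eN n x.1 + dC n x.2) '' PP n = posC n := by
  ext v
  constructor
  · rintro ⟨⟨i, c⟩, ⟨h1, h2⟩, rfl⟩
    simp only at h1 h2 ⊢
    unfold dC
    split_ifs with h
    · refine Or.inl ⟨⟨i, by omega⟩, ⟨c, h⟩, h1, ?_⟩
      rw [stdB_eN, stdB_eN, sub_eq_add_neg]
    · rcases Nat.lt_or_ge i (2 * n - 1 - c) with h3 | h3
      · refine Or.inr (Or.inl ⟨⟨i, by omega⟩, ⟨2 * n - 1 - c, by omega⟩, h3, ?_⟩)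
        rw [stdB_eN, stdB_eN]
      · refine Or.inr (Or.inr ⟨⟨i, by omega⟩, ?_⟩)
        rw [stdB_eN, two_smul, show 2 * n - 1 - c = i by omega]
  · rintro (⟨i, j, h, rfl⟩ | ⟨i, j, h, rfl⟩ | ⟨i, rfl⟩)
    · have h' : (i : ℕ) < j := h
      refine ⟨(i, j), ⟨h, by simp; omega⟩, ?_⟩
      simp only [dC, stdB_eN]
      rw [if_pos j.2, sub_eq_add_neg]
    · have h' : (i : ℕ) < j := h
      refine ⟨(i, 2 * n - 1 - j), ⟨by simp; omega, by simp; omega⟩, ?_⟩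
      simp only [dC, stdB_eN]
      rw [if_neg (by omega), show 2 * n - 1 - (2 * n - 1 - (j : ℕ)) = j by omega]
    · refine ⟨(i, 2 * n - 1 - i), ⟨by simp; omega, by simp; omega⟩, ?_⟩
      simp only [dC, stdB_eN]
      rw [if_neg (by omega), show 2 * n - 1 - (2 * n - 1 - (i : ℕ)) = i by omega, two_smul]

lemma posB_image (n : ℕ) : (fun x : ℕ × ℕ => eN n x.1 + dB n x.2) '' PP n = posB n := by
  ext v
  constructor
  · rintro ⟨⟨i, c⟩, ⟨h1, h2⟩, rfl⟩
    simp only at h1 h2 ⊢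
    unfold dB
    split_ifs with h h'
    · refine Or.inl ⟨⟨i, by omega⟩, ⟨c, h⟩, h1, ?_⟩
      rw [stdB_eN, stdB_eN, sub_eq_add_neg]
    · refine Or.inr (Or.inr ⟨⟨i, by omega⟩, ?_⟩)
      rw [stdB_eN, add_zero]
    · refine Or.inr (Or.inl ⟨⟨i, by omega⟩, ⟨2 * n - c, by omega⟩, ?_, ?_⟩)
      · rw [Fin.lt_def]; simp; omega
      · rw [stdB_eN, stdB_eN]
  · rintro (⟨i, j, h, rfl⟩ | ⟨i, j, h, rfl⟩ | ⟨i, rfl⟩)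
    · have h' : (i : ℕ) < j := h
      refine ⟨(i, j), ⟨h, by simp; omega⟩, ?_⟩
      simp only [dB, stdB_eN]
      rw [if_pos j.2, sub_eq_add_neg]
    · have h' : (i : ℕ) < j := h
      refine ⟨(i, 2 * n - j), ⟨by simp; omega, by simp; omega⟩, ?_⟩
      simp only [dB, stdB_eN]
      rw [if_neg (by omega), if_neg (by omega), show 2 * n - (2 * n - (j : ℕ)) = j by omega]
    · refine ⟨(i, n), ⟨by simp, by simp; omega⟩, ?_⟩
      simp [dB, stdB_eN]

theorem stmt_7 (n j : ℕ) (hn : 1 ≤ n) (hj : j ≤ n) :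
    Nat.card {S : Set (Fin n → ℤ) // isUpperC n S ∧ (S ∩ simpleC n).ncard = j} =
        (2 * n - j - 1).choose (n - 1) ∧
      Nat.card {S : Set (Fin n → ℤ) // isUpperC n S ∧ (S ∩ simpleC n).ncard = j} =
        Nat.card {S : Set (Fin n → ℤ) // isUpperB n S ∧ (S ∩ simpleB n).ncard = j} := by
  have hC := transfer n j (posC n) (simpleC n) _ (posC_image n)
    (fun x hx y hy => leC n x y hx hy) (simpC n)
  have hB := transfer n j (posB n) (simpleB n) _ (posB_image n)
    (fun x hx y hy => leB n x y hx hy) (simpB n)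
  have hm := count_main n j hn hj
  exact ⟨hC.trans hm, hC.trans hB.symm⟩
end

section
/- For all n ≥ 2 and 1 ≤ j ≤ n, the number of upper sets S of the root poset of type D_n with |S ∩ Π| = j equals C(2n−2−j, n−2) + C(2n−3−j, n−2), where C(a,b) denotes the binomial coefficient. -/
/-- The standard basis vector `e i` of `ℤ^n`. -/
def stdD (n : ℕ) (i : Fin n) : Fin n → ℤ := Pi.single i 1

/-- The set of positive roots of type `D_n`:
`e i - e j` and `e i + e j` for `i < j`. -/
def posD (n : ℕ) : Set (Fin n → ℤ) :=
  {x | (∃ i j : Fin n, i < j ∧ x = stdD n i - stdD n j) ∨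
    (∃ i j : Fin n, i < j ∧ x = stdD n i + stdD n j)}

/-- The set of simple roots of type `D_n`: `α i = e i - e (i+1)` for `i < n - 1`
together with the last simple root `e (n-2) + e (n-1)`. -/
def simpleD (n : ℕ) : Set (Fin n → ℤ) :=
  {x | (∃ i j : Fin n, (i : ℕ) + 1 = (j : ℕ) ∧ x = stdD n i - stdD n j) ∨
    (∃ i j : Fin n, (i : ℕ) + 1 = (j : ℕ) ∧ (j : ℕ) + 1 = n ∧ x = stdD n i + stdD n j)}

/-- The root poset order of type `D_n`. -/
def rootLeD (n : ℕ) (a b : Fin n → ℤ) : Prop :=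
  b - a ∈ AddSubmonoid.closure (simpleD n)

/-- `S` is an upper set of the root poset of type `D_n`. -/
def isUpperD (n : ℕ) (S : Set (Fin n → ℤ)) : Prop :=
  S ⊆ posD n ∧ ∀ a ∈ S, ∀ b ∈ posD n, rootLeD n a b → b ∈ S

/-! ### Part 1: binomials with integer arguments and the closed forms -/

/-- Binomial coefficient, zero for negative lower index. -/
def chz (a b : ℤ) : ℤ := if b < 0 then 0 else (a.toNat.choose b.toNat : ℤ)

lemma chz_neg (a b : ℤ) (h : b < 0) : chz a b = 0 := by simp [chz, h]

lemma chz_zero (a : ℤ) : chz a 0 = 1 := by simp [chz]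

lemma chz_nat (a b : ℕ) : chz a b = (a.choose b : ℤ) := by
  simp [chz]

lemma chz_succ (a b : ℤ) (h : 0 ≤ a ∨ b ≤ 0) : chz (a + 1) b = chz a b + chz a (b - 1) := by
  rcases lt_trichotomy b 0 with hb | hb | hb
  · rw [chz_neg _ _ hb, chz_neg _ _ hb, chz_neg _ _ (by omega)]; rfl
  · subst hb
    rw [chz_zero, chz_zero, chz_neg _ _ (by omega)]; rfl
  · have ha : 0 ≤ a := by omega
    lift a to ℕ using ha
    obtain ⟨c, rfl⟩ : ∃ c : ℕ, b = c + 1 := ⟨(b - 1).toNat, by omega⟩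
    have h1 := chz_nat (a + 1) (c + 1)
    have h2 := chz_nat a (c + 1)
    have h3 := chz_nat a c
    push_cast at h1 h2 h3
    rw [add_sub_cancel_right, h1, h2, h3, Nat.choose_succ_succ]
    push_cast; ring

lemma chz_pas (a b a' b' : ℤ) (h : 0 ≤ a' ∨ b ≤ 0) (ha : a = a' + 1) (hb : b' = b - 1) :
    chz a b = chz a' b + chz a' b' := by
  subst ha hb; exact chz_succ _ _ h

lemma chz_symm (a b c : ℤ) (hb : 0 ≤ b) (hc : 0 ≤ c) (h : b + c = a) : chz a b = chz a c := by
  lift b to ℕ using hb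
  lift c to ℕ using hc
  obtain rfl : a = ((b + c : ℕ) : ℤ) := by push_cast; omega
  rw [chz_nat, chz_nat, Nat.choose_symm_add]

def fA (k d r : ℤ) : ℤ := chz (2*k+d-r) (k-r) - chz (2*k+d-r) (k-r-1)

def fD (k m u r : ℤ) : ℤ := chz (2*k+m+u-r) (k-r) - chz (2*k+m+u-r) (k-r-1)
  + chz (2*k+m+u-r-1) (k-r-1) - chz (2*k+m+u-r-1) (k-r-2)

def fB (k m r : ℤ) : ℤ := chz (2*k+2*m-r) (k-r) + chz (2*k+2*m-r-1) (k-r-1)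

lemma fA_neg_one (k : ℕ) : fA k 0 (-1) = 0 := by
  unfold fA
  rw [chz_symm (2*k+0-(-1)) (k-(-1)) (k-(-1)-1) (by omega) (by omega) (by omega), sub_self]

lemma fA_succ (k : ℕ) (d r : ℤ) (hd : 0 ≤ d) (hr : 0 ≤ r) :
    fA (k+1) (d+1) r = fA (k+1) d r + fA k (d+2) r := by
  unfold fA
  rw [chz_pas (2*(k+1)+(d+1)-r) (k+1-r) (2*(k+1)+d-r) (k-r) (by omega) (by ring) (by ring),
    chz_pas (2*(k+1)+(d+1)-r) (k+1-r-1) (2*(k+1)+d-r) (k-r-1) (by omega) (by ring) (by ring),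
    show (2*k+(d+2)-r : ℤ) = 2*(k+1)+d-r by ring]
  ring

lemma fA_succ_zero (k : ℕ) (r : ℤ) (hr : 0 ≤ r) :
    fA (k+1) 0 r = fA k 0 (r-1) + fA k 1 r := by
  unfold fA
  rw [chz_pas (2*(k+1)+0-r) (k+1-r) (2*k+1-r) (k-r) (by omega) (by ring) (by ring),
    chz_pas (2*(k+1)+0-r) (k+1-r-1) (2*k+1-r) (k-r-1) (by omega) (by ring) (by ring),
    show (2*k+0-(r-1) : ℤ) = 2*k+1-r by ring, show (k-(r-1) : ℤ) = k+1-r by ring,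
    show (k+1-r-1 : ℤ) = k-r by ring]
  ring

lemma fA_sum (k : ℕ) (r : ℤ) (hr : 0 ≤ r) (d : ℕ) :
    ∑ x ∈ Finset.range (d+2), fA k x (r - if x = 0 then 1 else 0) = fA (k+1) d r := by
  induction d with
  | zero =>
    rw [Finset.sum_range_succ, Finset.sum_range_one]
    simpa using (fA_succ_zero k r hr).symm
  | succ d ih =>
    rw [Finset.sum_range_succ, ih]
    have := fA_succ k d r (by omega) hr
    push_cast
    rw [this]
    simp

lemma fD_succ (k : ℕ) (m u r : ℤ) (hm : 0 ≤ m) (hu : 0 ≤ u) (hr : 0 ≤ r) :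
    fD (k+1) m (u+1) r = fD (k+1) m u r + fD k (m+1) (u+1) r := by
  unfold fD
  rw [chz_pas (2*(k+1)+m+(u+1)-r) (k+1-r) (2*(k+1)+m+u-r) (k-r) (by omega) (by ring) (by ring),
    chz_pas (2*(k+1)+m+(u+1)-r) (k+1-r-1) (2*(k+1)+m+u-r) (k-r-1) (by omega) (by ring) (by ring),
    chz_pas (2*(k+1)+m+(u+1)-r-1) (k+1-r-1) (2*(k+1)+m+u-r-1) (k-r-1) (by omega) (by ring) (by ring),
    chz_pas (2*(k+1)+m+(u+1)-r-1) (k+1-r-2) (2*(k+1)+m+u-r-1) (k-r-2) (by omega) (by ring) (by ring),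
    show (2*k+(m+1)+(u+1)-r : ℤ) = 2*(k+1)+m+u-r by ring]
  ring

lemma fD_zero (k m r : ℤ) : fD (k+1) m 0 r = fA (k+1) m r + fA k (m+1) r := by
  unfold fD fA
  rw [show (2*(k+1)+m+0-r : ℤ) = 2*(k+1)+m-r by ring,
    show (2*k+(m+1)-r : ℤ) = 2*(k+1)+m-r-1 by ring, show (k+1-r-1:ℤ) = k-r by ring,
    show (k+1-r-2:ℤ) = k-r-1 by ring]
  ring

lemma fD_sum (k : ℕ) (m r : ℤ) (hm : 0 ≤ m) (hr : 0 ≤ r) (u : ℕ) :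
    ∑ x ∈ Finset.range u, fD k (m+1) (x+1) r + fA (k+1) m r + fA k (m+1) r = fD (k+1) m u r := by
  induction u with
  | zero => simp [fD_zero]
  | succ u ih =>
    rw [Finset.sum_range_succ]
    push_cast
    rw [fD_succ k m u r hm (by omega) hr, ← ih]
    ring

lemma fB_succ (k m r : ℤ) : fB (k+1) m r = fB k (m+1) r + fD (k+1) m m r := by
  unfold fB fD
  rw [show (2*(k+1)+m+m-r : ℤ) = 2*(k+1)+2*m-r by ring,
    show (2*k+2*(m+1)-r : ℤ) = 2*(k+1)+2*m-r by ring, show (k+1-r-1:ℤ) = k-r by ring,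
    show (k+1-r-2:ℤ) = k-r-1 by ring]
  ring

lemma fA_base (d r : ℤ) (hr : 0 ≤ r) : fA 0 d r = if r = 0 then 1 else 0 := by
  unfold fA
  split_ifs with h
  · subst h; rw [show (0-0:ℤ) = 0 by rfl, chz_zero, chz_neg _ _ (by omega)]; rfl
  · rw [chz_neg _ _ (by omega), chz_neg _ _ (by omega)]; rfl

lemma fD_base (m u r : ℤ) (hr : 0 ≤ r) : fD 0 m u r = if r = 0 then 1 else 0 := by
  unfold fD
  rw [chz_neg _ (0-r-1) (by omega), chz_neg _ (0-r-1) (by omega), chz_neg _ (0-r-2) (by omega)]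
  split_ifs with h
  · subst h; rw [show (0-0:ℤ) = 0 by rfl, chz_zero]; rfl
  · rw [chz_neg _ _ (by omega)]; rfl

lemma fB_base (m r : ℤ) (hr : 0 ≤ r) : fB 0 m r = if r = 0 then 1 else 0 := by
  unfold fB
  rw [chz_neg _ (0-r-1) (by omega)]
  split_ifs with h
  · subst h; rw [show (0-0:ℤ) = 0 by rfl, chz_zero]; rfl
  · rw [chz_neg _ _ (by omega)]; rfl

lemma intBinom_eq (a b : ℤ) (hb : 0 ≤ b) (ha : 0 ≤ a ∨ 0 < b) : intBinom a b = chz a b := by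
  unfold intBinom chz
  rw [if_neg (by omega : ¬ b < 0)]
  split_ifs with h
  · rfl
  · rw [Nat.choose_eq_zero_of_lt (by omega)]; rfl

/-- The final identity (`k = n - 2`). -/
lemma final_id (k : ℕ) (j : ℤ) (h1 : 1 ≤ j) (h2 : j ≤ k + 2) :
    fB k 1 j + 2 * fA k 1 (j-1) + fA k 0 (j-2) =
      intBinom (2*(k+2)-2-j) k + intBinom (2*(k+2)-3-j) k := by
  rw [intBinom_eq _ _ (by omega) (by omega)]
  have key : intBinom (2*(k+2)-3-j) k = chz (2*k+1-j) (k+1-j) := by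
    rcases lt_or_ge (k+1 : ℤ) j with h | h
    · rw [chz_neg _ _ (by omega), intBinom, if_neg (by omega)]
    · rw [intBinom_eq _ _ (by omega) (by omega), chz_symm _ k (k+1-j) (by omega) (by omega) (by ring)]
      congr 1; ring
  rw [key, chz_symm _ k (k+2-j) (by omega) (by omega) (by ring)]
  unfold fB fA
  rw [show (2*k+2*1-j : ℤ) = 2*k+2-j by ring, show (2*k+2-j-1 : ℤ) = 2*k+1-j by ring,
    show (2*k+1-(j-1) : ℤ) = 2*k+2-j by ring, show (2*k+0-(j-2) : ℤ) = 2*k+2-j by ring,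
    show (2*(k+2)-2-j : ℤ) = 2*k+2-j by ring,
    show (k-(j-1) : ℤ) = k+1-j by ring, show (k-(j-2) : ℤ) = k+2-j by ring,
    show (k+1-j-1 : ℤ) = k-j by ring, show (k+2-j-1 : ℤ) = k+1-j by ring]
  have e1 := chz_pas (2*k+2-j) (k+1-j) (2*k+1-j) (k-j) (by omega) (by ring) (by ring)
  have e2 := chz_pas (2*k+2-j) (k-j) (2*k+1-j) (k-j-1) (by omega) (by ring) (by ring)
  linarith

/-! ### Part 2: counting sequences of row states -/

/-- Row condition: the state `(a, b)` is admissible in row `m`. -/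
def RowOK (m : ℕ) (s : ℕ × ℕ) : Prop :=
  s.1 ≤ m ∧ s.2 ≤ m ∧ (2 ≤ s.2 → s.1 = 0) ∧ (1 ≤ s.2 → s.1 ≤ 1)

/-- Transition from row `m` (state `s`) to row `m+1` (state `t`). -/
def StepOK (m : ℕ) (s t : ℕ × ℕ) : Prop :=
  RowOK (m+1) t ∧ (s.1 = m ∨ t.1 ≤ s.1) ∧ s.2 ≤ t.2

open Classical in
/-- The finite set of successors. -/
noncomputable def nextS (m : ℕ) (s : ℕ × ℕ) : Finset (ℕ × ℕ) :=
  ((Finset.range (m+2)) ×ˢ (Finset.range (m+2))).filter (StepOK m s)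

lemma mem_nextS (m : ℕ) (s t : ℕ × ℕ) : t ∈ nextS m s ↔ StepOK m s t := by
  classical
  unfold nextS
  rw [Finset.mem_filter]
  constructor
  · exact fun h => h.2
  · intro h
    refine ⟨?_, h⟩
    obtain ⟨⟨h1, h2, -⟩, -⟩ := h
    rw [Finset.mem_product, Finset.mem_range, Finset.mem_range]
    omega

/-- weight of a state in row `m` -/
def wt (m : ℕ) (s : ℕ × ℕ) : ℤ := if s.2 = m then 1 else 0

/-- prepend a state to a sequence -/
def consF (s : ℕ × ℕ) (f : ℕ → ℕ × ℕ) : ℕ → ℕ × ℕ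
  | 0 => s
  | i + 1 => f i

open Classical in
/-- Sequences with `k` further rows starting in row `m` with state `s`, total further weight `r`. -/
noncomputable def seqs : ℕ → ℕ → ℕ × ℕ → ℤ → Finset (ℕ → ℕ × ℕ)
  | 0, _, s, r => if r = 0 then {consF s (fun _ => (0, 0))} else ∅
  | k + 1, m, s, r =>
    (nextS m s).biUnion (fun t => (seqs k (m+1) t (r - wt (m+1) t)).image (consF s))

lemma consF_inj (s : ℕ × ℕ) : Function.Injective (consF s) := by
  intro f g h
  funext i
  exact congrFun h (i+1)

lemma consF_eta (f : ℕ → ℕ × ℕ) : consF (f 0) (fun i => f (i+1)) = f := by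
  funext i
  cases i <;> rfl

lemma mem_seqs (k m : ℕ) (s : ℕ × ℕ) (r : ℤ) (f : ℕ → ℕ × ℕ) :
    f ∈ seqs k m s r ↔ f 0 = s ∧ (∀ i < k, StepOK (m+i) (f i) (f (i+1))) ∧
      (∀ i, k < i → f i = (0,0)) ∧ ∑ i ∈ Finset.range k, wt (m+i+1) (f (i+1)) = r := by
  induction k generalizing m s r f with
  | zero =>
    simp only [seqs]
    constructor
    · intro h
      split_ifs at h with h0
      · rw [Finset.mem_singleton] at h
        subst h
        refine ⟨rfl, by simp, ?_, by simp [h0]⟩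
        intro i hi
        obtain ⟨i, rfl⟩ : ∃ c, i = c + 1 := ⟨i - 1, by omega⟩
        rfl
      · simp at h
    · rintro ⟨h1, -, h2, h3⟩
      rw [if_pos (by simpa using h3.symm), Finset.mem_singleton, ← consF_eta f, h1]
      congr 1
      funext i
      exact h2 _ (by omega)
  | succ k ih =>
    simp only [seqs, Finset.mem_biUnion, Finset.mem_image, mem_nextS]
    constructor
    · rintro ⟨t, ht, g, hg, rfl⟩
      rw [ih] at hg
      obtain ⟨g0, g1, g2, g3⟩ := hg
      refine ⟨rfl, ?_, ?_, ?_⟩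
      · intro i hi
        cases i with
        | zero => simpa [consF, g0] using ht
        | succ i =>
          have := g1 i (by omega)
          rw [show m + (i+1) = m + 1 + i by ring]
          exact this
      · intro i hi
        obtain ⟨i, rfl⟩ : ∃ c, i = c + 1 := ⟨i - 1, by omega⟩
        exact g2 i (by omega)
      · rw [Finset.sum_range_succ']
        simp only [consF, g0]
        rw [eq_sub_iff_add_eq] at g3
        rw [← g3]
        congr 1
        apply Finset.sum_congr rfl
        intro i _
        congr 1
        ring
    · rintro ⟨h0, h1, h2, h3⟩
      refine ⟨f 1, ?_, fun i => f (i+1), ?_, ?_⟩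
      · have := h1 0 (by omega)
        rw [h0] at this
        exact this
      · rw [ih]
        refine ⟨rfl, ?_, ?_, ?_⟩
        · intro i hi
          have := h1 (i+1) (by omega)
          rw [show m + 1 + i = m + (i+1) by ring]
          exact this
        · intro i hi
          exact h2 _ (by omega)
        · rw [eq_sub_iff_add_eq, ← h3, Finset.sum_range_succ']
          congr 1
          apply Finset.sum_congr rfl
          intro i _
          congr 1
          ring
      · rw [← h0]; exact consF_eta f

/-- number of continuations -/
noncomputable def cnt (k m : ℕ) (s : ℕ × ℕ) (r : ℤ) : ℤ := ((seqs k m s r).card : ℤ)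

lemma cnt_zero (m : ℕ) (s : ℕ × ℕ) (r : ℤ) : cnt 0 m s r = if r = 0 then 1 else 0 := by
  unfold cnt
  simp only [seqs]
  split_ifs <;> simp

lemma cnt_succ (k m : ℕ) (s : ℕ × ℕ) (r : ℤ) :
    cnt (k+1) m s r = ∑ t ∈ nextS m s, cnt k (m+1) t (r - wt (m+1) t) := by
  classical
  unfold cnt
  simp only [seqs]
  rw [Finset.card_biUnion]
  · push_cast
    apply Finset.sum_congr rfl
    intro t _
    rw [Finset.card_image_of_injective _ (consF_inj s)]
  · intro t _ t' _ htt
    rw [Function.onFun, Finset.disjoint_left]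
    intro f hf hf'
    rw [Finset.mem_image] at hf hf'
    obtain ⟨g, hg, rfl⟩ := hf
    obtain ⟨g', hg', h⟩ := hf'
    have := consF_inj s h
    subst this
    rw [mem_seqs] at hg hg'
    exact htt (hg.1.symm.trans hg'.1)

lemma cnt_neg (k m : ℕ) (s : ℕ × ℕ) (r : ℤ) (hr : r < 0) : cnt k m s r = 0 := by
  induction k generalizing m s r with
  | zero => rw [cnt_zero, if_neg (by omega)]
  | succ k ih =>
    rw [cnt_succ]
    apply Finset.sum_eq_zero
    intro t _
    apply ih
    unfold wt
    split_ifs <;> omega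

/-- sum over low states -/
lemma low_sum (k m c : ℕ) (r : ℤ) (hc : c ≤ m) (hr : 0 ≤ r)
    (ih : ∀ (b : ℕ) (r : ℤ), b ≤ m + 1 → 0 ≤ r → cnt k (m+1) (0, b) r = fA k ((m+1 : ℕ) - b : ℤ) r) :
    ∑ t ∈ (Finset.range (c+2)).image (fun d => ((0 : ℕ), m + 1 - d)),
      cnt k (m+1) t (r - wt (m+1) t) = fA (k+1) c r := by
  rw [Finset.sum_image]
  · rw [← fA_sum k r hr c]
    apply Finset.sum_congr rfl
    intro d hd
    rw [Finset.mem_range] at hd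
    have hw : wt (m+1) (0, m+1-d) = if d = 0 then 1 else 0 := by
      unfold wt
      by_cases h : d = 0
      · simp [h]
      · rw [if_neg h, if_neg]
        simp only; omega
    rw [hw]
    by_cases h : d = 0
    · subst h
      rw [if_pos rfl]
      rcases eq_or_lt_of_le hr with h0 | h0
      · rw [← h0, cnt_neg _ _ _ _ (by omega)]
        have := fA_neg_one k
        simpa using this.symm
      · rw [ih _ _ (by omega) (by omega)]
        simp
    · rw [if_neg h, ih _ _ (by omega) (by omega)]
      congr 1
      push_cast [show d ≤ m + 1 by omega]
      ring
  · intro x hx y hy h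
    simp only [Finset.coe_range, Set.mem_Iio, Prod.mk.injEq, true_and] at hx hy h
    omega

lemma nextS_low (m b : ℕ) (hm : 1 ≤ m) (hb : b ≤ m) :
    nextS m (0, b) = (Finset.range (m - b + 2)).image (fun d => ((0 : ℕ), m + 1 - d)) := by
  ext ⟨x, y⟩
  simp only [mem_nextS, StepOK, RowOK, Finset.mem_image, Finset.mem_range, Prod.mk.injEq]
  constructor
  · rintro ⟨h1, h2, h3⟩
    exact ⟨m + 1 - y, by omega, by omega, by omega⟩
  · rintro ⟨d, h1, h2, h3⟩
    omega

lemma nextS_mid (m : ℕ) (hm : 1 ≤ m) :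
    nextS m (1, 1) =
      insert (1, 1) ((Finset.range (m - 1 + 2)).image (fun d => ((0 : ℕ), m + 1 - d))) := by
  ext ⟨x, y⟩
  simp only [mem_nextS, StepOK, RowOK, Finset.mem_insert, Finset.mem_image, Finset.mem_range,
    Prod.mk.injEq]
  constructor
  · rintro ⟨h1, h2, h3⟩
    by_cases hx : x = 0
    · exact Or.inr ⟨m + 1 - y, by omega, by omega, by omega⟩
    · left; omega
  · rintro (h | ⟨d, h1, h2, h3⟩) <;> omega

lemma nextS_up (m a c : ℕ) (hm : 1 ≤ m) (ha : 1 ≤ a) (ham : a ≤ m)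
    (hc : c = if a = m then m + 1 else a) :
    nextS m (a, 0) =
      ((Finset.range c).image (fun x => (x + 1, (0 : ℕ)))) ∪ insert (1, 1)
        ((Finset.range (m + 2)).image (fun d => ((0 : ℕ), m + 1 - d))) := by
  ext ⟨x, y⟩
  simp only [mem_nextS, StepOK, RowOK, Finset.mem_union, Finset.mem_insert, Finset.mem_image,
    Finset.mem_range, Prod.mk.injEq]
  have hc' : (a = m ∧ c = m + 1) ∨ (a < m ∧ c = a) := by
    split_ifs at hc <;> omega
  constructor
  · rintro ⟨h1, h2, h3⟩
    by_cases hx : x = 0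
    · exact Or.inr (Or.inr ⟨m + 1 - y, by omega, by omega, by omega⟩)
    · by_cases hy : y = 0
      · exact Or.inl ⟨x - 1, by omega, by omega, by omega⟩
      · right; left; omega
  · rintro (⟨d, h1, h2, h3⟩ | h | ⟨d, h1, h2, h3⟩) <;> omega

lemma cnt_low (k m b : ℕ) (r : ℤ) (hm : 1 ≤ m) (hb : b ≤ m) (hr : 0 ≤ r) :
    cnt k m (0, b) r = fA k ((m : ℕ) - b : ℤ) r := by
  induction k generalizing m b r with
  | zero => rw [cnt_zero, Nat.cast_zero, fA_base _ _ hr]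
  | succ k ih =>
    rw [cnt_succ, nextS_low m b hm hb,
      low_sum k m (m-b) r (by omega) hr (fun b r hb hr => ih _ _ _ (by omega) hb hr)]
    push_cast [hb]
    rfl

lemma cnt_mid (k m : ℕ) (r : ℤ) (hm : 1 ≤ m) (hr : 0 ≤ r) :
    cnt k m (1, 1) r = fA k m r := by
  induction k generalizing m r with
  | zero => rw [cnt_zero, Nat.cast_zero, fA_base _ _ hr]
  | succ k ih =>
    rw [cnt_succ, nextS_mid m hm, Finset.sum_insert (by simp),
      low_sum k m (m-1) r (by omega) hr (fun b r hb hr => cnt_low _ _ _ _ (by omega) hb hr)]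
    have hw : wt (m+1) (1, 1) = 0 := by
      unfold wt; rw [if_neg]; simp only; omega
    rw [hw, ih _ _ (by omega) (by omega)]
    have := fA_succ k ((m-1 : ℕ) : ℤ) r (by omega) hr
    push_cast [hm] at this ⊢
    rw [show (m - 1 + 1 : ℤ) = m by ring, show (m - 1 + 2 : ℤ) = m + 1 by ring] at this
    rw [this, sub_zero]
    ring

lemma up_sum (k m a c : ℕ) (r : ℤ) (hm : 1 ≤ m) (ha : 1 ≤ a) (ham : a ≤ m) (hr : 0 ≤ r)
    (hc : c = if a = m then m + 1 else a) :
    cnt (k+1) m (a, 0) r = ∑ x ∈ Finset.range c, cnt k (m+1) (x+1, 0) r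
      + fA (k+1) m r + fA k (m+1) r := by
  rw [cnt_succ, nextS_up m a c hm ha ham hc, Finset.sum_union, Finset.sum_insert (by simp),
    low_sum k m m r (by omega) hr (fun b r hb hr => cnt_low _ _ _ _ (by omega) hb hr)]
  · have hw : wt (m+1) (1, 1) = 0 := by
      unfold wt; rw [if_neg]; simp only; omega
    rw [hw, cnt_mid _ _ _ (by omega) (by omega), Finset.sum_image]
    · have : ∀ x ∈ Finset.range c, cnt k (m+1) (x+1, 0) (r - wt (m+1) (x+1, 0))
          = cnt k (m+1) (x+1, 0) r := by
        intro x _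
        have : wt (m+1) (x+1, 0) = 0 := by
          unfold wt; rw [if_neg]; simp only; omega
        rw [this, sub_zero]
      rw [Finset.sum_congr rfl this]
      push_cast
      rw [sub_zero]
      ring
    · intro x _ y _ h
      simp only [Prod.mk.injEq] at h
      omega
  · rw [Finset.disjoint_left]
    rintro ⟨x, y⟩ h1 h2
    simp only [Finset.mem_insert, Finset.mem_image, Finset.mem_range, Prod.mk.injEq] at h1 h2
    obtain ⟨d, h3, h4, h5⟩ := h1
    rcases h2 with h | ⟨d', h6, h7, h8⟩ <;> omega

lemma cnt_up (k m a : ℕ) (r : ℤ) (ha : 1 ≤ a) (ham : a < m) (hr : 0 ≤ r) :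
    cnt k m (a, 0) r = fD k m a r := by
  induction k generalizing m a r with
  | zero => rw [cnt_zero, Nat.cast_zero, fD_base _ _ _ hr]
  | succ k ih =>
    rw [up_sum k m a a r (by omega) ha (by omega) hr (by rw [if_neg (by omega)])]
    push_cast
    rw [← fD_sum k m r (by omega) hr a]
    congr 2
    apply Finset.sum_congr rfl
    intro x hx
    rw [Finset.mem_range] at hx
    rw [ih _ _ _ (by omega) (by omega) hr]
    push_cast; rfl

lemma cnt_top (k m : ℕ) (r : ℤ) (hm : 1 ≤ m) (hr : 0 ≤ r) :
    cnt k m (m, 0) r = fB k m r := by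
  induction k generalizing m r with
  | zero => rw [cnt_zero, Nat.cast_zero, fB_base _ _ hr]
  | succ k ih =>
    rw [up_sum k m m (m+1) r (by omega) hm (by omega) hr (by rw [if_pos rfl]),
      Finset.sum_range_succ, ih _ _ (by omega) hr]
    push_cast
    rw [fB_succ, ← fD_sum k m r (by omega) hr m]
    have : ∀ x ∈ Finset.range m, cnt k (m+1) (x+1, 0) r = fD k (m+1) (x+1) r := by
      intro x hx
      rw [Finset.mem_range] at hx
      rw [cnt_up _ _ _ _ (by omega) (by omega) hr]
      push_cast; rfl
    rw [Finset.sum_congr rfl this]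
    ring

/-- weight of the innermost row -/
def wt1 (s : ℕ × ℕ) : ℤ := (if s.2 = 1 then 1 else 0) + (if s.1 = 0 then 1 else 0)

open Classical in
/-- all sequences with `k+1` rows -/
noncomputable def allS (k : ℕ) (j : ℤ) : Finset (ℕ → ℕ × ℕ) :=
  ((Finset.range 2) ×ˢ (Finset.range 2)).biUnion (fun s => seqs k 1 s (j - wt1 s))

lemma mem_allS (k : ℕ) (j : ℤ) (f : ℕ → ℕ × ℕ) :
    f ∈ allS k j ↔ RowOK 1 (f 0) ∧ (∀ i < k, StepOK (i+1) (f i) (f (i+1))) ∧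
      (∀ i, k < i → f i = (0,0)) ∧
      wt1 (f 0) + ∑ i ∈ Finset.range k, wt (i+2) (f (i+1)) = j := by
  unfold allS
  simp only [Finset.mem_biUnion, mem_seqs, Finset.mem_product, Finset.mem_range]
  have e : ∀ i, 1 + i = i + 1 := fun i => by ring
  simp only [e]
  constructor
  · rintro ⟨s, ⟨h1, h2⟩, h3, h4, h5, h6⟩
    subst h3
    refine ⟨?_, h4, h5, ?_⟩
    · unfold RowOK; omega
    · change _ = _ at h6
      rw [h6]; ring
  · rintro ⟨h1, h2, h3, h4⟩
    unfold RowOK at h1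
    refine ⟨f 0, ⟨by omega, by omega⟩, rfl, h2, h3, ?_⟩
    rw [← h4]; simp

lemma card_allS (k : ℕ) (j : ℤ) (h1 : 1 ≤ j) (h2 : j ≤ k + 2) :
    ((allS k j).card : ℤ) = intBinom (2*(k+2)-2-j) k + intBinom (2*(k+2)-3-j) k := by
  classical
  rw [← final_id k j h1 h2]
  unfold allS
  rw [Finset.card_biUnion]
  · push_cast
    change ∑ s ∈ _, cnt k 1 s (j - wt1 s) = _
    rw [Finset.sum_product]
    simp only [Finset.sum_range_succ, Finset.sum_range_zero, zero_add]
    have a1 := cnt_low k 1 0 (j-1) le_rfl (by omega) (by omega)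
    have a2 : cnt k 1 (0, 1) (j-2) = fA k 0 (j-2) := by
      rcases eq_or_lt_of_le h1 with h | h
      · rw [← h, cnt_neg _ _ _ _ (by omega)]
        exact (fA_neg_one k).symm
      · have := cnt_low k 1 1 (j-2) le_rfl (by omega) (by omega)
        simpa using this
    have a3 := cnt_top k 1 j le_rfl (by omega)
    have a4 := cnt_mid k 1 (j-1) le_rfl (by omega)
    have w1 : wt1 (0,0) = 1 := by simp [wt1]
    have w2 : wt1 (0,1) = 2 := by simp [wt1]
    have w3 : wt1 (1,0) = 0 := by simp [wt1]
    have w4 : wt1 (1,1) = 1 := by simp [wt1]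
    rw [w1, w2, w3, w4, a1, a2, sub_zero, a3, a4]
    push_cast
    ring
  · intro t _ t' _ htt
    rw [Function.onFun, Finset.disjoint_left]
    intro f hf hg
    rw [mem_seqs] at hf hg
    exact htt (hf.1.symm.trans hg.1)

/-! ### Part 3: roots in reversed coordinates -/

/-- The basis vector with reversed index `p`: it is `e (N - p)`. -/
def ep (N p : ℕ) : Fin (N+1) → ℤ := fun l => if (l : ℕ) + p = N then 1 else 0

lemma stdD_eq (N : ℕ) (i : Fin (N+1)) : stdD (N+1) i = ep N (N - i) := by
  funext l
  have := i.2
  have := l.2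
  unfold stdD ep
  rw [Pi.single_apply]
  by_cases h : l = i
  · subst h; rw [if_pos rfl, if_pos (by omega)]
  · rw [if_neg h, if_neg]
    intro h'
    apply h
    ext; omega

lemma ep_eq (N p : ℕ) (hp : p ≤ N) : ep N p = stdD (N+1) ⟨N - p, by omega⟩ := by
  rw [stdD_eq]
  congr 1
  simp only; omega

lemma mem_posD (N : ℕ) (x : Fin (N+1) → ℤ) :
    x ∈ posD (N+1) ↔ ∃ i q, i < N ∧ q ≤ i ∧
      (x = ep N (i+1) - ep N q ∨ x = ep N (i+1) + ep N q) := by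
  unfold posD
  simp only [Set.mem_ofPred_eq, stdD_eq]
  constructor
  · rintro (⟨i, j, hij, h⟩ | ⟨i, j, hij, h⟩)
    all_goals
      have := i.2
      have := j.2
      have hij' : (i : ℕ) < j := hij
      refine ⟨N - i - 1, N - j, by omega, by omega, ?_⟩
      rw [show N - (i : ℕ) - 1 + 1 = N - i by omega]
      tauto
  · rintro ⟨i, q, hi, hq, h | h⟩
    · left
      refine ⟨⟨N - (i+1), by omega⟩, ⟨N - q, by omega⟩, ?_, ?_⟩
      · change N - (i+1) < N - q; omega
      · rw [h]; congr 2 <;> simp only <;> omega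
    · right
      refine ⟨⟨N - (i+1), by omega⟩, ⟨N - q, by omega⟩, ?_, ?_⟩
      · change N - (i+1) < N - q; omega
      · rw [h]; congr 2 <;> simp only <;> omega

lemma mem_simpleD (N : ℕ) (hN : 1 ≤ N) (x : Fin (N+1) → ℤ) :
    x ∈ simpleD (N+1) ↔ (∃ i, i < N ∧ x = ep N (i+1) - ep N i) ∨ x = ep N 1 + ep N 0 := by
  unfold simpleD
  simp only [Set.mem_ofPred_eq, stdD_eq]
  constructor
  · rintro (⟨i, j, hij, h⟩ | ⟨i, j, hij, hj, h⟩)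
    · left
      have := i.2
      have := j.2
      refine ⟨N - j, by omega, ?_⟩
      rw [h]; congr 2; omega
    · right
      rw [h]; congr 2 <;> omega
  · rintro (⟨i, hi, h⟩ | h)
    · left
      refine ⟨⟨N - (i+1), by omega⟩, ⟨N - i, by omega⟩, ?_, ?_⟩
      · change N - (i+1) + 1 = N - i; omega
      · rw [h]; congr 2 <;> simp only <;> omega
    · right
      refine ⟨⟨N - 1, by omega⟩, ⟨N, by omega⟩, ?_, ?_, ?_⟩
      · change N - 1 + 1 = N; omega
      · rfl
      · rw [h]; congr 2 <;> simp only <;> omega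

/-- partial sums -/
def phi (N p : ℕ) : (Fin (N+1) → ℤ) →+ ℤ where
  toFun x := ∑ l : Fin (N+1), if (l : ℕ) + p ≤ N then x l else 0
  map_zero' := by simp
  map_add' x y := by
    rw [← Finset.sum_add_distrib]
    apply Finset.sum_congr rfl
    intro l _
    split_ifs <;> simp

lemma phi_ep (N p m : ℕ) (hm : m ≤ N) : phi N p (ep N m) = if p ≤ m then 1 else 0 := by
  change (∑ l : Fin (N+1), if (l : ℕ) + p ≤ N then ep N m l else 0) = _
  rw [Finset.sum_eq_single (⟨N - m, by omega⟩ : Fin (N+1))]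
  · unfold ep
    simp only
    split_ifs <;> omega
  · intro l _ hl
    have : (l : ℕ) + m ≠ N := by
      intro h; apply hl; ext; simp only; omega
    unfold ep
    rw [if_neg this]; simp
  · simp

/-- the last functional -/
def psi (N : ℕ) : (Fin (N+1) → ℤ) →+ ℤ where
  toFun x := phi N 0 x - 2 * x (Fin.last N)
  map_zero' := by simp
  map_add' x y := by
    rw [map_add, Pi.add_apply]; ring

lemma psi_ep (N m : ℕ) (hm : m ≤ N) : psi N (ep N m) = if m = 0 then -1 else 1 := by
  change phi N 0 (ep N m) - 2 * (ep N m (Fin.last N)) = _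
  rw [phi_ep N 0 m hm]
  unfold ep
  simp only [Fin.val_last]
  split_ifs <;> omega

lemma phi_nonneg (N p : ℕ) (hN : 1 ≤ N) (x : Fin (N+1) → ℤ)
    (hx : x ∈ AddSubmonoid.closure (simpleD (N+1))) : 0 ≤ phi N p x := by
  induction hx using AddSubmonoid.closure_induction with
  | mem x hx =>
    rw [mem_simpleD N hN] at hx
    rcases hx with ⟨i, hi, rfl⟩ | rfl
    · rw [map_sub, phi_ep _ _ _ (by omega), phi_ep _ _ _ (by omega)]
      split_ifs <;> omega
    · rw [map_add, phi_ep _ _ _ (by omega), phi_ep _ _ _ (by omega)]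
      split_ifs <;> omega
  | zero => simp
  | add x y _ _ h1 h2 => rw [map_add]; omega

lemma psi_nonneg (N : ℕ) (hN : 1 ≤ N) (x : Fin (N+1) → ℤ)
    (hx : x ∈ AddSubmonoid.closure (simpleD (N+1))) : 0 ≤ psi N x := by
  induction hx using AddSubmonoid.closure_induction with
  | mem x hx =>
    rw [mem_simpleD N hN] at hx
    rcases hx with ⟨i, hi, rfl⟩ | rfl
    · rw [map_sub, psi_ep _ _ (by omega), psi_ep _ _ (by omega)]
      split_ifs <;> first | omega | contradiction
    · rw [map_add, psi_ep _ _ (by omega), psi_ep _ _ (by omega)]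
      split_ifs <;> first | omega | contradiction
  | zero => simp
  | add x y _ _ h1 h2 => rw [map_add]; omega

/-- minus and plus roots -/
def rM (N i q : ℕ) : Fin (N+1) → ℤ := ep N (i+1) - ep N q
def rP (N i q : ℕ) : Fin (N+1) → ℤ := ep N (i+1) + ep N q

lemma phi_rM (N p i q : ℕ) (hi : i < N) (hq : q ≤ i) :
    phi N p (rM N i q) = (if p ≤ i+1 then 1 else 0) - (if p ≤ q then 1 else 0) := by
  unfold rM; rw [map_sub, phi_ep _ _ _ (by omega), phi_ep _ _ _ (by omega)]

lemma phi_rP (N p i q : ℕ) (hi : i < N) (hq : q ≤ i) :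
    phi N p (rP N i q) = (if p ≤ i+1 then 1 else 0) + (if p ≤ q then 1 else 0) := by
  unfold rP; rw [map_add, phi_ep _ _ _ (by omega), phi_ep _ _ _ (by omega)]

section order
variable (N i q i' q' : ℕ)

lemma le_MM (hN : 1 ≤ N) (hi : i < N) (hq : q ≤ i) (hi' : i' < N) (hq' : q' ≤ i')
    (h : rootLeD (N+1) (rM N i q) (rM N i' q')) : i ≤ i' ∧ q' ≤ q := by
  have h1 := phi_nonneg N (i+1) hN _ h
  have h2 := phi_nonneg N q' hN _ h
  rw [map_sub, phi_rM _ _ _ _ hi hq, phi_rM _ _ _ _ hi' hq'] at h1 h2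
  split_ifs at h1 h2 <;> omega

lemma le_PP (hN : 1 ≤ N) (hi : i < N) (hq : q ≤ i) (hi' : i' < N) (hq' : q' ≤ i')
    (h : rootLeD (N+1) (rP N i q) (rP N i' q')) : i ≤ i' ∧ q ≤ q' := by
  have h1 := phi_nonneg N (i+1) hN _ h
  have h2 := phi_nonneg N q hN _ h
  rw [map_sub, phi_rP _ _ _ _ hi hq, phi_rP _ _ _ _ hi' hq'] at h1 h2
  split_ifs at h1 h2 <;> omega

lemma le_PM (hN : 1 ≤ N) (hi : i < N) (hq : q ≤ i) (hi' : i' < N) (hq' : q' ≤ i')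
    (h : rootLeD (N+1) (rP N i q) (rM N i' q')) : False := by
  have h1 := phi_nonneg N 0 hN _ h
  rw [map_sub, phi_rP _ _ _ _ hi hq, phi_rM _ _ _ _ hi' hq'] at h1
  split_ifs at h1 <;> omega

lemma le_MP (hN : 1 ≤ N) (hi : i < N) (hq : q ≤ i) (hi' : i' < N) (hq' : q' ≤ i')
    (h : rootLeD (N+1) (rM N i q) (rP N i' q')) : i ≤ i' ∧ ¬ (q = 0 ∧ q' = 0) := by
  have h1 := phi_nonneg N (i+1) hN _ h
  have h2 := psi_nonneg N hN _ h
  rw [map_sub, phi_rM _ _ _ _ hi hq, phi_rP _ _ _ _ hi' hq'] at h1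
  unfold rM rP at h2
  rw [map_sub, map_add, map_sub, psi_ep _ _ (by omega), psi_ep _ _ (by omega),
    psi_ep _ _ (by omega), psi_ep _ _ (by omega)] at h2
  split_ifs at h1 h2 <;> omega

lemma cl_sub (hN : 1 ≤ N) (p c : ℕ) (h : p + c ≤ N) :
    ep N (p + c) - ep N p ∈ AddSubmonoid.closure (simpleD (N+1)) := by
  induction c with
  | zero => simp
  | succ c ih =>
    have h1 : ep N (p+c+1) - ep N (p+c) ∈ AddSubmonoid.closure (simpleD (N+1)) :=
      AddSubmonoid.subset_closure ((mem_simpleD N hN _).2 (Or.inl ⟨p+c, by omega, rfl⟩))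
    have := add_mem h1 (ih (by omega))
    rwa [sub_add_sub_cancel] at this

lemma cl_sub' (hN : 1 ≤ N) (p p' : ℕ) (h : p ≤ p') (h' : p' ≤ N) :
    ep N p' - ep N p ∈ AddSubmonoid.closure (simpleD (N+1)) := by
  obtain ⟨c, rfl⟩ := Nat.exists_eq_add_of_le h
  exact cl_sub N hN p c h'

lemma cl_add (hN : 1 ≤ N) (p p' : ℕ) (h : p < p') (h' : p' ≤ N) :
    ep N p' + ep N p ∈ AddSubmonoid.closure (simpleD (N+1)) := by
  have h1 : ep N 1 + ep N 0 ∈ AddSubmonoid.closure (simpleD (N+1)) :=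
    AddSubmonoid.subset_closure ((mem_simpleD N hN _).2 (Or.inr rfl))
  have h2 := cl_sub' N hN 1 p' (by omega) h'
  have h3 := cl_sub' N hN 0 p (by omega) (by omega)
  have := add_mem (add_mem h2 h3) h1
  convert this using 1
  abel

lemma cl_add' (hN : 1 ≤ N) (p p' : ℕ) (h : ¬ (p = 0 ∧ p' = 0)) (hp : p ≤ N) (h' : p' ≤ N) :
    ep N p' + ep N p ∈ AddSubmonoid.closure (simpleD (N+1)) := by
  rcases lt_trichotomy p p' with h0 | h0 | h0
  · exact cl_add N hN p p' h0 h'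
  · subst h0
    have := add_mem (cl_sub' N hN 0 p (by omega) hp) (cl_add N hN 0 p (by omega) hp)
    convert this using 1
    abel
  · rw [add_comm (ep N p')]; exact cl_add N hN p' p h0 hp

lemma MM_le (hN : 1 ≤ N) (hi' : i' < N) (hii : i ≤ i') (hq : q ≤ i) (hqq : q' ≤ q) :
    rootLeD (N+1) (rM N i q) (rM N i' q') := by
  have := add_mem (cl_sub' N hN (i+1) (i'+1) (by omega) (by omega))
    (cl_sub' N hN q' q (by omega) (by omega))
  unfold rootLeD rM
  convert this using 1
  abel

lemma PP_le (hN : 1 ≤ N) (hi' : i' < N) (hii : i ≤ i') (hq : q' ≤ i') (hqq : q ≤ q') :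
    rootLeD (N+1) (rP N i q) (rP N i' q') := by
  have := add_mem (cl_sub' N hN (i+1) (i'+1) (by omega) (by omega))
    (cl_sub' N hN q q' (by omega) (by omega))
  unfold rootLeD rP
  convert this using 1
  abel

lemma MP_le (hN : 1 ≤ N) (hi' : i' < N) (hii : i ≤ i') (hq : q ≤ i) (hq' : q' ≤ i')
    (hqq : ¬ (q = 0 ∧ q' = 0)) :
    rootLeD (N+1) (rM N i q) (rP N i' q') := by
  have := add_mem (cl_sub' N hN (i+1) (i'+1) (by omega) (by omega))
    (cl_add' N hN q q' (by omega) (by omega) (by omega))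
  unfold rootLeD rM rP
  convert this using 1
  abel

lemma rootLe_of_eq (n : ℕ) (x y : Fin n → ℤ) (h : x = y) : rootLeD n x y := by
  subst h; unfold rootLeD; simp

lemma rM_inj (hN : 1 ≤ N) (hi : i < N) (hq : q ≤ i) (hi' : i' < N) (hq' : q' ≤ i')
    (h : rM N i q = rM N i' q') : i = i' ∧ q = q' := by
  have h1 := le_MM N i q i' q' hN hi hq hi' hq' (rootLe_of_eq _ _ _ h)
  have h2 := le_MM N i' q' i q hN hi' hq' hi hq (rootLe_of_eq _ _ _ h.symm)
  omega

lemma rP_inj (hN : 1 ≤ N) (hi : i < N) (hq : q ≤ i) (hi' : i' < N) (hq' : q' ≤ i')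
    (h : rP N i q = rP N i' q') : i = i' ∧ q = q' := by
  have h1 := le_PP N i q i' q' hN hi hq hi' hq' (rootLe_of_eq _ _ _ h)
  have h2 := le_PP N i' q' i q hN hi' hq' hi hq (rootLe_of_eq _ _ _ h.symm)
  omega

lemma rP_ne_rM (hN : 1 ≤ N) (hi : i < N) (hq : q ≤ i) (hi' : i' < N) (hq' : q' ≤ i') :
    rP N i q ≠ rM N i' q' := fun h =>
  le_PM N i q i' q' hN hi hq hi' hq' (rootLe_of_eq _ _ _ h)

end order

/-! ### Part 4: the bijection -/

/-- The set of roots attached to a sequence of row states. -/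
def setOf' (N : ℕ) (f : ℕ → ℕ × ℕ) : Set (Fin (N+1) → ℤ) :=
  {x | ∃ i q, i < N ∧ q ≤ i ∧
    ((x = rM N i q ∧ q < (f i).2) ∨ (x = rP N i q ∧ (f i).1 ≤ q))}

lemma mem_setM (N : ℕ) (hN : 1 ≤ N) (f : ℕ → ℕ × ℕ) (i q : ℕ) (hi : i < N) (hq : q ≤ i) :
    rM N i q ∈ setOf' N f ↔ q < (f i).2 := by
  constructor
  · rintro ⟨i', q', hi', hq', ⟨h1, h2⟩ | ⟨h1, h2⟩⟩
    · obtain ⟨rfl, rfl⟩ := rM_inj N i q i' q' hN hi hq hi' hq' h1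
      exact h2
    · exact absurd h1.symm (rP_ne_rM N i' q' i q hN hi' hq' hi hq)
  · intro h
    exact ⟨i, q, hi, hq, Or.inl ⟨rfl, h⟩⟩

lemma mem_setP (N : ℕ) (hN : 1 ≤ N) (f : ℕ → ℕ × ℕ) (i q : ℕ) (hi : i < N) (hq : q ≤ i) :
    rP N i q ∈ setOf' N f ↔ (f i).1 ≤ q := by
  constructor
  · rintro ⟨i', q', hi', hq', ⟨h1, h2⟩ | ⟨h1, h2⟩⟩
    · exact absurd h1 (rP_ne_rM N i q i' q' hN hi hq hi' hq')
    · obtain ⟨rfl, rfl⟩ := rP_inj N i q i' q' hN hi hq hi' hq' h1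
      exact h2
  · intro h
    exact ⟨i, q, hi, hq, Or.inr ⟨rfl, h⟩⟩

/-- validity of a sequence with `k+1` rows -/
def ValidF (k : ℕ) (f : ℕ → ℕ × ℕ) : Prop :=
  RowOK 1 (f 0) ∧ (∀ i < k, StepOK (i+1) (f i) (f (i+1))) ∧ (∀ i, k < i → f i = (0,0))

lemma ValidF.row {k : ℕ} {f : ℕ → ℕ × ℕ} (h : ValidF k f) (i : ℕ) (hi : i ≤ k) :
    RowOK (i+1) (f i) := by
  cases i with
  | zero => exact h.1
  | succ i => exact (h.2.1 i (by omega)).1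

lemma ValidF.mono2 {k : ℕ} {f : ℕ → ℕ × ℕ} (h : ValidF k f) (i c : ℕ) (hi : i + c ≤ k) :
    (f i).2 ≤ (f (i+c)).2 := by
  induction c with
  | zero => exact le_rfl
  | succ c ih => exact (ih (by omega)).trans (h.2.1 (i+c) (by omega)).2.2

lemma ValidF.mono1 {k : ℕ} {f : ℕ → ℕ × ℕ} (h : ValidF k f) (i c : ℕ) (hi : i + c ≤ k)
    (h' : (f i).1 ≤ i) : (f (i+c)).1 ≤ (f i).1 := by
  induction c with
  | zero => exact le_rfl
  | succ c ih =>
    have h1 := ih (by omega)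
    have h2 := (h.2.1 (i+c) (by omega)).2.1
    rw [← add_assoc]
    omega

lemma upper_setOf (k : ℕ) (f : ℕ → ℕ × ℕ) (h : ValidF k f) :
    isUpperD (k+2) (setOf' (k+1) f) := by
  have hN : 1 ≤ k + 1 := by omega
  constructor
  · rintro x ⟨i, q, hi, hq, ⟨h1, -⟩ | ⟨h1, -⟩⟩
    · exact (mem_posD (k+1) x).2 ⟨i, q, hi, hq, Or.inl h1⟩
    · exact (mem_posD (k+1) x).2 ⟨i, q, hi, hq, Or.inr h1⟩
  · rintro x ⟨i, q, hi, hq, hx⟩ y hy hle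
    obtain ⟨i', q', hi', hq', hy⟩ := (mem_posD (k+1) y).1 hy
    have hrow := h.row i' (by omega)
    unfold RowOK at hrow
    rcases hx with ⟨rfl, h1⟩ | ⟨rfl, h1⟩ <;> rcases hy with rfl | rfl
    · obtain ⟨ha, hb⟩ := le_MM (k+1) i q i' q' hN hi hq hi' hq' hle
      obtain ⟨c, rfl⟩ := Nat.exists_eq_add_of_le ha
      have := h.mono2 i c (by omega)
      exact ⟨_, _, hi', hq', Or.inl ⟨rfl, by omega⟩⟩
    · obtain ⟨ha, hb⟩ := le_MP (k+1) i q i' q' hN hi hq hi' hq' hle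
      obtain ⟨c, rfl⟩ := Nat.exists_eq_add_of_le ha
      have := h.mono2 i c (by omega)
      exact ⟨_, _, hi', hq', Or.inr ⟨rfl, by omega⟩⟩
    · exact (le_PM (k+1) i q i' q' hN hi hq hi' hq' hle).elim
    · obtain ⟨ha, hb⟩ := le_PP (k+1) i q i' q' hN hi hq hi' hq' hle
      obtain ⟨c, rfl⟩ := Nat.exists_eq_add_of_le ha
      have := h.mono1 i c (by omega) (by omega)
      exact ⟨_, _, hi', hq', Or.inr ⟨rfl, by omega⟩⟩

lemma thr_up (m : ℕ) (P : ℕ → Prop) (h : ∀ q q', q ≤ q' → q' ≤ m → P q → P q') :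
    ∃ a ≤ m + 1, ∀ q ≤ m, (P q ↔ a ≤ q) := by
  classical
  have hex : ∃ a, a = m + 1 ∨ (a ≤ m ∧ P a) := ⟨m+1, Or.inl rfl⟩
  have hs := Nat.find_spec hex
  have hmin : ∀ q, (q ≤ m ∧ P q) → Nat.find hex ≤ q := fun q hq => Nat.find_min' hex (Or.inr hq)
  refine ⟨Nat.find hex, by omega, fun q hq => ⟨fun hp => hmin q ⟨hq, hp⟩, fun hle => ?_⟩⟩
  rcases hs with hs | hs
  · omega
  · exact h _ _ hle hq hs.2

lemma exists_valid (k : ℕ) (S : Set (Fin (k+2) → ℤ)) (hS : isUpperD (k+2) S) :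
    ∃ f, ValidF k f ∧ setOf' (k+1) f = S := by
  classical
  have hN : 1 ≤ k + 1 := by omega
  obtain ⟨hpos, hup⟩ := hS
  have memM : ∀ i q, i ≤ k → q ≤ i → rM (k+1) i q ∈ posD (k+2) := fun i q hi hq =>
    (mem_posD (k+1) _).2 ⟨i, q, by omega, hq, Or.inl rfl⟩
  have memP : ∀ i q, i ≤ k → q ≤ i → rP (k+1) i q ∈ posD (k+2) := fun i q hi hq =>
    (mem_posD (k+1) _).2 ⟨i, q, by omega, hq, Or.inr rfl⟩
  have uM : ∀ i q i' q', i' ≤ k → i ≤ i' → q ≤ i → q' ≤ q → rM (k+1) i q ∈ S →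
      rM (k+1) i' q' ∈ S := fun i q i' q' h1 h2 h3 h4 h =>
    hup _ h _ (memM _ _ h1 (by omega)) (MM_le _ _ _ _ _ hN (by omega) h2 h3 h4)
  have uP : ∀ i q i' q', i' ≤ k → i ≤ i' → q' ≤ i' → q ≤ q' → rP (k+1) i q ∈ S →
      rP (k+1) i' q' ∈ S := fun i q i' q' h1 h2 h3 h4 h =>
    hup _ h _ (memP _ _ h1 (by omega)) (PP_le _ _ _ _ _ hN (by omega) h2 h3 h4)
  have uMP : ∀ i q i' q', i' ≤ k → i ≤ i' → q ≤ i → q' ≤ i' → ¬ (q = 0 ∧ q' = 0) →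
      rM (k+1) i q ∈ S → rP (k+1) i' q' ∈ S := fun i q i' q' h1 h2 h3 h4 h5 h =>
    hup _ h _ (memP _ _ h1 (by omega)) (MP_le _ _ _ _ _ hN (by omega) h2 h3 h4 h5)
  have hA : ∀ i, ∃ a, i ≤ k → a ≤ i + 1 ∧ ∀ q ≤ i, (rP (k+1) i q ∈ S ↔ a ≤ q) := by
    intro i
    by_cases hi : i ≤ k
    · obtain ⟨a, h1, h2⟩ := thr_up i (fun q => rP (k+1) i q ∈ S)
        (fun q q' hq hq' h => uP i q i q' hi le_rfl hq' hq h)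
      exact ⟨a, fun _ => ⟨h1, h2⟩⟩
    · exact ⟨0, fun h => absurd h hi⟩
  have hB : ∀ i, ∃ b, i ≤ k → b ≤ i + 1 ∧ ∀ q ≤ i, (rM (k+1) i q ∈ S ↔ q < b) := by
    intro i
    by_cases hi : i ≤ k
    · obtain ⟨b, h1, h2⟩ := thr_up i (fun q => ¬ rM (k+1) i q ∈ S)
        (fun q q' hq hq' h h' => h (uM i q' i q hi le_rfl hq' hq h'))
      refine ⟨b, fun _ => ⟨h1, fun q hq => ?_⟩⟩
      have := h2 q hq
      rw [← not_le, ← this, not_not]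
    · exact ⟨0, fun h => absurd h hi⟩
  choose a ha using hA
  choose b hb using hB
  have hrow : ∀ i ≤ k, RowOK (i+1) (a i, b i) := by
    intro i hi
    obtain ⟨a1, a2⟩ := ha i hi
    obtain ⟨b1, b2⟩ := hb i hi
    refine ⟨a1, b1, ?_, ?_⟩
    · intro h
      simp only at h ⊢
      have h1 := (b2 1 (by omega)).2 (by omega)
      have h2 := (a2 0 (by omega)).1 (uMP i 1 i 0 hi le_rfl (by omega) (by omega) (by omega) h1)
      omega
    · intro h
      simp only at h ⊢
      by_cases h0 : i = 0
      · omega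
      · have h1 := (b2 0 (by omega)).2 (by omega)
        exact (a2 1 (by omega)).1 (uMP i 0 i 1 hi le_rfl (by omega) (by omega) (by omega) h1)
  refine ⟨fun i => if i ≤ k then (a i, b i) else (0, 0), ⟨?_, ?_, ?_⟩, ?_⟩
  · simpa using hrow 0 (by omega)
  · intro i hi
    simp only [if_pos (show i ≤ k by omega), if_pos (show i + 1 ≤ k by omega)]
    obtain ⟨a1, a2⟩ := ha i (by omega)
    obtain ⟨b1, b2⟩ := hb i (by omega)
    obtain ⟨a1', a2'⟩ := ha (i+1) (by omega)
    obtain ⟨b1', b2'⟩ := hb (i+1) (by omega)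
    refine ⟨hrow (i+1) (by omega), ?_, ?_⟩
    · simp only
      by_cases h : a i = i + 1
      · exact Or.inl h
      · right
        have h1 := (a2 (a i) (by omega)).2 le_rfl
        exact (a2' (a i) (by omega)).1
          (uP i (a i) (i+1) (a i) (by omega) (by omega) (by omega) le_rfl h1)
    · simp only
      by_cases h : b i = 0
      · omega
      · have h1 := (b2 (b i - 1) (by omega)).2 (by omega)
        have h2 := (b2' (b i - 1) (by omega)).1
          (uM i (b i - 1) (i+1) (b i - 1) (by omega) (by omega) (by omega) le_rfl h1)
        omega
  · intro i hi
    simp only [if_neg (show ¬ i ≤ k by omega)]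
  · ext x
    constructor
    · rintro ⟨i, q, hi, hq, h⟩
      simp only [if_pos (show i ≤ k by omega)] at h
      rcases h with ⟨rfl, h⟩ | ⟨rfl, h⟩
      · exact ((hb i (by omega)).2 q hq).2 h
      · exact ((ha i (by omega)).2 q hq).2 h
    · intro hx
      obtain ⟨i, q, hi, hq, h⟩ := (mem_posD (k+1) x).1 (hpos hx)
      refine ⟨i, q, hi, hq, ?_⟩
      simp only [if_pos (show i ≤ k by omega)]
      rcases h with rfl | rfl
      · exact Or.inl ⟨rfl, ((hb i (by omega)).2 q hq).1 hx⟩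
      · exact Or.inr ⟨rfl, ((ha i (by omega)).2 q hq).1 hx⟩

lemma setOf_inj (k : ℕ) (f g : ℕ → ℕ × ℕ) (hf : ValidF k f) (hg : ValidF k g)
    (h : setOf' (k+1) f = setOf' (k+1) g) : f = g := by
  have hN : 1 ≤ k + 1 := by omega
  funext i
  by_cases hi : i ≤ k
  · have rf := hf.row i hi
    have rg := hg.row i hi
    unfold RowOK at rf rg
    have hM : ∀ q ≤ i, (q < (f i).2 ↔ q < (g i).2) := by
      intro q hq
      rw [← mem_setM (k+1) hN f i q (by omega) hq, h, mem_setM (k+1) hN g i q (by omega) hq]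
    have hP : ∀ q ≤ i, ((f i).1 ≤ q ↔ (g i).1 ≤ q) := by
      intro q hq
      rw [← mem_setP (k+1) hN f i q (by omega) hq, h, mem_setP (k+1) hN g i q (by omega) hq]
    apply Prod.ext
    · rcases lt_trichotomy (f i).1 (g i).1 with h' | h' | h'
      · have := hP (f i).1 (by omega); omega
      · exact h'
      · have := hP (g i).1 (by omega); omega
    · rcases lt_trichotomy (f i).2 (g i).2 with h' | h' | h'
      · have := hM (f i).2 (by omega); omega
      · exact h'
      · have := hM (g i).2 (by omega); omega
  · rw [hf.2.2 i (by omega), hg.2.2 i (by omega)]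

lemma ncard_simple (k : ℕ) (f : ℕ → ℕ × ℕ) (hf : ValidF k f) :
    (((setOf' (k+1) f ∩ simpleD (k+2)).ncard : ℕ) : ℤ) =
      wt1 (f 0) + ∑ i ∈ Finset.range k, wt (i+2) (f (i+1)) := by
  classical
  have hN : 1 ≤ k + 1 := by omega
  have hset : setOf' (k+1) f ∩ simpleD (k+2) =
      (((((Finset.range (k+1)).filter (fun i => (f i).2 = i+1)).image (fun i => rM (k+1) i i)) ∪
        (if (f 0).1 = 0 then {rP (k+1) 0 0} else ∅) : Finset (Fin (k+2) → ℤ)) :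
          Set (Fin (k+2) → ℤ)) := by
    ext x
    rw [Set.mem_inter_iff, mem_simpleD (k+1) hN, Finset.mem_coe, Finset.mem_union,
      Finset.mem_image]
    constructor
    · rintro ⟨h1, ⟨i, hi, rfl⟩ | rfl⟩
      · left
        refine ⟨i, ?_, rfl⟩
        have := (mem_setM (k+1) hN f i i hi le_rfl).1 h1
        have hr := hf.row i (by omega)
        unfold RowOK at hr
        rw [Finset.mem_filter, Finset.mem_range]
        omega
      · right
        have := (mem_setP (k+1) hN f 0 0 (by omega) le_rfl).1 h1
        rw [if_pos (by omega), Finset.mem_singleton]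
        rfl
    · rintro (⟨i, hi, rfl⟩ | h)
      · rw [Finset.mem_filter, Finset.mem_range] at hi
        exact ⟨(mem_setM (k+1) hN f i i hi.1 le_rfl).2 (by omega), Or.inl ⟨i, hi.1, rfl⟩⟩
      · split_ifs at h with h0
        · rw [Finset.mem_singleton] at h
          subst h
          exact ⟨(mem_setP (k+1) hN f 0 0 (by omega) le_rfl).2 (by omega), Or.inr rfl⟩
        · simp at h
  rw [hset, Set.ncard_coe_finset, Finset.card_union_of_disjoint, Finset.card_image_of_injOn]
  · have h1 : (((if (f 0).1 = 0 then {rP (k+1) 0 0} else ∅ : Finset (Fin (k+2) → ℤ)).card : ℕ) : ℤ)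
        = if (f 0).1 = 0 then 1 else 0 := by
      split_ifs <;> simp
    push_cast
    rw [h1, Finset.card_filter, Finset.sum_range_succ']
    push_cast
    unfold wt1 wt
    ring
  · intro x hx y hy h
    simp only [Finset.coe_filter, Finset.mem_range, Set.mem_ofPred_eq] at hx hy
    exact (rM_inj (k+1) x x y y hN hx.1 le_rfl hy.1 le_rfl h).1
  · rw [Finset.disjoint_left]
    intro x hx hx'
    rw [Finset.mem_image] at hx
    obtain ⟨i, hi, rfl⟩ := hx
    rw [Finset.mem_filter, Finset.mem_range] at hi
    split_ifs at hx' with h0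
    · rw [Finset.mem_singleton] at hx'
      exact rP_ne_rM (k+1) 0 0 i i hN (by omega) le_rfl hi.1 le_rfl hx'.symm
    · simp at hx'

lemma card_main (k j : ℕ) :
    Nat.card {S : Set (Fin (k+2) → ℤ) // isUpperD (k+2) S ∧ (S ∩ simpleD (k+2)).ncard = j}
      = (allS k j).card := by
  have hmem : ∀ f, f ∈ allS k j ↔ ValidF k f ∧ (setOf' (k+1) f ∩ simpleD (k+2)).ncard = j := by
    intro f
    rw [mem_allS]
    unfold ValidF
    constructor
    · rintro ⟨h1, h2, h3, h4⟩
      refine ⟨⟨h1, h2, h3⟩, ?_⟩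
      have := ncard_simple k f ⟨h1, h2, h3⟩
      omega
    · rintro ⟨⟨h1, h2, h3⟩, h4⟩
      refine ⟨h1, h2, h3, ?_⟩
      have := ncard_simple k f ⟨h1, h2, h3⟩
      omega
  have himg : {S : Set (Fin (k+2) → ℤ) | isUpperD (k+2) S ∧ (S ∩ simpleD (k+2)).ncard = j}
      = setOf' (k+1) '' (allS k j : Set (ℕ → ℕ × ℕ)) := by
    ext S
    simp only [Set.mem_ofPred_eq, Set.mem_image, Finset.mem_coe, hmem]
    constructor
    · rintro ⟨h1, h2⟩
      obtain ⟨f, hf, rfl⟩ := exists_valid k S h1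
      exact ⟨f, ⟨hf, h2⟩, rfl⟩
    · rintro ⟨f, ⟨hf, h2⟩, rfl⟩
      exact ⟨upper_setOf k f hf, h2⟩
  change Nat.card ↥{S : Set (Fin (k+2) → ℤ) | isUpperD (k+2) S ∧ (S ∩ simpleD (k+2)).ncard = j} = _
  rw [Nat.card_coe_set_eq, himg, Set.InjOn.ncard_image, Set.ncard_coe_finset]
  intro f hf g hg h
  rw [Finset.mem_coe, hmem] at hf hg
  exact setOf_inj k f g hf.1 hg.1 h

theorem stmt_8 (n j : ℕ) (hn : 2 ≤ n) (hj1 : 1 ≤ j) (hjn : j ≤ n) :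
    (Nat.card {S : Set (Fin n → ℤ) // isUpperD n S ∧ (S ∩ simpleD n).ncard = j} : ℤ) =
      intBinom (2 * (n : ℤ) - 2 - (j : ℤ)) ((n : ℤ) - 2) +
        intBinom (2 * (n : ℤ) - 3 - (j : ℤ)) ((n : ℤ) - 2) := by
  obtain ⟨k, rfl⟩ : ∃ k, n = k + 2 := ⟨n - 2, by omega⟩
  rw [card_main, card_allS k j (by omega) (by push_cast at *; omega)]
  push_cast
  rw [add_sub_cancel_right]
end
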